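/- Let ᾱ ∈ (0,1) be the universal Hölder exponent for which both the interior and the boundary C^{2,ᾱ} estimates in dimension two hold. Let F be of class C², uniformly elliptic with constants λ, Λ, with F(0) = 0, and let g ∈ C^{2,ᾱ}(∂B₁), B₁ ⊂ ℝ². Then there exists a unique classical solution u ∈ C^{2,ᾱ}(B̄₁) of F(D²u) = 0 in B₁ with u = g on ∂B₁; moreover ‖u‖_{C^{2,ᾱ}(B̄₁)} ≤ C‖g‖_{C^{2,ᾱ}(∂B₁)}, where C depends only on λ and Λ. -/

import Mathlib

open Metric Set Real
open scoped Classical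

noncomputable section

abbrev E2 : Type := EuclideanSpace ℝ (Fin 2)
abbrev Mat2 : Type := Matrix (Fin 2) (Fin 2) ℝ

/-- `‖A⁺‖`: the sum of the positive parts of the eigenvalues of a symmetric matrix `A`. -/
noncomputable def posNorm (A : Mat2) : ℝ :=
  if h : A.IsHermitian then ∑ i, max (h.eigenvalues i) 0 else 0

/-- `‖A⁻‖`: the sum of the negative parts of the eigenvalues of a symmetric matrix `A`. -/
noncomputable def negNorm (A : Mat2) : ℝ :=
  if h : A.IsHermitian then ∑ i, max (-(h.eigenvalues i)) 0 else 0

/-- A norm on 2×2 matrices: sum of absolute values of entries. -/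
noncomputable def matNorm (A : Mat2) : ℝ := ∑ i, ∑ j, |A i j|

/-- `F` is uniformly elliptic with constants `0 < lam ≤ Lam`:
`F M - F N ≤ Lam ‖(M-N)⁺‖ - lam ‖(M-N)⁻‖` for all symmetric `M, N`. -/
def UniformlyElliptic (lam Lam : ℝ) (F : Mat2 → ℝ) : Prop :=
  ∀ M N : Mat2, M.IsHermitian → N.IsHermitian →
    F M - F N ≤ Lam * posNorm (M - N) - lam * negNorm (M - N)

/-- The Hessian matrix `D²u(x)` of `u : ℝ² → ℝ` at `x`. -/
noncomputable def hess (u : E2 → ℝ) (x : E2) : Mat2 :=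
  Matrix.of fun i j =>
    fderiv ℝ (fun y => fderiv ℝ u y (EuclideanSpace.single j 1)) x (EuclideanSpace.single i 1)

/-- `sup_s |u|`, the `L^∞` norm of `u` on `s`. -/
noncomputable def supAbs (u : E2 → ℝ) (s : Set E2) : ℝ := ⨆ x ∈ s, |u x|

/-- The point `(cos t, sin t)` on the unit circle `∂B₁`. -/
noncomputable def circPt (t : ℝ) : E2 :=
  (EuclideanSpace.equiv (Fin 2) ℝ).symm ![Real.cos t, Real.sin t]

/-- The trace of `g` on the unit circle, as a `2π`-periodic function on `ℝ`. -/
noncomputable def onCircle (g : E2 → ℝ) : ℝ → ℝ := fun t => g (circPt t)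

/-- `g ∈ C^{2,α}(∂B₁)`, via the arclength parametrization `t ↦ (cos t, sin t)`. -/
def MemHolderCircle (α : ℝ) (g : E2 → ℝ) : Prop :=
  ContDiff ℝ 2 (onCircle g) ∧
    ∃ H : ℝ, ∀ s t : ℝ,
      |deriv (deriv (onCircle g)) s - deriv (deriv (onCircle g)) t| ≤ H * |s - t| ^ α

/-- The `C^{2,α}` norm of `g` on the unit circle `∂B₁`. -/
noncomputable def holderNormCircle (α : ℝ) (g : E2 → ℝ) : ℝ :=
  (⨆ t : ℝ, |onCircle g t|) + (⨆ t : ℝ, |deriv (onCircle g) t|) +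
    (⨆ t : ℝ, |deriv (deriv (onCircle g)) t|) +
    ⨆ p : ℝ × ℝ,
      if p.1 ≠ p.2 then
        |deriv (deriv (onCircle g)) p.1 - deriv (deriv (onCircle g)) p.2| / |p.1 - p.2| ^ α
      else 0

/-- `u` is a classical solution in `C^{2,α}(B̄₁)` of the Dirichlet problem
`F(D²u) = 0` in `B₁`, `u = g` on `∂B₁`. -/
def IsC2alphaSolution (α : ℝ) (F : Mat2 → ℝ) (g u : E2 → ℝ) : Prop :=
  ContDiffOn ℝ 2 u (closedBall (0 : E2) 1) ∧
  (∃ H : ℝ, ∀ x ∈ ball (0 : E2) 1, ∀ y ∈ ball (0 : E2) 1,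
    matNorm (hess u x - hess u y) ≤ H * ‖x - y‖ ^ α) ∧
  (∀ x ∈ ball (0 : E2) 1, F (hess u x) = 0) ∧
  (∀ x ∈ sphere (0 : E2) 1, u x = g x)

namespace FN
open MeasureTheory intervalIntegral

/-- Real differential of a complex gradient. -/
def dG (f : ℝ) (p : ℂ) : ℂ →L[ℝ] ℂ :=
  (1 / 2 : ℝ) • (ContinuousLinearMap.mul ℝ ℂ p + f • (Complex.conjCLE : ℂ →L[ℝ] ℂ))

lemma dG_apply (f : ℝ) (p v : ℂ) :
    dG f p v = (p * v + f * (starRingEnd ℂ) v) / 2 := by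
  simp [dG]; ring

structure GJet (g : ℂ → ℂ) (f : ℂ → ℝ) (p : ℂ → ℂ) : Prop where
  cd : ContDiff ℝ 2 g
  d : ∀ z, HasFDerivAt g (dG (f z) (p z)) z

lemma GJet.f_eq {g f p} (h : GJet g f p) (z : ℂ) :
    (f z : ℂ) = fderiv ℝ g z 1 + Complex.I * fderiv ℝ g z Complex.I := by
  rw [(h.d z).fderiv, dG_apply, dG_apply]
  simp
  linear_combination (-(1/2 : ℂ) * (p z - f z)) * Complex.I_sq

lemma GJet.p_eq {g f p} (h : GJet g f p) (z : ℂ) :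
    p z = fderiv ℝ g z 1 - Complex.I * fderiv ℝ g z Complex.I := by
  rw [(h.d z).fderiv, dG_apply, dG_apply]
  simp
  linear_combination ((1/2 : ℂ) * (p z - f z)) * Complex.I_sq

lemma GJet.cont_p {g f p} (h : GJet g f p) : Continuous p := by
  have h1 : Continuous (fderiv ℝ g) := h.cd.continuous_fderiv (by norm_num)
  have : p = fun z => fderiv ℝ g z 1 - Complex.I * fderiv ℝ g z Complex.I := by
    funext z; exact h.p_eq z
  rw [this]; fun_prop

lemma GJet.cont_f {g f p} (h : GJet g f p) : Continuous f := by
  have h1 : Continuous (fderiv ℝ g) := h.cd.continuous_fderiv (by norm_num)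
  have : f = fun z => (fderiv ℝ g z 1 + Complex.I * fderiv ℝ g z Complex.I).re := by
    funext z; rw [← h.f_eq z]; simp
  rw [this]
  exact Complex.continuous_re.comp (by fun_prop)

/-- Two-variable Jacobian identity. -/
lemma jacobian_identity (P Q : ℝ × ℝ → ℝ) (hP : ContDiff ℝ 1 P) (hQ : ContDiff ℝ 2 Q)
    (r α β : ℝ) :
    ∫ s in (0 : ℝ)..r, ∫ t in α..β, (fderiv ℝ P (s, t) (1, 0) * fderiv ℝ Q (s, t) (0, 1)
        - fderiv ℝ P (s, t) (0, 1) * fderiv ℝ Q (s, t) (1, 0))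
      = (∫ t in α..β, P (r, t) * fderiv ℝ Q (r, t) (0, 1))
        - (∫ t in α..β, P (0, t) * fderiv ℝ Q (0, t) (0, 1))
        - ∫ s in (0 : ℝ)..r, (P (s, β) * fderiv ℝ Q (s, β) (1, 0)
          - P (s, α) * fderiv ℝ Q (s, α) (1, 0)) := by
  have cP := hP.continuous
  have cP' : Continuous (fderiv ℝ P) := hP.continuous_fderiv (by norm_num)
  have hQ1 : ContDiff ℝ 1 (fderiv ℝ Q) := hQ.fderiv_right (by norm_num)
  have cQ' : Continuous (fderiv ℝ Q) := hQ1.continuous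
  have cQ'' : Continuous (fderiv ℝ (fderiv ℝ Q)) := hQ1.continuous_fderiv (by norm_num)
  set S : ℝ × ℝ → ℝ := fun x => fderiv ℝ (fderiv ℝ Q) x (1, 0) (0, 1) with hS
  have hsym : ∀ x, fderiv ℝ (fderiv ℝ Q) x (0, 1) (1, 0) = S x := by
    intro x
    have := (hQ.contDiffAt (x := x)).isSymmSndFDerivAt (by simp)
    exact this.eq _ _
  have cS : Continuous S := by fun_prop
  have dP : ∀ x, HasFDerivAt P (fderiv ℝ P x) x := fun x =>
    (hP.differentiable (by norm_num) x).hasFDerivAt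
  have dQ' : ∀ x, HasFDerivAt (fderiv ℝ Q) (fderiv ℝ (fderiv ℝ Q) x) x := fun x =>
    (hQ1.differentiable (by norm_num) x).hasFDerivAt
  have cs : ∀ s t : ℝ, HasDerivAt (fun s : ℝ => ((s, t) : ℝ × ℝ)) (1, 0) s := fun s t =>
    (hasDerivAt_id s).prodMk (hasDerivAt_const s t)
  have ct : ∀ s t : ℝ, HasDerivAt (fun t : ℝ => ((s, t) : ℝ × ℝ)) (0, 1) t := fun s t =>
    (hasDerivAt_const t s).prodMk (hasDerivAt_id t)
  have A1 : ∀ s t : ℝ, HasDerivAt (fun s : ℝ => P (s, t) * fderiv ℝ Q (s, t) (0, 1))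
      (fderiv ℝ P (s, t) (1, 0) * fderiv ℝ Q (s, t) (0, 1) + P (s, t) * S (s, t)) s := by
    intro s t
    have h1 := (dP (s, t)).comp_hasDerivAt s (cs s t)
    have h2 := (dQ' (s, t)).comp_hasDerivAt s (cs s t)
    have h3 := h2.clm_apply (hasDerivAt_const s ((0 : ℝ), (1 : ℝ)))
    exact (h1.mul h3).congr_deriv (by simp [hS])
  have A2 : ∀ s t : ℝ, HasDerivAt (fun t : ℝ => P (s, t) * fderiv ℝ Q (s, t) (1, 0))
      (fderiv ℝ P (s, t) (0, 1) * fderiv ℝ Q (s, t) (1, 0) + P (s, t) * S (s, t)) t := by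
    intro s t
    have h1 := (dP (s, t)).comp_hasDerivAt t (ct s t)
    have h2 := (dQ' (s, t)).comp_hasDerivAt t (ct s t)
    have h3 := h2.clm_apply (hasDerivAt_const t ((1 : ℝ), (0 : ℝ)))
    exact (h1.mul h3).congr_deriv (by rw [← hsym]; simp)
  set X : ℝ → ℝ → ℝ := fun s t =>
    fderiv ℝ P (s, t) (1, 0) * fderiv ℝ Q (s, t) (0, 1) + P (s, t) * S (s, t) with hX
  set Y : ℝ → ℝ → ℝ := fun s t =>
    fderiv ℝ P (s, t) (0, 1) * fderiv ℝ Q (s, t) (1, 0) + P (s, t) * S (s, t) with hY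
  have cX : Continuous (Function.uncurry X) := by
    simp only [hX, Function.uncurry_def]; fun_prop
  have cY : Continuous (Function.uncurry Y) := by
    simp only [hY, Function.uncurry_def]; fun_prop
  have e1 : ∫ s in (0 : ℝ)..r, ∫ t in α..β, X s t = (∫ t in α..β, P (r, t) * fderiv ℝ Q (r, t) (0, 1))
        - (∫ t in α..β, P (0, t) * fderiv ℝ Q (0, t) (0, 1)) := by
    rw [intervalIntegral_intervalIntegral_swap]
    · rw [← intervalIntegral.integral_sub]
      · refine intervalIntegral.integral_congr fun t _ => ?_
        refine integral_eq_sub_of_hasDerivAt (fun s _ => A1 s t) ?_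
        exact Continuous.intervalIntegrable (by fun_prop) _ _
      · exact Continuous.intervalIntegrable (by fun_prop) _ _
      · exact Continuous.intervalIntegrable (by fun_prop) _ _
    · exact (cX.continuousOn.integrableOn_compact (isCompact_uIcc.prod isCompact_uIcc)).mono_set
        (Set.prod_mono uIoc_subset_uIcc uIoc_subset_uIcc)
  have e2 : ∫ s in (0 : ℝ)..r, ∫ t in α..β, Y s t = ∫ s in (0 : ℝ)..r, (P (s, β) * fderiv ℝ Q (s, β) (1, 0)
          - P (s, α) * fderiv ℝ Q (s, α) (1, 0)) := by
    refine intervalIntegral.integral_congr fun s _ => ?_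
    refine integral_eq_sub_of_hasDerivAt (fun t _ => A2 s t) ?_
    exact Continuous.intervalIntegrable (by fun_prop) _ _
  rw [← e1, ← e2, ← intervalIntegral.integral_sub]
  · refine intervalIntegral.integral_congr fun s _ => ?_
    rw [← intervalIntegral.integral_sub]
    · refine intervalIntegral.integral_congr fun t _ => ?_
      simp only [hX, hY]; ring
    · exact Continuous.intervalIntegrable (by fun_prop) _ _
    · exact Continuous.intervalIntegrable (by fun_prop) _ _
  · exact Continuous.intervalIntegrable (by fun_prop) _ _
  · exact Continuous.intervalIntegrable (by fun_prop) _ _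

/-- Weighted Cauchy-Schwarz on an interval. -/
lemma cs_interval {a b : ℝ} (hab : a ≤ b) {w q : ℝ → ℝ} (hw : Continuous w) (hq : Continuous q)
    (hw0 : ∀ x ∈ Icc a b, 0 ≤ w x) :
    (∫ x in a..b, w x * q x) ^ 2 ≤ (∫ x in a..b, w x) * ∫ x in a..b, w x * q x ^ 2 := by
  have key : ∀ y : ℝ, 0 ≤ (∫ x in a..b, w x) * (y * y) + (2 * ∫ x in a..b, w x * q x) * y
      + ∫ x in a..b, w x * q x ^ 2 := by
    intro y
    have h1 : 0 ≤ ∫ x in a..b, w x * (y + q x) ^ 2 :=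
      integral_nonneg hab fun x hx => mul_nonneg (hw0 x hx) (sq_nonneg _)
    have h2 : (∫ x in a..b, w x * (y + q x) ^ 2) = ∫ x in a..b,
        ((y * y) * w x + (2 * y) * (w x * q x) + w x * q x ^ 2) := by
      refine intervalIntegral.integral_congr fun x _ => ?_
      ring
    rw [h2, intervalIntegral.integral_add, intervalIntegral.integral_add,
      intervalIntegral.integral_const_mul, intervalIntegral.integral_const_mul] at h1
    · linarith
    all_goals exact Continuous.intervalIntegrable (by fun_prop) _ _
  have := discrim_le_zero key
  unfold discrim at this
  nlinarith

def pol (c : ℂ) (s t : ℝ) : ℂ := c + s * Complex.exp (t * Complex.I)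

lemma pol_contDiff (c : ℂ) : ContDiff ℝ 2 (fun x : ℝ × ℝ => pol c x.1 x.2) := by
  unfold pol
  have h1 : ContDiff ℝ 2 (fun x : ℝ × ℝ => (x.1 : ℂ)) := Complex.ofRealCLM.contDiff.comp contDiff_fst
  have h2 : ContDiff ℝ 2 (fun x : ℝ × ℝ => (x.2 : ℂ)) := Complex.ofRealCLM.contDiff.comp contDiff_snd
  exact contDiff_const.add (h1.mul (h2.mul contDiff_const).cexp)

@[fun_prop]
lemma pol_cont (c : ℂ) : Continuous (fun x : ℝ × ℝ => pol c x.1 x.2) := (pol_contDiff c).continuous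

lemma pol_ds (c : ℂ) (s t : ℝ) :
    HasDerivAt (fun s : ℝ => pol c s t) (Complex.exp (t * Complex.I)) s := by
  unfold pol
  have := (((hasDerivAt_id s).ofReal_comp).mul_const (Complex.exp (t * Complex.I))).const_add c
  simpa using this

lemma pol_dt (c : ℂ) (s t : ℝ) :
    HasDerivAt (fun t : ℝ => pol c s t) (s * (Complex.exp (t * Complex.I) * Complex.I)) t := by
  unfold pol
  have h1 : HasDerivAt (fun t : ℝ => (t : ℂ) * Complex.I) Complex.I t := by
    simpa using ((hasDerivAt_id t).ofReal_comp).mul_const Complex.I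
  exact (h1.cexp.const_mul (s : ℂ)).const_add c

/-- the density -/
def Nn (f : ℂ → ℝ) (p : ℂ → ℂ) (z : ℂ) : ℝ := (f z ^ 2 + ‖p z‖ ^ 2) / 2

lemma Nn_nonneg (f p z) : 0 ≤ Nn f p z := by unfold Nn; positivity

lemma norm_dG_le (f : ℝ) (p v : ℂ) : ‖dG f p v‖ ≤ √((f ^ 2 + ‖p‖ ^ 2) / 2) * ‖v‖ := by
  rw [dG_apply]
  have h1 : ‖(p * v + f * (starRingEnd ℂ) v) / 2‖ ≤ (‖p‖ + |f|) / 2 * ‖v‖ := by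
    rw [norm_div]
    have := norm_add_le (p * v) (f * (starRingEnd ℂ) v)
    simp only [norm_mul, Complex.norm_real, RCLike.norm_conj, Real.norm_eq_abs] at this
    rw [show ‖(2 : ℂ)‖ = 2 by simp]
    linarith
  refine h1.trans (mul_le_mul_of_nonneg_right ?_ (norm_nonneg _))
  refine Real.le_sqrt_of_sq_le ?_
  nlinarith [sq_nonneg (‖p‖ - |f|), sq_abs f]

/-- sector boundary condition -/
def Bd (g : ℂ → ℂ) (c : ℂ) (α β : ℝ) : Prop :=
  β = α + 2 * π ∨ (α < β ∧ β ≤ α + 2 * π ∧ ∀ s : ℝ, 0 ≤ s → (g (pol c s α)).im = 0 ∧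
    (g (pol c s β)).im = 0)

lemma Bd.le {g c α β} (h : Bd g c α β) : α ≤ β ∧ β ≤ α + 2 * π := by
  rcases h with h | h
  · constructor <;> linarith [Real.pi_pos]
  · exact ⟨h.1.le, h.2.1⟩

lemma pol_periodic (c : ℂ) (s α : ℝ) : pol c s (α + 2 * π) = pol c s α := by
  unfold pol
  congr 2
  rw [Complex.exp_eq_exp_iff_exists_int]
  refine ⟨1, ?_⟩
  push_cast; ring

def enE (f : ℂ → ℝ) (p : ℂ → ℂ) (c : ℂ) (α β s : ℝ) : ℝ := ∫ t in α..β, Nn f p (pol c s t)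
def enN (f : ℂ → ℝ) (p : ℂ → ℂ) (c : ℂ) (α β s : ℝ) : ℝ := ∫ t in α..β, √(Nn f p (pol c s t))


lemma GJet.cont_Nn {g f p} (h : GJet g f p) : Continuous (Nn f p) := by
  have := h.cont_f; have := h.cont_p
  unfold Nn; fun_prop

lemma GJet.cont_enE {g f p} (h : GJet g f p) (c α β) : Continuous (enE f p c α β) := by
  have := h.cont_Nn; have := pol_cont c
  unfold enE
  apply continuous_parametric_intervalIntegral_of_continuous' (f := fun s t => Nn f p (pol c s t))
  simp only [Function.uncurry_def]; fun_prop

lemma GJet.cont_enN {g f p} (h : GJet g f p) (c α β) : Continuous (enN f p c α β) := by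
  have := h.cont_Nn; have := pol_cont c
  unfold enN
  apply continuous_parametric_intervalIntegral_of_continuous' (f := fun s t => √(Nn f p (pol c s t)))
  simp only [Function.uncurry_def]; fun_prop

lemma GJet.enN_sq {g f p} (h : GJet g f p) (c : ℂ) {α β : ℝ} (hab : α ≤ β) (hb : β ≤ α + 2 * π) (s : ℝ) :
    enN f p c α β s ^ 2 ≤ 2 * π * enE f p c α β s := by
  have := h.cont_Nn; have := pol_cont c
  have hc : Continuous fun t => pol c s t := (pol_cont c).comp (Continuous.prodMk_right s)
  have h1 := cs_interval hab (w := fun _ => 1) (q := fun t => √(Nn f p (pol c s t)))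
    (by fun_prop) (by fun_prop) (by simp)
  simp only [one_mul, intervalIntegral.integral_const, smul_eq_mul, mul_one, Real.sq_sqrt (Nn_nonneg f p _)] at h1
  refine h1.trans ?_
  have : 0 ≤ enE f p c α β s := integral_nonneg hab fun t _ => Nn_nonneg _ _ _
  exact mul_le_mul_of_nonneg_right (by linarith) this

lemma GJet.dt {g f p} (h : GJet g f p) (c : ℂ) (s t : ℝ) : HasDerivAt (fun t : ℝ => g (pol c s t))
    (dG (f (pol c s t)) (p (pol c s t)) (s * (Complex.exp (t * Complex.I) * Complex.I))) t :=
  (h.d (pol c s t)).comp_hasDerivAt t (pol_dt c s t)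

lemma GJet.ds {g f p} (h : GJet g f p) (c : ℂ) (s t : ℝ) : HasDerivAt (fun s : ℝ => g (pol c s t))
    (dG (f (pol c s t)) (p (pol c s t)) (Complex.exp (t * Complex.I))) s :=
  (h.d (pol c s t)).comp_hasDerivAt s (pol_ds c s t)

lemma norm_dt_le {f : ℂ → ℝ} {p : ℂ → ℂ} (c : ℂ) {s : ℝ} (hs : 0 ≤ s) (t : ℝ) :
    ‖dG (f (pol c s t)) (p (pol c s t)) (s * (Complex.exp (t * Complex.I) * Complex.I))‖
      ≤ s * √(Nn f p (pol c s t)) := by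
  refine (norm_dG_le _ _ _).trans ?_
  rw [norm_mul, norm_mul, Complex.norm_exp_ofReal_mul_I]
  simp [Nn, abs_of_nonneg hs, mul_comm]

lemma GJet.cont_dt {g f p} (h : GJet g f p) (c : ℂ) : Continuous fun x : ℝ × ℝ => dG (f (pol c x.1 x.2)) (p (pol c x.1 x.2))
    (x.1 * (Complex.exp (x.2 * Complex.I) * Complex.I)) := by
  have := h.cont_f; have := h.cont_p; have := pol_cont c
  simp only [dG_apply]
  fun_prop

/-- oscillation on a circle arc -/
lemma GJet.osc {g f p} (h : GJet g f p) (c : ℂ) {α β s t t' : ℝ} (hs : 0 ≤ s) (ht : t ∈ Icc α β) (ht' : t' ∈ Icc α β) :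
    ‖g (pol c s t) - g (pol c s t')‖ ≤ s * enN f p c α β s := by
  have c1 := h.cont_Nn; have c2 := pol_cont c
  have hc : Continuous fun t => pol c s t := (pol_cont c).comp (Continuous.prodMk_right s)
  have c3 : Continuous fun t : ℝ => dG (f (pol c s t)) (p (pol c s t))
    (s * (Complex.exp (t * Complex.I) * Complex.I)) := by
    have := h.cont_f; have := h.cont_p
    simp only [dG_apply]
    fun_prop
  wlog hle : t' ≤ t generalizing t t'
  · rw [norm_sub_rev]; exact this ht' ht (by linarith)
  rw [← integral_eq_sub_of_hasDerivAt (fun t _ => h.dt c s t) (c3.intervalIntegrable _ _)]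
  refine (norm_integral_le_of_norm_le hle (g := fun t => s * √(Nn f p (pol c s t)))
    (Filter.Eventually.of_forall fun t _ => norm_dt_le c hs t)
    (Continuous.intervalIntegrable (by fun_prop) _ _)).trans ?_
  rw [enN, intervalIntegral.integral_const_mul]
  refine mul_le_mul_of_nonneg_left ?_ hs
  refine integral_mono_interval ht'.1 hle ht.2 ?_ (Continuous.intervalIntegrable (by fun_prop) _ _)
  exact Filter.Eventually.of_forall fun t => Real.sqrt_nonneg _


end FN

namespace FN
open MeasureTheory intervalIntegral

lemma fderiv_fst_eq {A : ℝ × ℝ → ℝ} (hA : ContDiff ℝ 1 A) {s t a : ℝ}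
    (h : HasDerivAt (fun s => A (s, t)) a s) : fderiv ℝ A (s, t) (1, 0) = a := by
  have h1 := ((hA.differentiable (by norm_num) (s, t)).hasFDerivAt).comp_hasDerivAt s
    ((hasDerivAt_id s).prodMk (hasDerivAt_const s t))
  exact h1.unique h

lemma fderiv_snd_eq {A : ℝ × ℝ → ℝ} (hA : ContDiff ℝ 1 A) {s t a : ℝ}
    (h : HasDerivAt (fun t => A (s, t)) a t) : fderiv ℝ A (s, t) (0, 1) = a := by
  have h1 := ((hA.differentiable (by norm_num) (s, t)).hasFDerivAt).comp_hasDerivAt t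
    ((hasDerivAt_const t s).prodMk (hasDerivAt_id t))
  exact h1.unique h

lemma hd_re {u : ℝ → ℂ} {u' : ℂ} {x : ℝ} (h : HasDerivAt u u' x) :
    HasDerivAt (fun x => (u x).re) u'.re x :=
  (Complex.reCLM.hasFDerivAt (x := u x)).comp_hasDerivAt x h

lemma hd_im {u : ℝ → ℂ} {u' : ℂ} {x : ℝ} (h : HasDerivAt u u' x) :
    HasDerivAt (fun x => (u x).im) u'.im x :=
  (Complex.imCLM.hasFDerivAt (x := u x)).comp_hasDerivAt x h

/-- boundary functional -/
def GG (g : ℂ → ℂ) (f : ℂ → ℝ) (p : ℂ → ℂ) (c : ℂ) (α β r : ℝ) : ℝ :=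
  ∫ t in α..β, -(g (pol c r t)).im *
    (dG (f (pol c r t)) (p (pol c r t)) (r * (Complex.exp (t * Complex.I) * Complex.I))).re

lemma jac_alg (f s t : ℝ) (p : ℂ) :
    -(dG f p (Complex.exp (t * Complex.I))).im *
      (dG f p (s * (Complex.exp (t * Complex.I) * Complex.I))).re
    - -(dG f p (s * (Complex.exp (t * Complex.I) * Complex.I))).im *
      (dG f p (Complex.exp (t * Complex.I))).re = s * ((‖p‖ ^ 2 - f ^ 2) / 4) := by
  have h1 := Real.cos_sq_add_sin_sq t
  rw [Complex.exp_mul_I, ← Complex.ofReal_cos, ← Complex.ofReal_sin]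
  simp only [dG_apply, Complex.sq_norm, Complex.normSq_apply]
  generalize Real.cos t = C at *
  generalize Real.sin t = S at *
  simp
  linear_combination (s * (p.re * p.re + p.im * p.im - f ^ 2) / 4) * h1

lemma GJet.energy {g f p} (h : GJet g f p) {c : ℂ} {α β : ℝ} (hB : Bd g c α β) {r : ℝ} (hr : 0 ≤ r) :
    ∫ s in (0 : ℝ)..r, s * ∫ t in α..β, (‖p (pol c s t)‖ ^ 2 - f (pol c s t) ^ 2) / 4
      = GG g f p c α β r := by
  have cg : ContDiff ℝ 2 (fun x : ℝ × ℝ => g (pol c x.1 x.2)) := h.cd.comp (pol_contDiff c)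
  have cQ : ContDiff ℝ 2 (fun x : ℝ × ℝ => (g (pol c x.1 x.2)).re) := Complex.reCLM.contDiff.comp cg
  have cI : ContDiff ℝ 2 (fun x : ℝ × ℝ => (g (pol c x.1 x.2)).im) := Complex.imCLM.contDiff.comp cg
  have cP : ContDiff ℝ 1 (fun x : ℝ × ℝ => -(g (pol c x.1 x.2)).im) :=
    (cI.neg).of_le (by norm_num)
  have cQ1 := cQ.of_le (m := 1) (by norm_num)
  have Ps : ∀ s t : ℝ, _ := fun s t => fderiv_fst_eq cP (s := s) (t := t) (hd_im (h.ds c s t)).neg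
  have Pt : ∀ s t : ℝ, _ := fun s t => fderiv_snd_eq cP (s := s) (t := t) (hd_im (h.dt c s t)).neg
  have Qs : ∀ s t : ℝ, _ := fun s t => fderiv_fst_eq cQ1 (s := s) (t := t) (hd_re (h.ds c s t))
  have Qt : ∀ s t : ℝ, _ := fun s t => fderiv_snd_eq cQ1 (s := s) (t := t) (hd_re (h.dt c s t))
  have key := jacobian_identity _ _ cP cQ r α β
  simp only [Ps, Pt, Qs, Qt, jac_alg] at key
  simp only [intervalIntegral.integral_const_mul] at key
  rw [key]
  have z1 : (∫ t in α..β, -(g (pol c 0 t)).im *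
    (dG (f (pol c 0 t)) (p (pol c 0 t)) ((0 : ℝ) * (Complex.exp (t * Complex.I) * Complex.I))).re) = 0 := by
    simp
  rw [z1]
  have z2 : (∫ s in (0 : ℝ)..r, (-(g (pol c s β)).im * (dG (f (pol c s β)) (p (pol c s β)) (Complex.exp (β * Complex.I))).re
      - -(g (pol c s α)).im * (dG (f (pol c s α)) (p (pol c s α)) (Complex.exp (α * Complex.I))).re)) = 0 := by
    rw [intervalIntegral.integral_congr (g := fun _ => 0)]
    · simp
    · intro s hs
      rw [uIcc_of_le hr] at hs
      rcases hB with h0 | h0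
      · have e : Complex.exp ((β : ℝ) * Complex.I) = Complex.exp ((α : ℝ) * Complex.I) := by
          have := pol_periodic 0 1 α
          simpa [pol, h0] using this
        simp only [e]
        rw [h0, pol_periodic]; ring
      · simp [(h0.2.2 s hs.1).1, (h0.2.2 s hs.1).2]
  rw [z2]
  simp [GG]

lemma GJet.GG_shift {g f p} (h : GJet g f p) {c : ℂ} {α β : ℝ} (hB : Bd g c α β) {r : ℝ} (hr : 0 ≤ r) :
    GG g f p c α β r = ∫ t in α..β, ((g (pol c r α)).im - (g (pol c r t)).im) *
    (dG (f (pol c r t)) (p (pol c r t)) (r * (Complex.exp (t * Complex.I) * Complex.I))).re := by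
  have c0 := h.cd.continuous
  have c1 := h.cont_f; have c2 := h.cont_p; have c3 := pol_cont c
  have hc : Continuous fun t => pol c r t := (pol_cont c).comp (Continuous.prodMk_right r)
  have c3 : Continuous fun t : ℝ => (dG (f (pol c r t)) (p (pol c r t))
    (r * (Complex.exp (t * Complex.I) * Complex.I))).re := by
    simp only [dG_apply]
    exact Complex.continuous_re.comp (by fun_prop)
  have c4 : Continuous fun t : ℝ => (g (pol c r t)).im := Complex.continuous_im.comp (by fun_prop)
  have e : ∫ t in α..β, (g (pol c r α)).im *
    (dG (f (pol c r t)) (p (pol c r t)) (r * (Complex.exp (t * Complex.I) * Complex.I))).re = 0 := by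
    rw [intervalIntegral.integral_const_mul, integral_eq_sub_of_hasDerivAt
      (fun t _ => hd_re (h.dt c r t)) (c3.intervalIntegrable _ _)]
    rcases hB with h0 | h0
    · rw [h0, pol_periodic]; simp
    · rw [(h0.2.2 r hr).1]; simp
  have e2 := intervalIntegral.integral_add (a := α) (b := β) (μ := volume)
    (f := fun t : ℝ => (g (pol c r α)).im *
    (dG (f (pol c r t)) (p (pol c r t)) (r * (Complex.exp (t * Complex.I) * Complex.I))).re)
    (g := fun t : ℝ => -(g (pol c r t)).im *
    (dG (f (pol c r t)) (p (pol c r t)) (r * (Complex.exp (t * Complex.I) * Complex.I))).re)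
    ((c3.const_mul _).intervalIntegrable _ _) ((c4.neg.mul c3).intervalIntegrable _ _)
  rw [e, zero_add] at e2
  rw [GG, ← e2]
  refine intervalIntegral.integral_congr fun t _ => ?_
  ring

lemma GJet.GG_le {g f p} (h : GJet g f p) {c : ℂ} {α β : ℝ} (hB : Bd g c α β) {r : ℝ} (hr : 0 ≤ r)
    {o : ℝ} (ho : ∀ t ∈ Icc α β, |(g (pol c r α)).im - (g (pol c r t)).im| ≤ o) :
    GG g f p c α β r ≤ o * (r * enN f p c α β r) := by
  have c1 := h.cont_Nn; have c2 := pol_cont c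
  have hc : Continuous fun t => pol c r t := (pol_cont c).comp (Continuous.prodMk_right r)
  rw [h.GG_shift hB hr]
  refine (le_abs_self _).trans ?_
  rw [← Real.norm_eq_abs]
  have o0 : 0 ≤ o := (abs_nonneg _).trans (ho α ⟨le_rfl, hB.le.1⟩)
  refine (norm_integral_le_of_norm_le hB.le.1 (g := fun t => o * (r * √(Nn f p (pol c r t)))) ?_ ?_).trans ?_
  · refine Filter.Eventually.of_forall fun t ht => ?_
    rw [norm_mul]
    refine mul_le_mul (ho t ⟨ht.1.le, ht.2⟩) ?_ (norm_nonneg _) o0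
    exact (Complex.abs_re_le_norm _).trans (norm_dt_le c hr t)
  · exact Continuous.intervalIntegrable (by fun_prop) _ _
  · rw [intervalIntegral.integral_const_mul, intervalIntegral.integral_const_mul, enN]

lemma GJet.enN_nonneg {g f p} (_h : GJet g f p) (c : ℂ) {α β : ℝ} (hab : α ≤ β) (s : ℝ) :
    0 ≤ enN f p c α β s := integral_nonneg hab fun t _ => Real.sqrt_nonneg _

lemma GJet.enE_nonneg {g f p} (_h : GJet g f p) (c : ℂ) {α β : ℝ} (hab : α ≤ β) (s : ℝ) :
    0 ≤ enE f p c α β s := integral_nonneg hab fun t _ => Nn_nonneg _ _ _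

lemma GJet.GG_le' {g f p} (h : GJet g f p) {c : ℂ} {α β : ℝ} (hB : Bd g c α β) {r : ℝ} (hr : 0 ≤ r) :
    GG g f p c α β r ≤ 2 * π * (r ^ 2 * enE f p c α β r) := by
  have := h.GG_le hB hr (o := r * enN f p c α β r) (fun t ht => by
    rw [← Complex.sub_im]
    exact (Complex.abs_im_le_norm _).trans (h.osc c hr ⟨le_rfl, hB.le.1⟩ ht))
  have h2 := h.enN_sq c hB.le.1 hB.le.2 r
  nlinarith [mul_le_mul_of_nonneg_left h2 (sq_nonneg r)]

def En (f : ℂ → ℝ) (p : ℂ → ℂ) (c : ℂ) (α β r : ℝ) : ℝ := ∫ s in (0 : ℝ)..r, s * enE f p c α β s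

lemma pt_ineq {k b f x : ℝ} (hk0 : 0 ≤ k) (hk : k < 1) (hb : 0 ≤ b) (hf : |f| ≤ k * x + b) (hx : 0 ≤ x) :
    (1 - k) * ((f ^ 2 + x ^ 2) / 2) ≤ 4 * ((x ^ 2 - f ^ 2) / 4) + 2 * b ^ 2 / (1 - k) := by
  have h1 : 0 < 1 - k := by linarith
  have h2 : f ^ 2 ≤ (k * x + b) ^ 2 := by
    rw [← sq_abs f]; exact pow_le_pow_left₀ (abs_nonneg _) hf 2
  set B := b / (1 - k) with hB
  have hbB : b = (1 - k) * B := by rw [hB]; field_simp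
  have h3 : 2 * b ^ 2 / (1 - k) = 2 * (1 - k) * B ^ 2 := by rw [hbB]; field_simp
  have h4 : (k * x + b) ^ 2 ≤ k * x ^ 2 + (1 - k) * B ^ 2 := by
    rw [hbB]; nlinarith [mul_nonneg (mul_nonneg hk0 h1.le) (sq_nonneg (x - B))]
  rw [h3]
  have h5 : f ^ 2 ≤ k * x ^ 2 + (1 - k) * B ^ 2 := h2.trans h4
  have := mul_le_mul_of_nonneg_left h5 (show 0 ≤ (1 - k) / 2 + 1 by linarith)
  nlinarith [mul_nonneg hk0 (sq_nonneg x), mul_nonneg (mul_nonneg hk0 h1.le) (sq_nonneg x), mul_nonneg h1.le (sq_nonneg B), mul_nonneg (mul_nonneg hk0 h1.le) (sq_nonneg B), mul_nonneg (mul_nonneg h1.le h1.le) (sq_nonneg x)]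

lemma GJet.En_le_GG {g f p} (h : GJet g f p) {c : ℂ} {α β : ℝ} (hB : Bd g c α β) {r k b : ℝ} (hr : 0 ≤ r)
    (hk0 : 0 ≤ k) (hk : k < 1) (hb : 0 ≤ b)
    (hf : ∀ s ∈ Icc 0 r, ∀ t ∈ Icc α β, |f (pol c s t)| ≤ k * ‖p (pol c s t)‖ + b) :
    (1 - k) * En f p c α β r ≤ 4 * GG g f p c α β r + 2 * π * (b ^ 2 * r ^ 2) / (1 - k) := by
  have c0 := h.cont_f; have c2 := h.cont_p
  have c1 := h.cont_Nn; have c2 := pol_cont c; have c3 := h.cont_enE c α β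
  have h1 : 0 < 1 - k := by linarith
  rw [← h.energy hB hr, En]
  have cI : Continuous fun s : ℝ => ∫ t in α..β, (‖p (pol c s t)‖ ^ 2 - f (pol c s t) ^ 2) / 4 := by
    apply continuous_parametric_intervalIntegral_of_continuous'
      (f := fun s t => (‖p (pol c s t)‖ ^ 2 - f (pol c s t) ^ 2) / 4)
    simp only [Function.uncurry_def]; fun_prop
  have e3 : ∫ s in (0 : ℝ)..r, (2 * b ^ 2 / (1 - k) * (2 * π)) * s = 2 * π * (b ^ 2 * r ^ 2) / (1 - k) := by
    rw [intervalIntegral.integral_const_mul, integral_id]; field_simp; ring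
  rw [← e3, ← intervalIntegral.integral_const_mul, ← intervalIntegral.integral_const_mul,
    ← intervalIntegral.integral_add (Continuous.intervalIntegrable (by fun_prop) _ _)
      (Continuous.intervalIntegrable (by fun_prop) _ _)]
  refine integral_mono_on hr (Continuous.intervalIntegrable (by fun_prop) _ _)
    (Continuous.intervalIntegrable (by fun_prop) _ _) fun s hs => ?_
  have hc : Continuous fun t => pol c s t := (pol_cont c).comp (Continuous.prodMk_right s)
  have key : (1 - k) * enE f p c α β s ≤ 4 * (∫ t in α..β, (‖p (pol c s t)‖ ^ 2 - f (pol c s t) ^ 2) / 4)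
      + 2 * b ^ 2 / (1 - k) * (2 * π) := by
    have : (1 - k) * enE f p c α β s ≤ 4 * (∫ t in α..β, (‖p (pol c s t)‖ ^ 2 - f (pol c s t) ^ 2) / 4)
      + ∫ t in α..β, 2 * b ^ 2 / (1 - k) := by
      rw [enE, ← intervalIntegral.integral_const_mul, ← intervalIntegral.integral_const_mul,
        ← intervalIntegral.integral_add (Continuous.intervalIntegrable (by fun_prop) _ _)
        (Continuous.intervalIntegrable (by fun_prop) _ _)]
      refine integral_mono_on hB.le.1 (Continuous.intervalIntegrable (by fun_prop) _ _)
        (Continuous.intervalIntegrable (by fun_prop) _ _) fun t ht => ?_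
      exact pt_ineq hk0 hk hb (hf s hs t ht) (norm_nonneg _)
    refine this.trans ?_
    rw [intervalIntegral.integral_const, smul_eq_mul]
    have h5 : 0 ≤ 2 * b ^ 2 / (1 - k) := by positivity
    have := mul_le_mul_of_nonneg_right (show β - α ≤ 2 * π by linarith [hB.le.2]) h5
    linarith
  have := mul_le_mul_of_nonneg_left key hs.1
  linarith

end FN

namespace FN
open MeasureTheory intervalIntegral

lemma hasDerivAt_E {e : ℝ → ℝ} (ce : Continuous e) (r : ℝ) :
    HasDerivAt (fun r => ∫ s in (0 : ℝ)..r, s * e s) (r * e r) r := by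
  have c : Continuous fun s => s * e s := by fun_prop
  exact integral_hasDerivAt_right (c.intervalIntegrable _ _)
    c.aestronglyMeasurable.stronglyMeasurableAtFilter c.continuousAt

lemma mono_of_hd {φ φ' : ℝ → ℝ} {a b : ℝ} (hab : a ≤ b) (h : ∀ x ∈ Icc a b, HasDerivAt φ (φ' x) x)
    (h0 : ∀ x ∈ Icc a b, 0 ≤ φ' x) : φ a ≤ φ b := by
  have : MonotoneOn φ (Icc a b) := by
    apply monotoneOn_of_deriv_nonneg (convex_Icc a b)
    · exact fun x hx => (h x hx).continuousAt.continuousWithinAt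
    · exact fun x hx => (h x (interior_subset hx)).differentiableAt.differentiableWithinAt
    · intro x hx; rw [(h x (interior_subset hx)).deriv]; exact h0 x (interior_subset hx)
  exact this ⟨le_rfl, hab⟩ ⟨hab, le_rfl⟩ hab

lemma ode_decay {K R o b : ℝ} (hK : 1 ≤ K) (hR : 0 < R) {e : ℝ → ℝ}
    (ce : Continuous e) (he : ∀ s, 0 ≤ e s)
    (h1 : ∀ r ∈ Ioc 0 (2 * R), (∫ s in (0 : ℝ)..r, s * e s) ≤ K * (r ^ 2 * e r) + K * (b ^ 2 * r ^ 2))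
    (h2 : ∀ r ∈ Ioc 0 (2 * R), (∫ s in (0 : ℝ)..r, s * e s) ≤ K * (o * (r * √(e r))) + K * (b ^ 2 * r ^ 2))
    {ρ : ℝ} (hρ : ρ ∈ Ioc 0 R) :
    (∫ s in (0 : ℝ)..ρ, s * e s) ≤ 9 * K ^ 2 * (ρ / R) ^ (1 / K) * (o ^ 2 + b ^ 2 * R ^ 2) := by
  set E : ℝ → ℝ := fun r => ∫ s in (0 : ℝ)..r, s * e s with hE
  have dE : ∀ r, HasDerivAt E (r * e r) r := hasDerivAt_E ce
  have E0 : ∀ r, 0 ≤ r → 0 ≤ E r := fun r hr =>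
    integral_nonneg hr fun s hs => mul_nonneg hs.1 (he s)
  -- Caccioppoli
  have cac : E R ≤ 8 * K ^ 2 * (o ^ 2 + b ^ 2 * R ^ 2) := by
    by_contra hcon
    push Not at hcon
    have hb2 : 8 * K * (b ^ 2 * R ^ 2) < E R := by
      have q1 : 0 ≤ b ^ 2 * R ^ 2 := by positivity
      have q2 : 0 ≤ K ^ 2 * o ^ 2 := by positivity
      have q3 : K ≤ K ^ 2 := by nlinarith
      have := mul_le_mul_of_nonneg_right q3 q1
      linarith
    have hpos : 0 < E R := lt_of_le_of_lt (by positivity) hcon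
    have hmono : ∀ r ∈ Icc R (2 * R), E R ≤ E r := by
      intro r hr
      exact mono_of_hd hr.1 (fun x _ => dE x) fun x hx => mul_nonneg (hR.le.trans hx.1) (he x)
    have key : ∀ r ∈ Icc R (2 * R), E r ^ 2 ≤ 8 * K ^ 2 * o ^ 2 * R * (r * e r) := by
      intro r hr
      have hr0 : 0 < r := lt_of_lt_of_le hR hr.1
      have a1 := h2 r ⟨hr0, hr.2⟩
      have a2 := hmono r hr
      have a3 : b ^ 2 * r ^ 2 ≤ b ^ 2 * (4 * R ^ 2) :=
        mul_le_mul_of_nonneg_left (by nlinarith [hr.2]) (sq_nonneg b)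
      have a4 : E r ≤ 2 * (K * (o * (r * √(e r)))) := by
        have : K * (b ^ 2 * r ^ 2) ≤ K * (b ^ 2 * (4 * R ^ 2)) := mul_le_mul_of_nonneg_left a3 (by linarith)
        change E r ≤ _ at a1
        linarith
      have a5 := pow_le_pow_left₀ (hpos.le.trans a2) a4 2
      have a6 : (2 * (K * (o * (r * √(e r))))) ^ 2 = 4 * K ^ 2 * o ^ 2 * r * (r * e r) := by
        rw [show (2 * (K * (o * (r * √(e r))))) ^ 2 = 4 * K ^ 2 * o ^ 2 * r * r * (√(e r)) ^ 2 by ring,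
          Real.sq_sqrt (he r)]; ring
      rw [a6] at a5
      refine a5.trans ?_
      refine mul_le_mul_of_nonneg_right ?_ (mul_nonneg hr0.le (he r))
      have : 0 ≤ 4 * K ^ 2 * o ^ 2 := by positivity
      nlinarith [hr.2]
    set A := 8 * K ^ 2 * o ^ 2 * R with hA
    have hA0 : 0 ≤ A := by positivity
    have mono := mono_of_hd (φ := fun r => -A * (E r)⁻¹ - r) (φ' := fun r => -A * (-(r * e r) / E r ^ 2) - 1)
      (show R ≤ 2 * R by linarith) (fun r hr => (((dE r).inv (hpos.trans_le (hmono r hr)).ne').const_mul _).sub (hasDerivAt_id r))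
      (fun r hr => by
        have p := hpos.trans_le (hmono r hr)
        have := key r hr
        have : 1 ≤ A * (r * e r) / E r ^ 2 := by rw [le_div_iff₀ (by positivity)]; linarith
        have e : -A * (-(r * e r) / E r ^ 2) = A * (r * e r) / E r ^ 2 := by ring
        rw [e]; linarith)
    have p := hpos.trans_le (hmono (2 * R) ⟨by linarith, le_rfl⟩)
    have q : 0 ≤ A * (E (2 * R))⁻¹ := by positivity
    have q2 : R ≤ A * (E R)⁻¹ := by linarith
    rw [← div_eq_mul_inv, le_div_iff₀ hpos] at q2
    have q3 : E R ≤ 8 * K ^ 2 * o ^ 2 := by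
      rw [hA] at q2; nlinarith
    have : 0 ≤ 8 * K ^ 2 * (b ^ 2 * R ^ 2) := by positivity
    nlinarith
  -- decay
  have dec := mono_of_hd (φ := fun r => r ^ (-(1 / K)) * (E r + b ^ 2 * r ^ 2))
    (φ' := fun r => (-(1 / K)) * r ^ (-(1 / K) - 1) * (E r + b ^ 2 * r ^ 2)
      + r ^ (-(1 / K)) * (r * e r + b ^ 2 * (2 * r)))
    hρ.2 (fun r hr => by
      have hr0 : 0 < r := hρ.1.trans_le hr.1
      refine (Real.hasDerivAt_rpow_const (Or.inl hr0.ne')).mul ((dE r).add ?_)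
      simpa using (hasDerivAt_pow 2 r).const_mul (b ^ 2))
    (fun r hr => by
      have hr0 : 0 < r := hρ.1.trans_le hr.1
      have a1 := h1 r ⟨hr0, by linarith [hr.2]⟩
      change E r ≤ _ at a1
      have e1 : r ^ (-(1 / K)) = r ^ (-(1 / K) - 1) * r := by
        rw [Real.rpow_sub_one hr0.ne']; field_simp
      rw [e1]
      have p : 0 < r ^ (-(1 / K) - 1) := Real.rpow_pos_of_pos hr0 _
      have e2 : (-(1 / K)) * r ^ (-(1 / K) - 1) * (E r + b ^ 2 * r ^ 2)
        + r ^ (-(1 / K) - 1) * r * (r * e r + b ^ 2 * (2 * r)) = r ^ (-(1 / K) - 1) *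
          (r ^ 2 * e r + 2 * (b ^ 2 * r ^ 2) - (E r + b ^ 2 * r ^ 2) / K) := by ring
      rw [e2]
      refine mul_nonneg p.le ?_
      have : (E r + b ^ 2 * r ^ 2) / K ≤ r ^ 2 * e r + 2 * (b ^ 2 * r ^ 2) := by
        rw [div_le_iff₀ (by linarith)]
        have : 0 ≤ b ^ 2 * r ^ 2 := by positivity
        nlinarith
      linarith)
  have hRp : 0 < R ^ (-(1 / K)) := Real.rpow_pos_of_pos hR _
  have hρp : 0 < ρ ^ (1 / K) := Real.rpow_pos_of_pos hρ.1 _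
  have y1 : E ρ + b ^ 2 * ρ ^ 2 ≤ (ρ / R) ^ (1 / K) * (E R + b ^ 2 * R ^ 2) := by
    have := mul_le_mul_of_nonneg_left dec hρp.le
    rw [← mul_assoc, ← Real.rpow_add hρ.1] at this
    simp only [add_neg_cancel, Real.rpow_zero, one_mul] at this
    rw [Real.div_rpow hρ.1.le hR.le, div_eq_mul_inv, ← Real.rpow_neg hR.le]
    linarith
  have y2 : E R + b ^ 2 * R ^ 2 ≤ 9 * K ^ 2 * (o ^ 2 + b ^ 2 * R ^ 2) := by
    have : 0 ≤ b ^ 2 * R ^ 2 := by positivity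
    have hK2 : 1 ≤ K ^ 2 := by nlinarith
    nlinarith [sq_nonneg o, mul_le_mul_of_nonneg_right hK2 this, mul_nonneg (sq_nonneg K) (sq_nonneg o)]
  have y3 : 0 ≤ (ρ / R) ^ (1 / K) := Real.rpow_nonneg (by have := hρ.1; positivity) _
  have := mul_le_mul_of_nonneg_left y2 y3
  have : 0 ≤ b ^ 2 * ρ ^ 2 := by positivity
  change E ρ ≤ _
  nlinarith

/-- universal constants -/
def KK (k : ℝ) : ℝ := 8 * π / (1 - k) ^ 2

lemma KK_ge {k : ℝ} (hk0 : 0 ≤ k) (hk : k < 1) : 1 ≤ KK k := by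
  rw [KK, le_div_iff₀ (by have : 0 < 1 - k := by linarith
                          positivity)]
  nlinarith [Real.pi_gt_three]

lemma GJet.decay {g f p} (h : GJet g f p) {c : ℂ} {α β : ℝ} (hB : Bd g c α β) {R k b o : ℝ} (hR : 0 < R)
    (hk0 : 0 ≤ k) (hk : k < 1) (hb : 0 ≤ b)
    (hf : ∀ s ∈ Icc 0 (2 * R), ∀ t ∈ Icc α β, |f (pol c s t)| ≤ k * ‖p (pol c s t)‖ + b)
    (ho : ∀ s ∈ Icc 0 (2 * R), ∀ t ∈ Icc α β, |(g (pol c s α)).im - (g (pol c s t)).im| ≤ o)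
    {ρ : ℝ} (hρ : ρ ∈ Ioc 0 R) :
    En f p c α β ρ ≤ 9 * KK k ^ 2 * (ρ / R) ^ (1 / KK k) * (o ^ 2 + b ^ 2 * R ^ 2) := by
  have h1k : 0 < 1 - k := by linarith
  have hpi := Real.pi_gt_three
  have key : ∀ r ∈ Ioc 0 (2 * R), ∀ X, GG g f p c α β r ≤ 2 * π * X → 0 ≤ X →
      En f p c α β r ≤ KK k * X + KK k * (b ^ 2 * r ^ 2) := by
    intro r hr X hX hX0
    have a := h.En_le_GG hB hr.1.le hk0 hk hb (fun s hs t ht => hf s ⟨hs.1, hs.2.trans hr.2⟩ t ht)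
    have a2 : (1 - k) * En f p c α β r ≤ 8 * π * X + 8 * π * (b ^ 2 * r ^ 2) / (1 - k) := by
      have : 2 * π * (b ^ 2 * r ^ 2) / (1 - k) ≤ 8 * π * (b ^ 2 * r ^ 2) / (1 - k) := by
        gcongr; norm_num
      linarith
    have a3 : En f p c α β r ≤ (8 * π * X + 8 * π * (b ^ 2 * r ^ 2) / (1 - k)) / (1 - k) := by
      rw [le_div_iff₀ h1k]; linarith
    refine a3.trans ?_
    have e1 : (8 * π * X + 8 * π * (b ^ 2 * r ^ 2) / (1 - k)) / (1 - k)
      = KK k * ((1 - k) * X) + KK k * (b ^ 2 * r ^ 2) := by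
      rw [KK]; field_simp
    rw [e1]
    have : 0 ≤ KK k := by linarith [KK_ge hk0 hk]
    have : (1 - k) * X ≤ X := by nlinarith
    nlinarith
  refine ode_decay (KK_ge hk0 hk) hR (h.cont_enE c α β) (h.enE_nonneg c hB.le.1) ?_ ?_ hρ
  · intro r hr
    exact key r hr _ (h.GG_le' hB hr.1.le) (mul_nonneg (sq_nonneg _) (h.enE_nonneg c hB.le.1 _))
  · intro r hr
    have o0 : 0 ≤ o := (abs_nonneg _).trans (ho r ⟨hr.1.le, hr.2⟩ α ⟨le_rfl, hB.le.1⟩)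
    have hn : enN f p c α β r ≤ 2 * π * √(enE f p c α β r) := by
      refine abs_le_of_sq_le_sq' ?_ (by positivity) |>.2
      rw [mul_pow, Real.sq_sqrt (h.enE_nonneg c hB.le.1 _)]
      refine (h.enN_sq c hB.le.1 hB.le.2 r).trans ?_
      exact mul_le_mul_of_nonneg_right (by nlinarith) (h.enE_nonneg c hB.le.1 _)
    refine key r hr _ ((h.GG_le hB hr.1.le (fun t ht => ho r ⟨hr.1.le, hr.2⟩ t ht)).trans ?_)
      (mul_nonneg o0 (mul_nonneg hr.1.le (Real.sqrt_nonneg _)))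
    have := mul_le_mul_of_nonneg_left hn (mul_nonneg o0 hr.1.le)
    linarith

lemma pol_arg (c : ℂ) (z : ℂ) : pol c ‖z‖ z.arg = c + z := by
  rw [pol, Complex.norm_mul_exp_arg_mul_I]

/-- the core estimate -/
theorem GJet.core {g f p} (h : GJet g f p) {c : ℂ} {α β : ℝ} (hB : Bd g c α β)
    (hα : α ≤ -(π / 2)) (hβ : π / 2 ≤ β) {R k b o : ℝ} (hR : 0 < R)
    (hk0 : 0 ≤ k) (hk : k < 1) (hb : 0 ≤ b) 
    (hf : ∀ s ∈ Icc 0 (2 * R), ∀ t ∈ Icc α β, |f (pol c s t)| ≤ k * ‖p (pol c s t)‖ + b)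
    (ho : ∀ s ∈ Icc 0 (2 * R), ∀ t ∈ Icc α β, |(g (pol c s α)).im - (g (pol c s t)).im| ≤ o)
    {η d D : ℝ} (hη : 0 < η) (hd : 0 ≤ d) (hdD : d ≤ D * η) (hDR : (D + 2) * η ≤ R) :
    ∫ x in η..(2 * η), ‖g (c + (d + x * Complex.I)) - g (c + (d - x * Complex.I))‖ ≤
      6 * KK k * ((D + 2) ^ 2 * η) * ((D + 2) * η / R) ^ (1 / (2 * KK k)) * (o + b * R) := by
  have hpi := Real.pi_gt_three
  have o0 : 0 ≤ o := (abs_nonneg _).trans (ho 0 ⟨le_rfl, by linarith⟩ α ⟨le_rfl, hB.le.1⟩)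
  have cg := h.cd.continuous
  have cN := h.cont_enN c α β
  have cE := h.cont_enE c α β
  have hn0 := h.enN_nonneg c hB.le.1
  set T := (D + 2) * η with hT
  have hD : 0 ≤ D := by
    by_contra hh; push Not at hh; nlinarith
  have hT0 : 0 < T := by positivity
  set σ : ℝ → ℝ := fun x => √(d ^ 2 + x ^ 2) with hσ
  have pos : ∀ x, 0 < x → 0 < d ^ 2 + x ^ 2 := fun x hx => by positivity
  have dσ : ∀ x, 0 < x → HasDerivAt σ (x / σ x) x := by
    intro x hx
    have h1 : HasDerivAt (fun x : ℝ => d ^ 2 + x ^ 2) (2 * x) x := by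
      simpa using (hasDerivAt_pow 2 x).const_add (d ^ 2)
    refine (h1.sqrt (pos x hx).ne').congr_deriv ?_
    simp only [hσ]; field_simp
  have cσ : Continuous σ := by fun_prop
  have nrm : ∀ x : ℝ, ‖(d + x * Complex.I : ℂ)‖ = σ x := by
    intro x
    rw [Complex.norm_add_mul_I]
  have nrm' : ∀ x : ℝ, ‖(d - x * Complex.I : ℂ)‖ = σ x := by
    intro x
    have := Complex.norm_add_mul_I d (-x)
    simp only [hσ]
    rw [← neg_sq x, ← this]; push_cast; congr 1; ring
  have pt : ∀ x ∈ Icc η (2 * η), ‖g (c + (d + x * Complex.I)) - g (c + (d - x * Complex.I))‖ ≤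
      η⁻¹ * ((σ x ^ 2 * enN f p c α β (σ x)) * (x / σ x)) := by
    intro x hx
    have hx0 : 0 < x := hη.trans_le hx.1
    have hσ0 : 0 < σ x := Real.sqrt_pos.2 (pos x hx0)
    rw [← pol_arg c (d + x * Complex.I), ← pol_arg c (d - x * Complex.I), nrm, nrm']
    have a1 : |(d + x * Complex.I : ℂ).arg| ≤ π / 2 := by
      rw [Complex.abs_arg_le_pi_div_two_iff]; simpa using hd
    have a2 : |(d - x * Complex.I : ℂ).arg| ≤ π / 2 := by
      rw [Complex.abs_arg_le_pi_div_two_iff]; simpa using hd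
    rw [abs_le] at a1 a2
    refine (h.osc c (s := σ x) (α := α) (β := β) hσ0.le ⟨by linarith, by linarith⟩ ⟨by linarith, by linarith⟩).trans ?_
    have e : η⁻¹ * ((σ x ^ 2 * enN f p c α β (σ x)) * (x / σ x)) = (x / η) * (σ x * enN f p c α β (σ x)) := by
      field_simp
    rw [e]
    have : 1 ≤ x / η := by rw [le_div_iff₀ hη]; linarith [hx.1]
    nlinarith [mul_nonneg hσ0.le (hn0 (σ x))]
  have cont1 : ContinuousOn (fun x => η⁻¹ * ((σ x ^ 2 * enN f p c α β (σ x)) * (x / σ x))) (uIcc η (2 * η)) := by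
    rw [uIcc_of_le (by linarith)]
    refine ContinuousOn.mul continuousOn_const (ContinuousOn.mul (Continuous.continuousOn (by fun_prop)) ?_)
    exact ContinuousOn.div continuousOn_id cσ.continuousOn fun x hx => (Real.sqrt_pos.2 (pos x (hη.trans_le hx.1))).ne'
  have step1 := integral_mono_on (μ := volume) (show η ≤ 2 * η by linarith) (Continuous.intervalIntegrable (by fun_prop) _ _)
    (cont1.intervalIntegrable) pt
  rw [intervalIntegral.integral_const_mul] at step1
  have step2 : ∫ x in η..(2 * η), (σ x ^ 2 * enN f p c α β (σ x)) * (x / σ x)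
      = ∫ s in (σ η)..(σ (2 * η)), s ^ 2 * enN f p c α β s := by
    refine integral_comp_mul_deriv'' (f := σ) (g := fun s => s ^ 2 * enN f p c α β s) cσ.continuousOn ?_ ?_ (Continuous.continuousOn (by fun_prop))
    · intro x hx
      rw [min_eq_left (by linarith), max_eq_right (by linarith)] at hx
      exact (dσ x (hη.trans hx.1)).hasDerivWithinAt
    · rw [uIcc_of_le (by linarith)]
      exact ContinuousOn.div continuousOn_id cσ.continuousOn fun x hx => (Real.sqrt_pos.2 (pos x (hη.trans_le hx.1))).ne'
  have hσT : σ (2 * η) ≤ T := by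
    refine Real.sqrt_le_iff.2 ⟨hT0.le, ?_⟩
    rw [hT]; nlinarith [mul_nonneg hD hη.le]
  have hσm : σ η ≤ σ (2 * η) := Real.sqrt_le_sqrt (by nlinarith)
  have hσ0 : 0 ≤ σ η := Real.sqrt_nonneg _
  have step3 : (∫ s in (σ η)..(σ (2 * η)), s ^ 2 * enN f p c α β s) ≤ T * ∫ s in (0 : ℝ)..T, s * enN f p c α β s := by
    have : (∫ s in (σ η)..(σ (2 * η)), s ^ 2 * enN f p c α β s) ≤ ∫ s in (σ η)..(σ (2 * η)), T * (s * enN f p c α β s) := by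
      refine integral_mono_on hσm (Continuous.intervalIntegrable (by fun_prop) _ _) (Continuous.intervalIntegrable (by fun_prop) _ _) fun s hs => ?_
      have h1 : 0 ≤ s := hσ0.trans hs.1
      have h2 : s ≤ T := hs.2.trans hσT
      have := mul_le_mul_of_nonneg_right h2 (mul_nonneg h1 (hn0 s))
      linarith
    refine this.trans ?_
    rw [intervalIntegral.integral_const_mul]
    refine mul_le_mul_of_nonneg_left ?_ hT0.le
    refine integral_mono_interval hσ0 hσm hσT ?_ (Continuous.intervalIntegrable (by fun_prop) _ _)
    refine (ae_restrict_iff' measurableSet_Ioc).2 (Filter.Eventually.of_forall fun s hs => ?_)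
    exact mul_nonneg hs.1.le (hn0 s)
  have step4 : (∫ s in (0 : ℝ)..T, s * enN f p c α β s) ^ 2 ≤ T ^ 2 * π * En f p c α β T := by
    refine (cs_interval hT0.le continuous_id cN (fun x hx => hx.1)).trans ?_
    have e1 : ∫ s in (0 : ℝ)..T, id s = T ^ 2 / 2 := by simp
    have e2 : (∫ s in (0 : ℝ)..T, id s * enN f p c α β s ^ 2) ≤ 2 * π * En f p c α β T := by
      rw [En, ← intervalIntegral.integral_const_mul]
      refine integral_mono_on hT0.le (Continuous.intervalIntegrable (by fun_prop) _ _) (Continuous.intervalIntegrable (by fun_prop) _ _) fun s hs => ?_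
      have := mul_le_mul_of_nonneg_left (h.enN_sq c hB.le.1 hB.le.2 s) hs.1
      simp only [id]; linarith
    rw [e1]
    have := mul_le_mul_of_nonneg_left e2 (show 0 ≤ T ^ 2 / 2 by positivity)
    linarith
  have step5 := h.decay hB hR hk0 hk hb hf ho (ρ := T) ⟨hT0, hDR⟩
  set K := KK k with hKdef
  have hK1 : 1 ≤ K := KK_ge hk0 hk
  set q := (T / R) ^ (1 / (2 * K)) with hq
  have hq0 : 0 ≤ q := Real.rpow_nonneg (by positivity) _
  have hq2 : (T / R) ^ (1 / K) = q ^ 2 := by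
    rw [hq, ← Real.rpow_natCast, ← Real.rpow_mul (by positivity)]
    congr 1; push_cast; field_simp
  have step6 : (∫ s in (0 : ℝ)..T, s * enN f p c α β s) ≤ T * (6 * K * q * (o + b * R)) := by
    refine abs_le_of_sq_le_sq' ?_ (by positivity) |>.2
    refine step4.trans ?_
    rw [hq2] at step5
    have : T ^ 2 * π * En f p c α β T ≤ T ^ 2 * 4 * (9 * K ^ 2 * q ^ 2 * (o ^ 2 + b ^ 2 * R ^ 2)) := by
      have hpi4 := Real.pi_le_four
      have e0 : 0 ≤ 9 * K ^ 2 * q ^ 2 * (o ^ 2 + b ^ 2 * R ^ 2) := by positivity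
      calc T ^ 2 * π * En f p c α β T ≤ T ^ 2 * π * (9 * K ^ 2 * q ^ 2 * (o ^ 2 + b ^ 2 * R ^ 2)) :=
            mul_le_mul_of_nonneg_left step5 (by positivity)
        _ ≤ _ := by gcongr
    refine this.trans ?_
    have e3 : o ^ 2 + b ^ 2 * R ^ 2 ≤ (o + b * R) ^ 2 := by
      nlinarith [mul_nonneg o0 (mul_nonneg hb hR.le)]
    calc T ^ 2 * 4 * (9 * K ^ 2 * q ^ 2 * (o ^ 2 + b ^ 2 * R ^ 2)) ≤ T ^ 2 * 4 * (9 * K ^ 2 * q ^ 2 * (o + b * R) ^ 2) := by gcongr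
      _ = _ := by ring
  calc _ ≤ _ := step1
    _ ≤ η⁻¹ * (T * (T * (6 * K * q * (o + b * R)))) := by
      rw [step2]
      refine mul_le_mul_of_nonneg_left (step3.trans ?_) (by positivity)
      exact mul_le_mul_of_nonneg_left step6 hT0.le
    _ = _ := by rw [hT]; field_simp

end FN

namespace FN
open MeasureTheory intervalIntegral

def Wq (φ : ℝ → ℂ) (h y : ℝ) : ℂ := ((3 * h ^ 2)⁻¹ : ℝ) • ∫ x in h..(2 * h), (φ (y + x) - φ (y - x))

lemma Wq_eq {φ : ℝ → ℂ} (cφ : Continuous φ) (h y : ℝ) :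
    Wq φ h y = ((3 * h ^ 2)⁻¹ : ℝ) • ((∫ x in (0 : ℝ)..(y + 2 * h), φ x) - (∫ x in (0 : ℝ)..(y + h), φ x)
      - (∫ x in (0 : ℝ)..(y - h), φ x) + ∫ x in (0 : ℝ)..(y - 2 * h), φ x) := by
  have ii : ∀ a b, IntervalIntegrable φ volume a b := fun a b => cφ.intervalIntegrable a b
  rw [Wq, intervalIntegral.integral_sub (Continuous.intervalIntegrable (by fun_prop) _ _)
    (Continuous.intervalIntegrable (by fun_prop) _ _), integral_comp_add_left, integral_comp_sub_left,
    integral_interval_sub_left (ii _ _) (ii _ _), ← integral_interval_sub_left (ii 0 (y - h)) (ii 0 (y - 2 * h))]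
  congr 1; ring

lemma Wq_half {φ : ℝ → ℂ} (cφ : Continuous φ) {h : ℝ} (hh : h ≠ 0) (y : ℝ) :
    Wq φ h y = (1 / 4 : ℝ) • (Wq φ (h / 2) (y + h / 2) + Wq φ (h / 2) (y - h / 2)
      + Wq φ (h / 2) (y + h) + Wq φ (h / 2) (y - h)) := by
  simp only [Wq_eq cφ]
  have e : ((3 * h ^ 2)⁻¹ : ℝ) = (1 / 4) * (3 * (h / 2) ^ 2)⁻¹ := by field_simp; norm_num
  rw [e, ← smul_add, ← smul_add, ← smul_add, ← mul_smul]
  congr 1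
  ring_nf

lemma Wq_tendsto {φ : ℝ → ℂ} (cφ : Continuous φ) {y : ℝ} {d : ℂ} (hd : HasDerivAt φ d y) {ε : ℝ} (hε : 0 < ε) :
    ∃ δ > 0, ∀ h ∈ Ioo 0 δ, ‖Wq φ h y - d‖ ≤ ε := by
  have h1 := (hasDerivAt_iff_isLittleO.1 hd).def hε
  rw [Metric.eventually_nhds_iff] at h1
  obtain ⟨δ, hδ, h1⟩ := h1
  refine ⟨δ / 2, by positivity, fun h hh => ?_⟩
  have hh0 := hh.1
  have e1 : ∫ x in h..(2 * h), (2 * x : ℝ) • d = (3 * h ^ 2 : ℝ) • d := by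
    rw [intervalIntegral.integral_smul_const, intervalIntegral.integral_const_mul, integral_id]
    congr 1; ring
  have e2 : d = ((3 * h ^ 2)⁻¹ : ℝ) • ∫ x in h..(2 * h), (2 * x : ℝ) • d := by
    rw [e1, smul_smul, inv_mul_cancel₀ (by positivity), one_smul]
  have e3 : Wq φ h y - d = ((3 * h ^ 2)⁻¹ : ℝ) • ∫ x in h..(2 * h), (φ (y + x) - φ (y - x) - (2 * x : ℝ) • d) := by
    conv_lhs => rw [e2]
    rw [Wq, ← smul_sub, ← intervalIntegral.integral_sub (Continuous.intervalIntegrable (by fun_prop) _ _)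
    (Continuous.intervalIntegrable (by fun_prop) _ _)]
  rw [e3, norm_smul, Real.norm_of_nonneg (by positivity)]
  have e4 : ‖∫ x in h..(2 * h), (φ (y + x) - φ (y - x) - (2 * x : ℝ) • d)‖ ≤ ∫ x in h..(2 * h), (2 * ε) * x := by
    refine norm_integral_le_of_norm_le (by linarith) (Filter.Eventually.of_forall fun x hx => ?_)
      (Continuous.intervalIntegrable (by fun_prop) _ _)
    have hx0 : 0 < x := hh0.trans hx.1
    have b1 := @h1 (y + x) (by rw [Real.dist_eq]; simp [abs_of_pos hx0]; linarith [hx.2, hh.2])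
    have b2 := @h1 (y - x) (by rw [Real.dist_eq]; simp [abs_of_pos hx0]; linarith [hx.2, hh.2])
    simp only [add_sub_cancel_left, Real.norm_eq_abs, abs_of_pos hx0, sub_sub_cancel_left, abs_neg] at b1 b2
    have : φ (y + x) - φ (y - x) - (2 * x : ℝ) • d = (φ (y + x) - φ y - x • d) - (φ (y - x) - φ y - (-x) • d) := by
      simp only [neg_smul, mul_smul, two_smul]; ring
    rw [this]
    refine (norm_sub_le _ _).trans ?_
    linarith
  rw [intervalIntegral.integral_const_mul, integral_id] at e4
  calc _ ≤ (3 * h ^ 2)⁻¹ * (2 * ε * (((2 * h) ^ 2 - h ^ 2) / 2)) := by gcongr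
    _ = ε := by field_simp; ring

def CW (γ : ℝ) : ℝ := 1 + 2 / (2 ^ γ - 1)

lemma CW_pos {γ : ℝ} (hγ : 0 < γ) : 0 < CW γ := by
  have : 0 < (2 : ℝ) ^ γ - 1 := by linarith [Real.one_lt_rpow (show (1 : ℝ) < 2 by norm_num) hγ]
  unfold CW; positivity

lemma W_lemma {φ : ℝ → ℂ} (cφ : Continuous φ) {y h κ γ : ℝ} (hh : 0 < h) (hγ : 0 < γ) (hκ : 0 ≤ κ)
    {d1 d2 : ℂ} (hd1 : HasDerivAt φ d1 y) (hd2 : HasDerivAt φ d2 (y + h))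
    (H : ∀ η ∈ Ioc 0 h, ∀ x ∈ Icc (y - 2 * h) (y + 2 * h), ∫ ρ in η..(2 * η),
      ‖(φ (x + ρ + η) - φ (x + ρ)) - (φ (x - ρ + η) - φ (x - ρ))‖ ≤ κ * η ^ (2 + γ)) :
    ‖d2 - d1‖ ≤ CW γ * κ * h ^ γ := by
  have s1 : ∀ η ∈ Ioc 0 h, ∀ x ∈ Icc (y - 2 * h) (y + 2 * h), ‖Wq φ η (x + η) - Wq φ η x‖ ≤ κ / 3 * η ^ γ := by
    intro η hη x hx
    have h0 := hη.1
    rw [Wq, Wq, ← smul_sub, ← intervalIntegral.integral_sub (Continuous.intervalIntegrable (by fun_prop) _ _)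
    (Continuous.intervalIntegrable (by fun_prop) _ _), norm_smul, Real.norm_of_nonneg (by positivity)]
    have := H η hη x hx
    have e : ‖∫ ρ in η..(2 * η), (φ (x + η + ρ) - φ (x + η - ρ) - (φ (x + ρ) - φ (x - ρ)))‖ ≤
      ∫ ρ in η..(2 * η), ‖(φ (x + ρ + η) - φ (x + ρ)) - (φ (x - ρ + η) - φ (x - ρ))‖ := by
      refine norm_integral_le_of_norm_le (by linarith) (Filter.Eventually.of_forall fun ρ _ => ?_)
        (Continuous.intervalIntegrable (by fun_prop) _ _)
      rw [show x + η + ρ = x + ρ + η by ring, show x + η - ρ = x - ρ + η by ring]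
      refine le_of_eq (congrArg _ ?_); ring
    rw [Real.rpow_add h0, Real.rpow_two] at this
    calc _ ≤ (3 * η ^ 2)⁻¹ * (κ * (η ^ 2 * η ^ γ)) := by gcongr; exact e.trans this
      _ = _ := by field_simp
  -- one halving step
  have s2 : ∀ η ∈ Ioc 0 h, ∀ x ∈ Icc y (y + h), ‖Wq φ η x - Wq φ (η / 2) x‖ ≤ κ / 2 * (η / 2) ^ γ := by
    intro η hη x hx
    have h0 := hη.1
    rw [Wq_half cφ h0.ne' x]
    have hη2 : η / 2 ∈ Ioc 0 h := ⟨by linarith, by linarith [hη.2]⟩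
    have t1 := s1 (η / 2) hη2 x ⟨by linarith [hx.1], by linarith [hx.2]⟩
    have t2 := s1 (η / 2) hη2 (x + η / 2) ⟨by linarith [hx.1], by linarith [hx.2, hη.2]⟩
    have t3 := s1 (η / 2) hη2 (x - η / 2) ⟨by linarith [hx.1, hη.2], by linarith [hx.2]⟩
    have t4 := s1 (η / 2) hη2 (x - η) ⟨by linarith [hx.1, hη.2], by linarith [hx.2]⟩
    rw [show x + η / 2 + η / 2 = x + η by ring] at t2
    rw [show x - η / 2 + η / 2 = x by ring] at t3
    rw [show x - η + η / 2 = x - η / 2 by ring] at t4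
    set c := κ / 3 * (η / 2) ^ γ
    set A := Wq φ (η / 2) x
    set A1 := Wq φ (η / 2) (x + η / 2)
    set A2 := Wq φ (η / 2) (x + η)
    set B1 := Wq φ (η / 2) (x - η / 2)
    set B2 := Wq φ (η / 2) (x - η)
    have e : (1 / 4 : ℝ) • (A1 + B1 + A2 + B2) - A = (1 / 4 : ℝ) • ((A1 - A) + (A1 - A) + (A2 - A1) - (A - B1) - (A - B1) - (B1 - B2)) := by
      simp only [Complex.real_smul]; push_cast; ring
    rw [e, norm_smul, Real.norm_of_nonneg (by norm_num)]
    have : ‖(A1 - A) + (A1 - A) + (A2 - A1) - (A - B1) - (A - B1) - (B1 - B2)‖ ≤ 6 * c := by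
      calc _ ≤ ‖A1 - A‖ + ‖A1 - A‖ + ‖A2 - A1‖ + ‖A - B1‖ + ‖A - B1‖ + ‖B1 - B2‖ := by
            refine (norm_sub_le _ _).trans (add_le_add_left ?_ _)
            refine (norm_sub_le _ _).trans (add_le_add_left ?_ _)
            refine (norm_sub_le _ _).trans (add_le_add_left ?_ _)
            exact norm_add₃_le
        _ ≤ _ := by linarith
    calc _ ≤ 1 / 4 * (6 * c) := by gcongr
      _ = _ := by simp only [c]; ring
  -- sum up
  have q1 : 1 < (2 : ℝ) ^ γ := Real.one_lt_rpow (by norm_num) hγ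
  have s3 : ∀ x ∈ Icc y (y + h), ∀ n : ℕ, ‖Wq φ h x - Wq φ (h / 2 ^ n) x‖ ≤
      κ / 2 * h ^ γ / (2 ^ γ - 1) * (1 - ((2 : ℝ) ^ γ)⁻¹ ^ n) := by
    intro x hx n
    induction n with
    | zero => simp
    | succ n ih =>
      have h2 : h / 2 ^ n ∈ Ioc 0 h := ⟨by positivity, div_le_self hh.le (one_le_pow₀ (by norm_num))⟩
      have t := s2 _ h2 x hx
      have e1 : h / 2 ^ (n + 1) = h / 2 ^ n / 2 := by rw [pow_succ]; field_simp
      rw [e1]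
      have e2 : (h / 2 ^ n / 2) ^ γ = h ^ γ * ((2 : ℝ) ^ γ)⁻¹ ^ (n + 1) := by
        rw [← e1, Real.div_rpow hh.le (by positivity), ← Real.rpow_natCast, ← Real.rpow_mul (by norm_num), mul_comm _ γ,
          Real.rpow_mul (by norm_num), Real.rpow_natCast, inv_pow]; rfl
      rw [e2] at t
      have tri := norm_sub_le_norm_sub_add_norm_sub (Wq φ h x) (Wq φ (h / 2 ^ n) x) (Wq φ (h / 2 ^ n / 2) x)
      refine tri.trans ((add_le_add ih t).trans (le_of_eq ?_))
      have : (2 : ℝ) ^ γ - 1 ≠ 0 := by linarith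
      have : (2 : ℝ) ^ γ ≠ 0 := by linarith
      rw [pow_succ]
      field_simp
      ring
  have s4 : ∀ x ∈ Icc y (y + h), ∀ d, HasDerivAt φ d x → ‖Wq φ h x - d‖ ≤ κ / 2 * h ^ γ / (2 ^ γ - 1) := by
    intro x hx d hd
    refine le_of_forall_pos_le_add fun ε hε => ?_
    obtain ⟨δ, hδ, hW⟩ := Wq_tendsto cφ hd hε
    obtain ⟨n, hn⟩ := exists_pow_lt_of_lt_one (show 0 < δ / h by positivity) (show (1 / 2 : ℝ) < 1 by norm_num)
    have hn2 : h / 2 ^ n < δ := by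
      rw [lt_div_iff₀ hh] at hn
      calc h / 2 ^ n = (1 / 2) ^ n * h := by rw [one_div, inv_pow]; ring
        _ < δ := hn
    have t1 := hW (h / 2 ^ n) ⟨by positivity, hn2⟩
    have t2 := s3 x hx n
    have t3 : κ / 2 * h ^ γ / (2 ^ γ - 1) * (1 - ((2 : ℝ) ^ γ)⁻¹ ^ n) ≤ κ / 2 * h ^ γ / (2 ^ γ - 1) := by
      have a0 : 0 ≤ κ / 2 * h ^ γ / (2 ^ γ - 1) := div_nonneg (by positivity) (by linarith)
      have a1 : 0 ≤ ((2 : ℝ) ^ γ)⁻¹ ^ n := by positivity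
      nlinarith
    have tri := norm_sub_le_norm_sub_add_norm_sub (Wq φ h x) (Wq φ (h / 2 ^ n) x) d
    linarith
  have u1 := s4 y ⟨le_rfl, by linarith⟩ d1 hd1
  have u2 := s4 (y + h) ⟨by linarith, le_rfl⟩ d2 hd2
  have u3 := s1 h ⟨hh, le_rfl⟩ y ⟨by linarith, by linarith⟩
  have tri : ‖d2 - d1‖ ≤ ‖Wq φ h (y + h) - d2‖ + ‖Wq φ h (y + h) - Wq φ h y‖ + ‖Wq φ h y - d1‖ := by
    have : d2 - d1 = -(Wq φ h (y + h) - d2) + (Wq φ h (y + h) - Wq φ h y) + (Wq φ h y - d1) := by ring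
    rw [this]
    refine norm_add₃_le.trans ?_
    rw [norm_neg]
  have a0 : 0 ≤ κ * h ^ γ := by positivity
  calc ‖d2 - d1‖ ≤ 2 * (κ / 2 * h ^ γ / (2 ^ γ - 1)) + κ / 3 * h ^ γ := by linarith
    _ ≤ CW γ * κ * h ^ γ := by
      have e : CW γ * κ * h ^ γ = κ * h ^ γ + 2 * (κ * h ^ γ / (2 ^ γ - 1)) := by rw [CW]; ring
      have : 0 ≤ κ * h ^ γ / (2 ^ γ - 1) := div_nonneg a0 (by linarith)
      rw [e]
      have : 2 * (κ / 2 * h ^ γ / (2 ^ γ - 1)) = κ * h ^ γ / (2 ^ γ - 1) := by ring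
      linarith

end FN

namespace FN
open MeasureTheory intervalIntegral

/-- limit jets on a set -/
def LJ (Ω : Set ℂ) (Bc : (ℂ → ℂ) → Prop) (g : ℂ → ℂ) (f : ℂ → ℝ) (p : ℂ → ℂ) : Prop :=
  ∀ ε > 0, ∃ G F P, GJet G F P ∧ Bc G ∧ ∀ z ∈ Ω, ‖G z - g z‖ ≤ ε ∧ |F z - f z| ≤ ε ∧ ‖P z - p z‖ ≤ ε

lemma dG_sub (f f' : ℝ) (p p' : ℂ) : dG f p - dG f' p' = dG (f - f') (p - p') := by
  ext <;> simp [dG_apply] <;> ring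

lemma GJet.shift_sub {g f p} (h : GJet g f p) (a : ℂ) :
    GJet (fun z => g (z + a) - g z) (fun z => f (z + a) - f z) (fun z => p (z + a) - p z) where
  cd := (h.cd.comp (contDiff_id.add contDiff_const)).sub h.cd
  d z := by
    rw [← dG_sub]
    refine HasFDerivAt.sub ?_ (h.d z)
    exact ((h.d (z + a)).comp z ((hasFDerivAt_id z).add_const a)).congr_fderiv (by ext <;> simp)

lemma norm_dG_le' (f : ℝ) (p v : ℂ) {a : ℝ} (hf : |f| ≤ a) (hp : ‖p‖ ≤ a) : ‖dG f p v‖ ≤ a * ‖v‖ := by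
  rw [dG_apply, norm_div]
  have := norm_add_le (p * v) (f * (starRingEnd ℂ) v)
  simp only [norm_mul, Complex.norm_real, RCLike.norm_conj, Real.norm_eq_abs] at this
  rw [show ‖(2 : ℂ)‖ = 2 by simp]
  have := mul_le_mul_of_nonneg_right hf (norm_nonneg v)
  have := mul_le_mul_of_nonneg_right hp (norm_nonneg v)
  linarith

lemma GJet.line {g f p} (h : GJet g f p) (z v : ℂ) (t : ℝ) :
    HasDerivAt (fun t : ℝ => g (z + t * v)) (dG (f (z + t * v)) (p (z + t * v)) v) t := by
  have h1 : HasDerivAt (fun t : ℝ => z + t * v) v t := by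
    simpa using (((hasDerivAt_id t).ofReal_comp).mul_const v).const_add z
  exact (h.d _).comp_hasDerivAt t h1

/-- mean value inequality for double differences -/
lemma GJet.dbl {g f p} (h : GJet g f p) (z z' v : ℂ) {η a : ℝ} (hη : 0 ≤ η)
    (H : ∀ t ∈ Icc 0 η, |f (z + t * v) - f (z' + t * v)| ≤ a ∧ ‖p (z + t * v) - p (z' + t * v)‖ ≤ a) :
    ‖(g (z + η * v) - g z) - (g (z' + η * v) - g z')‖ ≤ a * ‖v‖ * η := by
  have := norm_image_sub_le_of_norm_deriv_le_segment' (f := fun t : ℝ => g (z + t * v) - g (z' + t * v))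
    (f' := fun t => dG (f (z + t * v)) (p (z + t * v)) v - dG (f (z' + t * v)) (p (z' + t * v)) v)
    (a := 0) (b := η) (C := a * ‖v‖)
    (fun t _ => ((h.line z v t).sub (h.line z' v t)).hasDerivWithinAt)
    (fun t ht => by
      rw [← sub_apply, dG_sub]
      exact norm_dG_le' _ _ _ (H t ⟨ht.1, ht.2.le⟩).1 (H t ⟨ht.1, ht.2.le⟩).2) η ⟨hη, le_rfl⟩
  simp only [Complex.ofReal_zero, zero_mul, add_zero, sub_zero] at this
  refine le_of_eq_of_le (congrArg _ ?_) this
  ring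

lemma le_of_eps {x y Z : ℝ} (hZ : 0 ≤ Z) (h : ∀ ε > 0, x ≤ y + ε * Z) : x ≤ y := by
  refine le_of_forall_pos_le_add fun ε hε => ?_
  have := h (ε / (Z + 1)) (by positivity)
  have h2 : ε / (Z + 1) * Z ≤ ε := by
    rw [div_mul_eq_mul_div, div_le_iff₀ (by linarith)]; nlinarith
  linarith

structure Chart (k γ A B : ℝ) (Ω : Set ℂ) (Bc : (ℂ → ℂ) → Prop) (g : ℂ → ℂ) (f : ℂ → ℝ) (p : ℂ → ℂ) : Prop where
  cg : Continuous g
  lj : LJ Ω Bc g f p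
  conv : Convex ℝ Ω
  hf : ∀ z ∈ Ω, ∀ z' ∈ Ω, |f z - f z'| ≤ A * ‖z - z'‖ ^ γ
  hp : ∀ z ∈ Ω, ∀ z' ∈ Ω, ‖p z - p z'‖ ≤ A * ‖z - z'‖ ^ γ
  pair : ∀ z ∈ Ω, ∀ z' ∈ Ω, |f z - f z'| ≤ k * ‖p z - p z'‖ + B * ‖z - z'‖ ^ γ

lemma pol_norm (c : ℂ) {s : ℝ} (hs : 0 ≤ s) (t : ℝ) : ‖pol c s t - c‖ = s := by
  rw [pol, add_sub_cancel_left, norm_mul, Complex.norm_exp_ofReal_mul_I]; simp [abs_of_nonneg hs]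

lemma Chart.T {k γ A B Ω Bc g f p} (h : Chart k γ A B Ω Bc g f p) (hk0 : 0 ≤ k) (hk : k < 1)
    (hA : 0 ≤ A) (hB : 0 ≤ B) (hγ : 0 < γ) {c : ℂ} {α β : ℝ}
    (hBd : β = α + 2 * π ∨ (α = -(π / 2) ∧ β = π / 2 ∧ c.re = 0 ∧ ∀ G, Bc G → ∀ s : ℝ, (G (s * Complex.I)).im = 0))
    (hα : α ≤ -(π / 2)) (hβ : π / 2 ≤ β) {R η d D : ℝ} (hR : 0 < R)
    (hη : 0 < η) (hd : 0 ≤ d) (hdD : d ≤ D * η) (hDR : (D + 2) * η ≤ R)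
    (hS : ∀ s ∈ Icc 0 (2 * R), ∀ t ∈ Icc α β, pol c s t ∈ Ω ∧ pol c s t + η * Complex.I ∈ Ω) :
    ∫ x in η..(2 * η), ‖(g (c + (d + x * Complex.I) + η * Complex.I) - g (c + (d + x * Complex.I)))
        - (g (c + (d - x * Complex.I) + η * Complex.I) - g (c + (d - x * Complex.I)))‖ ≤
      6 * KK k * ((D + 2) ^ 2 * η) * ((D + 2) * η / R) ^ (1 / (2 * KK k)) *
        (A * (4 * R) ^ γ * η + B * η ^ γ * R) := by
  have hpi := Real.pi_gt_three
  have hK1 := KK_ge hk0 hk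
  set M := 6 * KK k * ((D + 2) ^ 2 * η) * ((D + 2) * η / R) ^ (1 / (2 * KK k)) with hM
  have hD : 0 ≤ D := by
    by_contra hh; push Not at hh; nlinarith
  have hM0 : 0 ≤ M := by positivity
  have cg := h.cg
  refine le_of_eps (Z := M * (2 * η + 4 * R) + 4 * η) (by positivity) fun ε hε => ?_
  obtain ⟨G, F, P, hJ, hb, hGa⟩ := h.lj ε hε
  have hV := hJ.shift_sub (η * Complex.I)
  have cG := hJ.cd.continuous
  have hBd' : Bd (fun z => G (z + η * Complex.I) - G z) c α β := by
    rcases hBd with h1 | ⟨h1, h2, h3, h4⟩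
    · exact Or.inl h1
    · refine Or.inr ⟨by rw [h1, h2]; linarith, by rw [h1, h2]; linarith, fun s _ => ?_⟩
      have e1 : ∀ s : ℝ, pol c s (-(π / 2)) = ((c.im - s : ℝ) : ℂ) * Complex.I := by
        intro s
        have : Complex.exp (((-(π / 2) : ℝ) : ℂ) * Complex.I) = -Complex.I := by
          rw [Complex.exp_mul_I, ← Complex.ofReal_cos, ← Complex.ofReal_sin]; simp
        rw [pol, this]; apply Complex.ext <;> simp [h3]; ring
      have e2 : ∀ s : ℝ, pol c s (π / 2) = ((c.im + s : ℝ) : ℂ) * Complex.I := by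
        intro s
        have : Complex.exp (((π / 2 : ℝ) : ℂ) * Complex.I) = Complex.I := by
          rw [Complex.exp_mul_I, ← Complex.ofReal_cos, ← Complex.ofReal_sin]; simp
        rw [pol, this]; apply Complex.ext <;> simp [h3]
      rw [h1, h2, e1, e2]
      simp only [← add_mul, ← Complex.ofReal_add, Complex.sub_im, h4 G hb]
      simp
  have S1 : ∀ s ∈ Icc 0 (2 * R), ∀ t ∈ Icc α β, ∀ r ∈ Icc 0 η, pol c s t + r * Complex.I ∈ Ω := by
    intro s hs t ht r hr
    obtain ⟨a1, a2⟩ := hS s hs t ht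
    have := h.conv.add_smul_sub_mem a1 a2 (t := r / η) ⟨by have := hr.1; positivity, by
      rw [div_le_one hη]; exact hr.2⟩
    convert this using 2
    simp only [add_sub_cancel_left, Complex.real_smul]
    push_cast
    have : (η : ℂ) ≠ 0 := by exact_mod_cast hη.ne'
    field_simp
  have key := hV.core hBd' hα hβ (R := R) (k := k) (b := B * η ^ γ + 4 * ε) (o := (A * (4 * R) ^ γ + 2 * ε) * η) hR hk0 hk
    (by positivity) (fun s hs t ht => by
      obtain ⟨a1, a2⟩ := hS s hs t ht
      have p1 := h.pair _ a2 _ a1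
      rw [add_sub_cancel_left, norm_mul, Complex.norm_I, mul_one, Complex.norm_real, Real.norm_of_nonneg hη.le] at p1
      obtain ⟨-, b2, b3⟩ := hGa _ a1
      obtain ⟨-, c2, c3⟩ := hGa _ a2
      have e1 : ‖p (pol c s t + η * Complex.I) - p (pol c s t)‖ ≤ ‖P (pol c s t + η * Complex.I) - P (pol c s t)‖ + 2 * ε := by
        have : p (pol c s t + η * Complex.I) - p (pol c s t) = (P (pol c s t + η * Complex.I) - P (pol c s t))
          - (P (pol c s t + η * Complex.I) - p (pol c s t + η * Complex.I)) + (P (pol c s t) - p (pol c s t)) := by ring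
        rw [this]
        refine (norm_add_le _ _).trans ?_
        have := norm_sub_le (P (pol c s t + η * Complex.I) - P (pol c s t)) (P (pol c s t + η * Complex.I) - p (pol c s t + η * Complex.I))
        linarith
      have e2 : k * ‖p (pol c s t + η * Complex.I) - p (pol c s t)‖ ≤ k * ‖P (pol c s t + η * Complex.I) - P (pol c s t)‖ + 2 * ε := by
        have := mul_le_mul_of_nonneg_left e1 hk0
        nlinarith
      rw [abs_le] at *
      constructor <;> linarith)
    (fun s hs t ht => by
      rw [← Complex.sub_im]
      refine (Complex.abs_im_le_norm _).trans ?_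
      have hα' : α ∈ Icc α β := ⟨le_rfl, by linarith⟩
      have dist4 : ‖pol c s α - pol c s t‖ ≤ 4 * R := by
        have := norm_sub_le_norm_sub_add_norm_sub (pol c s α) c (pol c s t)
        rw [norm_sub_rev c, pol_norm c hs.1, pol_norm c hs.1] at this
        linarith [hs.2]
      have := hJ.dbl (pol c s α) (pol c s t) Complex.I (η := η) (a := A * (4 * R) ^ γ + 2 * ε) hη.le (fun r hr => by
        have m1 := S1 s hs α hα' r hr
        have m2 := S1 s hs t ht r hr
        have q1 := h.hf _ m1 _ m2
        have q2 := h.hp _ m1 _ m2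
        rw [add_sub_add_right_eq_sub] at q1 q2
        have q3 : A * ‖pol c s α - pol c s t‖ ^ γ ≤ A * (4 * R) ^ γ := by gcongr
        obtain ⟨-, b2, b3⟩ := hGa _ m1
        obtain ⟨-, c2, c3⟩ := hGa _ m2
        constructor
        · rw [abs_le] at *
          constructor <;> linarith
        · have : P (pol c s α + r * Complex.I) - P (pol c s t + r * Complex.I) = (p (pol c s α + r * Complex.I) - p (pol c s t + r * Complex.I))
            + (P (pol c s α + r * Complex.I) - p (pol c s α + r * Complex.I)) - (P (pol c s t + r * Complex.I) - p (pol c s t + r * Complex.I)) := by ring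
          rw [this]
          refine (norm_sub_le _ _).trans ?_
          have := norm_add_le (p (pol c s α + r * Complex.I) - p (pol c s t + r * Complex.I)) (P (pol c s α + r * Complex.I) - p (pol c s α + r * Complex.I))
          linarith)
      simpa using this)
    hη hd hdD hDR
  have rhs : M * ((A * (4 * R) ^ γ + 2 * ε) * η + (B * η ^ γ + 4 * ε) * R) =
    M * (A * (4 * R) ^ γ * η + B * η ^ γ * R) + ε * (M * (2 * η + 4 * R)) := by ring
  rw [rhs] at key
  -- compare integrals
  have memS : ∀ x ∈ Icc η (2 * η), (c + (d + x * Complex.I) ∈ Ω ∧ c + (d + x * Complex.I) + η * Complex.I ∈ Ω) ∧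
      (c + (d - x * Complex.I) ∈ Ω ∧ c + (d - x * Complex.I) + η * Complex.I ∈ Ω) := by
    intro x hx
    have hx0 : 0 < x := hη.trans_le hx.1
    have nb : d + x ≤ 2 * R := by nlinarith [hx.2]
    have a1 : |(d + x * Complex.I : ℂ).arg| ≤ π / 2 := by
      rw [Complex.abs_arg_le_pi_div_two_iff]; simpa using hd
    have a2 : |(d - x * Complex.I : ℂ).arg| ≤ π / 2 := by
      rw [Complex.abs_arg_le_pi_div_two_iff]; simpa using hd
    have n1 : ‖(d + x * Complex.I : ℂ)‖ ≤ 2 * R := by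
      refine (norm_add_le _ _).trans ?_
      simp only [norm_mul, Complex.norm_I, mul_one, Complex.norm_real, Real.norm_of_nonneg hd, Real.norm_of_nonneg hx0.le]
      exact nb
    have n2 : ‖(d - x * Complex.I : ℂ)‖ ≤ 2 * R := by
      refine (norm_sub_le _ _).trans ?_
      simp only [norm_mul, Complex.norm_I, mul_one, Complex.norm_real, Real.norm_of_nonneg hd, Real.norm_of_nonneg hx0.le]
      exact nb
    rw [abs_le] at a1 a2
    have r1 := hS _ ⟨norm_nonneg _, n1⟩ (d + x * Complex.I : ℂ).arg ⟨by linarith, by linarith⟩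
    have r2 := hS _ ⟨norm_nonneg _, n2⟩ (d - x * Complex.I : ℂ).arg ⟨by linarith, by linarith⟩
    rw [pol_arg] at r1 r2
    exact ⟨r1, r2⟩
  have cmp : ∫ x in η..(2 * η), ‖(g (c + (d + x * Complex.I) + η * Complex.I) - g (c + (d + x * Complex.I)))
        - (g (c + (d - x * Complex.I) + η * Complex.I) - g (c + (d - x * Complex.I)))‖ ≤
      (∫ x in η..(2 * η), (‖(G (c + (d + x * Complex.I) + η * Complex.I) - G (c + (d + x * Complex.I)))
        - (G (c + (d - x * Complex.I) + η * Complex.I) - G (c + (d - x * Complex.I)))‖ + 4 * ε)) := by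
    refine integral_mono_on (by linarith) (Continuous.intervalIntegrable (by fun_prop) _ _) (Continuous.intervalIntegrable (by fun_prop) _ _) fun x hx => ?_
    obtain ⟨⟨m1, m2⟩, m3, m4⟩ := memS x hx
    have b1 := (hGa _ m1).1
    have b2 := (hGa _ m2).1
    have b3 := (hGa _ m3).1
    have b4 := (hGa _ m4).1
    generalize c + (d + x * Complex.I) + η * Complex.I = w2 at *
    generalize c + (d - x * Complex.I) + η * Complex.I = w4 at *
    generalize c + (d + x * Complex.I) = w1 at *
    generalize c + (d - x * Complex.I) = w3 at *
    have e : g w2 - g w1 - (g w4 - g w3) = (G w2 - G w1 - (G w4 - G w3)) - (G w2 - g w2) + (G w1 - g w1) + ((G w4 - g w4) - (G w3 - g w3)) := by ring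
    rw [e]
    have t1 := norm_sub_le (G w4 - g w4) (G w3 - g w3)
    have t2 := norm_sub_le (G w2 - G w1 - (G w4 - G w3)) (G w2 - g w2)
    refine norm_add₃_le.trans ?_
    linarith
  rw [intervalIntegral.integral_add (Continuous.intervalIntegrable (by fun_prop) _ _) (Continuous.intervalIntegrable (by fun_prop) _ _),
    intervalIntegral.integral_const, smul_eq_mul] at cmp
  linarith

end FN

namespace FN
open MeasureTheory intervalIntegral

lemma LJ.line {Ω Bc g f p} (lj : LJ Ω Bc g f p) {z v : ℂ} {t ε : ℝ} (hε : 0 < ε)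
    (hΩ : ∀ s ∈ ball t ε, z + (s : ℝ) * v ∈ Ω) :
    HasDerivAt (fun s : ℝ => g (z + s * v)) (dG (f (z + t * v)) (p (z + t * v)) v) t := by
  choose G F P hJ hb hG using fun n : ℕ => lj (1 / ((n : ℝ) + 1)) (by positivity)
  have h0 := tendsto_one_div_add_atTop_nhds_zero_nat (𝕜 := ℝ)
  refine hasDerivAt_of_tendstoUniformlyOn (l := Filter.atTop) (s := ball t ε) isOpen_ball
    (f := fun (n : ℕ) (s : ℝ) => G n (z + s * v))
    (f' := fun (n : ℕ) (s : ℝ) => dG (F n (z + s * v)) (P n (z + s * v)) v)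
    (g' := fun s => dG (f (z + s * v)) (p (z + s * v)) v) ?_ ?_ ?_ (mem_ball_self hε)
  · rw [Metric.tendstoUniformlyOn_iff]
    intro e he
    have h1 : ∀ᶠ n : ℕ in Filter.atTop, 1 / ((n : ℝ) + 1) * ‖v‖ < e := by
      have := h0.mul_const ‖v‖
      rw [zero_mul] at this
      exact this.eventually (gt_mem_nhds he)
    filter_upwards [h1] with n hn s hs
    refine lt_of_le_of_lt ?_ hn
    rw [dist_comm, dist_eq_norm, ← sub_apply, dG_sub]
    exact norm_dG_le' _ _ _ (hG n _ (hΩ s hs)).2.1 (hG n _ (hΩ s hs)).2.2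
  · exact Filter.Eventually.of_forall fun n s _ => (hJ n).line z v s
  · intro s hs
    rw [tendsto_iff_norm_sub_tendsto_zero]
    exact squeeze_zero (fun _ => norm_nonneg _) (fun n => (hG n _ (hΩ s hs)).1) h0

def Good (Ω : Set ℂ) (Bc : (ℂ → ℂ) → Prop) (r0 : ℝ) (x y : ℝ) : Prop :=
  ∀ r ∈ Ioc 0 r0, closedBall ((x : ℂ) + y * Complex.I) r ⊆ Ω ∨
    (0 ≤ x ∧ x < r ∧ (∀ G, Bc G → ∀ s : ℝ, (G (s * Complex.I)).im = 0) ∧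
      ∀ z : ℂ, 0 ≤ z.re → ‖z - y * Complex.I‖ ≤ r0 → z ∈ Ω)

lemma Good.vert {Ω Bc r0 x y} (h : Good Ω Bc r0 x y) (hr : 0 < r0) :
    ∃ ε > 0, ∀ s ∈ ball y ε, (x : ℂ) + (s : ℝ) * Complex.I ∈ Ω := by
  rcases h r0 ⟨hr, le_rfl⟩ with h1 | ⟨h1, h2, -, h4⟩
  · refine ⟨r0, hr, fun s hs => h1 ?_⟩
    rw [mem_closedBall, dist_eq_norm]
    have : (x : ℂ) + s * Complex.I - (x + y * Complex.I) = ((s - y : ℝ) : ℂ) * Complex.I := by push_cast; ring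
    rw [this, norm_mul, Complex.norm_I, mul_one, Complex.norm_real]
    rw [mem_ball, dist_eq_norm] at hs; exact hs.le
  · refine ⟨r0 - x, by linarith, fun s hs => h4 _ (by simpa using h1) ?_⟩
    have : (x : ℂ) + s * Complex.I - (y * Complex.I) = x + ((s - y : ℝ) : ℂ) * Complex.I := by push_cast; ring
    rw [this]
    refine (norm_add_le _ _).trans ?_
    rw [norm_mul, Complex.norm_I, mul_one, Complex.norm_real, Complex.norm_real, Real.norm_of_nonneg h1]
    rw [mem_ball, dist_eq_norm] at hs; linarith

lemma Good.mem {Ω Bc r0 x y} (h : Good Ω Bc r0 x y) (hr : 0 < r0) : (x : ℂ) + y * Complex.I ∈ Ω := by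
  obtain ⟨ε, hε, h1⟩ := h.vert hr
  exact h1 y (mem_ball_self hε)

lemma pair_solve {k X b : ℝ} {f : ℝ} {p : ℂ} (hk0 : 0 ≤ k) (hk : k < 1)
    (h1 : |f| ≤ k * ‖p‖ + b) (h2 : ‖p - f‖ ≤ X) : |f| ≤ (X + b) / (1 - k) ∧ ‖p‖ ≤ (X + b) / (1 - k) := by
  have h3 : ‖p‖ ≤ |f| + X := by
    have := norm_add_le (p - f) (f : ℂ)
    rw [sub_add_cancel, Complex.norm_real, Real.norm_eq_abs] at this; linarith
  have hk' : 0 < 1 - k := by linarith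
  have hX : 0 ≤ X := (norm_nonneg _).trans h2
  have h4 : ‖p‖ ≤ (X + b) / (1 - k) := by
    rw [le_div_iff₀ hk']; linarith
  refine ⟨?_, h4⟩
  rw [le_div_iff₀ hk'] at h4 ⊢
  nlinarith [abs_nonneg f, norm_nonneg p]

lemma dG_I_norm (f : ℝ) (p : ℂ) : ‖dG f p Complex.I‖ = ‖p - f‖ / 2 := by
  rw [dG_apply]
  have : (p * Complex.I + f * (starRingEnd ℂ) Complex.I) / 2 = (p - f) / 2 * Complex.I := by
    rw [Complex.conj_I]; ring
  rw [this, norm_mul, Complex.norm_I, norm_div]; simp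

lemma rpow_calc {K η L D γ A B : ℝ} (hK : 0 ≤ K) (hη : 0 < η) (hL : 1 ≤ L) (hD : 0 ≤ D) (hγ : 0 < γ) (hγ1 : 2 * γ ≤ 1) (hA : 0 ≤ A)
    (hB : 0 ≤ B) :
    6 * K * ((D + 2) ^ 2 * η) * ((D + 2) * η / (L * η)) ^ (2 * γ) * (A * (4 * (L * η)) ^ γ * η + B * η ^ γ * (L * η)) ≤
      6 * K * (D + 2) ^ 3 * (4 * L ^ (-γ) * A + L * B) * η ^ (2 + γ) := by
  have hL0 : 0 < L := by linarith
  have e1 : (D + 2) * η / (L * η) = (D + 2) / L := by field_simp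
  have e2 : ((D + 2) / L) ^ (2 * γ) ≤ (D + 2) * L ^ (-(2 * γ)) := by
    rw [Real.div_rpow (by linarith) hL0.le, Real.rpow_neg hL0.le, ← div_eq_mul_inv]
    gcongr
    calc (D + 2) ^ (2 * γ) ≤ (D + 2) ^ (1 : ℝ) := Real.rpow_le_rpow_of_exponent_le (by linarith) hγ1
      _ = D + 2 := Real.rpow_one _
  have e3 : (4 * (L * η)) ^ γ ≤ 4 * (L ^ γ * η ^ γ) := by
    rw [Real.mul_rpow (by norm_num) (by positivity), Real.mul_rpow hL0.le hη.le]
    gcongr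
    calc (4 : ℝ) ^ γ ≤ 4 ^ (1 : ℝ) := Real.rpow_le_rpow_of_exponent_le (by norm_num) (by linarith)
      _ = 4 := Real.rpow_one _
  have e4 : η ^ (2 + γ) = η ^ 2 * η ^ γ := by rw [Real.rpow_add hη]; norm_num
  have e5 : L ^ (-(2 * γ)) * L ^ γ = L ^ (-γ) := by rw [← Real.rpow_add hL0]; congr 1; ring
  have e6 : L ^ (-(2 * γ)) ≤ 1 := Real.rpow_le_one_of_one_le_of_nonpos hL (by linarith)
  rw [e1, e4]
  calc 6 * K * ((D + 2) ^ 2 * η) * ((D + 2) / L) ^ (2 * γ) * (A * (4 * (L * η)) ^ γ * η + B * η ^ γ * (L * η))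
      ≤ 6 * K * ((D + 2) ^ 2 * η) * ((D + 2) * L ^ (-(2 * γ))) * (A * (4 * (L ^ γ * η ^ γ)) * η + B * η ^ γ * (L * η)) := by gcongr
    _ = 6 * K * (D + 2) ^ 3 * (4 * (L ^ (-(2 * γ)) * L ^ γ) * A + L ^ (-(2 * γ)) * (L * B)) * (η ^ 2 * η ^ γ) := by ring
    _ ≤ 6 * K * (D + 2) ^ 3 * (4 * L ^ (-γ) * A + 1 * (L * B)) * (η ^ 2 * η ^ γ) := by rw [e5]; gcongr
    _ = _ := by ring

def gam (k : ℝ) : ℝ := 1 / (4 * KK k)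

lemma gam_pos {k : ℝ} (hk0 : 0 ≤ k) (hk : k < 1) : 0 < gam k := by
  have := KK_ge hk0 hk; unfold gam; positivity
lemma gam_le {k : ℝ} (hk0 : 0 ≤ k) (hk : k < 1) : gam k ≤ 1 / 4 := by
  have := KK_ge hk0 hk; unfold gam
  rw [div_le_div_iff₀ (by linarith) (by norm_num)]; linarith
lemma gam_two {k : ℝ} : 1 / (2 * KK k) = 2 * gam k := by
  unfold gam; ring

lemma Chart.tang0 {k A B Ω Bc g f p} (hk0 : 0 ≤ k) (hk : k < 1) (h : Chart k (gam k) A B Ω Bc g f p)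
    (hA : 0 ≤ A) (hB : 0 ≤ B) {L L' r0 x y h' : ℝ} (hL : 2 ≤ L) (hL' : 2 * L + 3 ≤ L') (hr0 : 0 < r0)
    (hh : 0 < h') (hh' : (2 * L' + 1) * h' ≤ r0) (hG : ∀ y', |y' - y| ≤ r0 → Good Ω Bc r0 x y') :
    ‖(p (x + (y + h' : ℝ) * Complex.I) - p (x + y * Complex.I)) -
      ((f (x + (y + h' : ℝ) * Complex.I) - f (x + y * Complex.I) : ℝ) : ℂ)‖ ≤
      2 * (CW (gam k) * (6 * KK k * 8 * (4 * L ^ (-gam k) * A + L * B) + 6 * KK k * (2 * L + 3) ^ 3 * (4 * L' ^ (-gam k) * A + L' * B)) * h' ^ gam k) := by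
  have hγ := gam_pos hk0 hk
  have hγ1 := gam_le hk0 hk
  have hK := KK_ge hk0 hk
  have hpi := Real.pi_gt_three
  have hL0 : 0 < L := by linarith
  have hL0' : 0 < L' := by linarith
  have hL'h : 7 * h' ≤ r0 := by nlinarith
  set κ1 := 6 * KK k * 8 * (4 * L ^ (-gam k) * A + L * B) with hκ1
  set κ2 := 6 * KK k * (2 * L + 3) ^ 3 * (4 * L' ^ (-gam k) * A + L' * B) with hκ2
  have hκ10 : 0 ≤ κ1 := by positivity
  have hκ20 : 0 ≤ κ2 := by positivity
  obtain ⟨ε1, hε1, v1⟩ := (hG y (by simpa using hr0.le)).vert hr0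
  obtain ⟨ε2, hε2, v2⟩ := (hG (y + h') (by rw [add_sub_cancel_left, abs_of_pos hh]; linarith)).vert hr0
  have cg := h.cg
  have := W_lemma (φ := fun s : ℝ => g (x + s * Complex.I)) (by fun_prop) hh hγ (add_nonneg hκ10 hκ20)
    (h.lj.line hε1 v1) (h.lj.line hε2 v2) (fun η hη y' hy' => by
      obtain ⟨hη0, hη1⟩ := hη
      have hGy := hG y' (by rw [abs_le]; constructor <;> linarith [hy'.1, hy'.2])
      have hex : ∀ t : ℝ, ‖Complex.exp (t * Complex.I)‖ = 1 := fun t => Complex.norm_exp_ofReal_mul_I t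
      rcases hGy ((2 * L + 1) * η) ⟨by positivity, by nlinarith⟩ with hb | ⟨hx0, hx1, hbc, hb⟩
      · have T := h.T hk0 hk hA hB hγ (c := x + y' * Complex.I) (α := -π) (β := π) (Or.inl (by ring))
          (by linarith) (by linarith) (R := L * η) (η := η) (d := 0) (D := 0) (by positivity) hη0 le_rfl (by simp)
          (by nlinarith) (fun s hs t _ => by
            constructor
            · apply hb
              rw [mem_closedBall, dist_eq_norm, pol_norm _ hs.1]; nlinarith [hs.2]
            · apply hb
              rw [mem_closedBall, dist_eq_norm, add_sub_right_comm]
              refine (norm_add_le _ _).trans ?_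
              rw [pol_norm _ hs.1, norm_mul, Complex.norm_I, Complex.norm_real, Real.norm_of_nonneg hη0.le]; nlinarith [hs.2])
        have T2 := T.trans (le_of_eq_of_le (by rw [gam_two]) (rpow_calc (by linarith) hη0 (by linarith) le_rfl hγ (by linarith) hA hB))
        have T3 : 6 * KK k * (0 + 2) ^ 3 * (4 * L ^ (-gam k) * A + L * B) * η ^ (2 + gam k) ≤ (κ1 + κ2) * η ^ (2 + gam k) := by
          gcongr; rw [hκ1]; norm_num; linarith
        refine le_of_eq_of_le (integral_congr fun ρ _ => ?_) (T2.trans T3)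
        congr 3 <;> congr 1 <;> push_cast <;> ring
      · have T := h.T hk0 hk hA hB hγ (c := y' * Complex.I) (α := -(π/2)) (β := π/2) (Or.inr ⟨rfl, rfl, by simp, hbc⟩)
          (by linarith) (by linarith) (R := L' * η) (η := η) (d := x) (D := 2 * L + 1) (by positivity) hη0 hx0 (by linarith)
          (by nlinarith) (fun s hs t ht => by
            have hre : 0 ≤ (pol (y' * Complex.I) s t).re := by
              have := Real.cos_nonneg_of_mem_Icc ht
              rw [pol, Complex.exp_mul_I, ← Complex.ofReal_cos, ← Complex.ofReal_sin]
              simp; exact mul_nonneg hs.1 this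
            have hl : (2 * L' + 1) * η ≤ r0 := by nlinarith
            constructor
            · apply hb _ hre
              rw [pol_norm _ hs.1]; nlinarith [hs.2]
            · apply hb _ (by simpa using hre)
              rw [add_sub_right_comm]
              refine (norm_add_le _ _).trans ?_
              rw [pol_norm _ hs.1, norm_mul, Complex.norm_I, Complex.norm_real, Real.norm_of_nonneg hη0.le]; nlinarith [hs.2])
        have T2 := T.trans (le_of_eq_of_le (by rw [gam_two]) (rpow_calc (by linarith) hη0 (by linarith) (by linarith) hγ (by linarith) hA hB))
        have T3 : 6 * KK k * (2 * L + 1 + 2) ^ 3 * (4 * L' ^ (-gam k) * A + L' * B) * η ^ (2 + gam k) ≤ (κ1 + κ2) * η ^ (2 + gam k) := by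
          rw [show 2 * L + 1 + 2 = 2 * L + 3 by ring]
          gcongr; linarith
        refine le_of_eq_of_le (integral_congr fun ρ _ => ?_) (T2.trans T3)
        congr 3 <;> congr 1 <;> push_cast <;> ring)
  rw [← sub_apply, dG_sub, dG_I_norm] at this
  linarith

lemma exists_rpow_small {γ c δ : ℝ} (hγ : 0 < γ) (hδ : 0 < δ) (m : ℝ) : ∃ L, m ≤ L ∧ c * L ^ (-γ) ≤ δ := by
  have := (tendsto_rpow_neg_atTop hγ).const_mul c
  rw [mul_zero] at this
  obtain ⟨L, h1, h2⟩ := ((this.eventually (gt_mem_nhds hδ)).and (Filter.eventually_ge_atTop m)).exists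
  exact ⟨L, h2, h1.le⟩

lemma Chart.tang {k : ℝ} (hk0 : 0 ≤ k) (hk : k < 1) {δ r0 : ℝ} (hδ : 0 < δ) (hr0 : 0 < r0) :
    ∃ h0 C : ℝ, 0 < h0 ∧ h0 ≤ r0 ∧ 0 ≤ C ∧ ∀ {A B Ω Bc g f p}, Chart k (gam k) A B Ω Bc g f p → 0 ≤ A → 0 ≤ B →
      ∀ x y, (∀ y', |y' - y| ≤ r0 → Good Ω Bc r0 x y') → ∀ h ∈ Icc 0 h0,
      |f (x + (y + h : ℝ) * Complex.I) - f (x + y * Complex.I)| ≤ (δ * A + C * B) * h ^ gam k ∧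
      ‖p (x + (y + h : ℝ) * Complex.I) - p (x + y * Complex.I)‖ ≤ (δ * A + C * B) * h ^ gam k := by
  have hγ := gam_pos hk0 hk
  have hK := KK_ge hk0 hk
  have hk' : 0 < 1 - k := by linarith
  have hCW := CW_pos hγ
  obtain ⟨L, hL, hL1⟩ := exists_rpow_small (c := 2 * CW (gam k) * (6 * KK k * 8 * 4)) (δ := δ * (1 - k) / 2) hγ (by positivity) 2
  obtain ⟨L', hL', hL1'⟩ := exists_rpow_small (c := 2 * CW (gam k) * (6 * KK k * (2 * L + 3) ^ 3 * 4)) (δ := δ * (1 - k) / 2) hγ (by positivity) (2 * L + 3)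
  have hL0 : 0 < L := by linarith
  have hL0' : 0 < L' := by linarith
  refine ⟨r0 / (2 * L' + 1), (2 * CW (gam k) * (6 * KK k * 8 * L + 6 * KK k * (2 * L + 3) ^ 3 * L') + 1) / (1 - k), by positivity,
    div_le_self hr0.le (by linarith), by positivity, ?_⟩
  intro A B Ω Bc g f p hC hA hB x y hG h hh
  rcases hh.1.eq_or_lt with h0 | h0
  · rw [← h0]; simp [Real.zero_rpow hγ.ne']
  have hh2 : (2 * L' + 1) * h ≤ r0 := by
    have := hh.2; rw [le_div_iff₀ (by linarith)] at this; linarith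
  have key := hC.tang0 hk0 hk hA hB hL hL' hr0 h0 hh2 hG
  have m1 := (hG (y + h) (by rw [add_sub_cancel_left, abs_of_pos h0]; nlinarith)).mem hr0
  have m2 := (hG y (by simpa using hr0.le)).mem hr0
  have pr := hC.pair _ m1 _ m2
  have e : ((x : ℂ) + (y + h : ℝ) * Complex.I) - (x + y * Complex.I) = h * Complex.I := by push_cast; ring
  rw [e, norm_mul, Complex.norm_I, mul_one, Complex.norm_real, Real.norm_of_nonneg h0.le] at pr
  have := pair_solve hk0 hk pr key
  have hp : 0 < h ^ gam k := by positivity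
  have fin : (2 * (CW (gam k) * (6 * KK k * 8 * (4 * L ^ (-gam k) * A + L * B) + 6 * KK k * (2 * L + 3) ^ 3 * (4 * L' ^ (-gam k) * A + L' * B)) * h ^ gam k) + B * h ^ gam k) / (1 - k)
     ≤ (δ * A + (2 * CW (gam k) * (6 * KK k * 8 * L + 6 * KK k * (2 * L + 3) ^ 3 * L') + 1) / (1 - k) * B) * h ^ gam k := by
    rw [div_le_iff₀ hk']
    have a1 := mul_le_mul_of_nonneg_right (mul_le_mul_of_nonneg_right (add_le_add hL1 hL1') hA) hp.le
    have a2 : (2 * CW (gam k) * (6 * KK k * 8 * L + 6 * KK k * (2 * L + 3) ^ 3 * L') + 1) / (1 - k) * (1 - k) = 2 * CW (gam k) * (6 * KK k * 8 * L + 6 * KK k * (2 * L + 3) ^ 3 * L') + 1 := by field_simp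
    calc _ = (2 * CW (gam k) * (6 * KK k * 8 * 4) * L ^ (-gam k) + 2 * CW (gam k) * (6 * KK k * (2 * L + 3) ^ 3 * 4) * L' ^ (-gam k)) * A * h ^ gam k
        + (2 * CW (gam k) * (6 * KK k * 8 * L + 6 * KK k * (2 * L + 3) ^ 3 * L') + 1) * B * h ^ gam k := by ring
      _ ≤ (δ * (1 - k) / 2 + δ * (1 - k) / 2) * A * h ^ gam k
        + (2 * CW (gam k) * (6 * KK k * 8 * L + 6 * KK k * (2 * L + 3) ^ 3 * L') + 1) * B * h ^ gam k := by linarith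
      _ = (δ * (1 - k) / 2 + δ * (1 - k) / 2) * A * h ^ gam k
        + ((2 * CW (gam k) * (6 * KK k * 8 * L + 6 * KK k * (2 * L + 3) ^ 3 * L') + 1) / (1 - k) * (1 - k)) * B * h ^ gam k := by rw [a2]
      _ = _ := by ring
  exact ⟨this.1.trans fin, this.2.trans fin⟩

end FN

namespace FN
open MeasureTheory intervalIntegral

lemma tri3 {E : Type*} [SeminormedAddCommGroup E] {a b a' b' : E} {ε X : ℝ} (h1 : ‖a - a'‖ ≤ ε) (h2 : ‖b - b'‖ ≤ ε) (h : ‖a' - b'‖ ≤ X) :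
    ‖a - b‖ ≤ X + 2 * ε := by
  have : a - b = (a - a') + (a' - b') - (b - b') := by abel
  rw [this]
  have := norm_sub_le ((a - a') + (a' - b')) (b - b')
  have := norm_add_le (a - a') (a' - b')
  linarith

lemma Chart.normal {k γ A B Ω Bc g f p} (h : Chart k γ A B Ω Bc g f p) (hk0 : 0 ≤ k) (hk : k < 1)
    {x y d T : ℝ} (hd : 0 < d)
    (hm : ∀ s ∈ Icc 0 d, ∀ t ∈ Icc 0 d, ((x + s : ℝ) : ℂ) + (y + t : ℝ) * Complex.I ∈ Ω)
    (hT : ∀ s ∈ Icc 0 d, ∀ t ∈ Icc 0 d,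
      |f ((x + s : ℝ) + (y + t : ℝ) * Complex.I) - f ((x + s : ℝ) + y * Complex.I)| ≤ T ∧
      ‖p ((x + s : ℝ) + (y + t : ℝ) * Complex.I) - p ((x + s : ℝ) + y * Complex.I)‖ ≤ T) :
      |f ((x + d : ℝ) + y * Complex.I) - f (x + y * Complex.I)| ≤ (6 * T + B * d ^ γ) / (1 - k) ∧
      ‖p ((x + d : ℝ) + y * Complex.I) - p (x + y * Complex.I)‖ ≤ (6 * T + B * d ^ γ) / (1 - k) := by
  have i0 : (0 : ℝ) ∈ Icc 0 d := ⟨le_rfl, hd.le⟩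
  have id' : d ∈ Icc 0 d := ⟨hd.le, le_rfl⟩
  have mx : ∀ s ∈ Icc 0 d, ((x + s : ℝ) : ℂ) + y * Complex.I ∈ Ω := fun s hs => by simpa using hm s hs 0 i0
  have m0 : (x : ℂ) + y * Complex.I ∈ Ω := by simpa using hm 0 i0 0 i0
  have pr := h.pair _ (mx d id') _ m0
  have e : ((x + d : ℝ) : ℂ) + y * Complex.I - (x + y * Complex.I) = (d : ℂ) := by push_cast; ring
  rw [e, Complex.norm_real, Real.norm_of_nonneg hd.le] at pr
  refine pair_solve hk0 hk pr ?_
  have hmain : ‖dG (f ((x + d : ℝ) + y * Complex.I) - f (x + y * Complex.I)) (p ((x + d : ℝ) + y * Complex.I) - p (x + y * Complex.I)) Complex.I‖ ≤ 3 * T := by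
    refine le_of_eps (Z := 8) (by norm_num) fun ε hε => ?_
    obtain ⟨G, F, P, hJ, -, ha⟩ := h.lj ε hε
    have hT' : ∀ s ∈ Icc 0 d, ∀ t ∈ Icc 0 d,
      |F ((x + s : ℝ) + (y + t : ℝ) * Complex.I) - F ((x + s : ℝ) + y * Complex.I)| ≤ T + 2 * ε ∧
      ‖P ((x + s : ℝ) + (y + t : ℝ) * Complex.I) - P ((x + s : ℝ) + y * Complex.I)‖ ≤ T + 2 * ε := fun s hs t ht =>
        ⟨tri3 (E := ℝ) (ha _ (hm s hs t ht)).2.1 (ha _ (mx s hs)).2.1 (hT s hs t ht).1,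
          tri3 (ha _ (hm s hs t ht)).2.2 (ha _ (mx s hs)).2.2 (hT s hs t ht).2⟩
    have q1 := hJ.dbl (x + (y + d : ℝ) * Complex.I) (x + y * Complex.I) 1 hd.le (a := T + 2 * ε) (fun s hs => by
      have := hT' s hs d id'
      have e1 : (x : ℂ) + (y + d : ℝ) * Complex.I + s * 1 = (x + s : ℝ) + (y + d : ℝ) * Complex.I := by push_cast; ring
      have e2 : (x : ℂ) + y * Complex.I + s * 1 = (x + s : ℝ) + y * Complex.I := by push_cast; ring
      rwa [e1, e2])
    set z1 : ℂ := (x + d : ℝ) + y * Complex.I with hz1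
    set z0 : ℂ := x + y * Complex.I with hz0
    set D := dG (F z1) (P z1) Complex.I - dG (F z0) (P z0) Complex.I with hD
    have q2 := norm_image_sub_le_of_norm_deriv_le_segment' (f := fun t : ℝ => G (z1 + t * Complex.I) - G (z0 + t * Complex.I) - (t : ℂ) * D)
      (f' := fun t => dG (F (z1 + t * Complex.I)) (P (z1 + t * Complex.I)) Complex.I - dG (F (z0 + t * Complex.I)) (P (z0 + t * Complex.I)) Complex.I - D)
      (a := 0) (b := d) (C := 2 * (T + 2 * ε))
      (fun t _ => ((((hJ.line z1 _ t).sub (hJ.line z0 _ t)).sub (((hasDerivAt_id t).ofReal_comp.mul_const D).congr_deriv (by simp))).hasDerivWithinAt))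
      (fun t ht => by
        have t1 := hT' d id' t ⟨ht.1, ht.2.le⟩
        have t2 := hT' 0 i0 t ⟨ht.1, ht.2.le⟩
        have e1 : ((x + d : ℝ) : ℂ) + (y + t : ℝ) * Complex.I = z1 + t * Complex.I := by rw [hz1]; push_cast; ring
        have e2 : ((x + 0 : ℝ) : ℂ) + (y + t : ℝ) * Complex.I = z0 + t * Complex.I := by rw [hz0]; push_cast; ring
        have e3 : ((x + 0 : ℝ) : ℂ) + y * Complex.I = z0 := by rw [hz0]; push_cast; ring
        rw [e1, ← hz1] at t1
        rw [e2, e3] at t2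
        have e4 : dG (F (z1 + t * Complex.I)) (P (z1 + t * Complex.I)) Complex.I - dG (F (z0 + t * Complex.I)) (P (z0 + t * Complex.I)) Complex.I - D
          = dG (F (z1 + t * Complex.I) - F z1) (P (z1 + t * Complex.I) - P z1) Complex.I - dG (F (z0 + t * Complex.I) - F z0) (P (z0 + t * Complex.I) - P z0) Complex.I := by
          rw [hD, ← dG_sub, ← dG_sub]; simp only [sub_apply]; ring
        rw [e4]
        refine (norm_sub_le _ _).trans ?_
        have a1 := norm_dG_le' _ _ Complex.I t1.1 t1.2
        have a2 := norm_dG_le' _ _ Complex.I t2.1 t2.2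
        rw [Complex.norm_I] at a1 a2; linarith) d id'
    have e5 : G (z1 + d * Complex.I) - G (z0 + d * Complex.I) - d * D - (G (z1 + ((0:ℝ):ℂ) * Complex.I) - G (z0 + ((0:ℝ):ℂ) * Complex.I) - ((0:ℝ):ℂ) * D)
      = ((G (z1 + d * Complex.I) - G (z0 + d * Complex.I)) - (G z1 - G z0)) - d * D := by push_cast; simp; ring
    simp only [e5] at q2
    have e6 : G (x + (y + d : ℝ) * Complex.I + d * 1) - G (x + (y + d : ℝ) * Complex.I) - (G (z0 + d * 1) - G z0) =
      (G (z1 + d * Complex.I) - G (z0 + d * Complex.I)) - (G z1 - G z0) := by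
      have w1 : (x : ℂ) + (y + d : ℝ) * Complex.I + d * 1 = z1 + d * Complex.I := by rw [hz1]; push_cast; ring
      have w2 : (x : ℂ) + (y + d : ℝ) * Complex.I = z0 + d * Complex.I := by rw [hz0]; push_cast; ring
      have w3 : z0 + d * 1 = z1 := by rw [hz0, hz1]; push_cast; ring
      rw [w1, w2, w3]
    rw [e6, norm_one] at q1
    have q3 : ‖D‖ * d ≤ 3 * (T + 2 * ε) * d := by
      have : ‖(d : ℂ) * D‖ ≤ ‖(G (z1 + d * Complex.I) - G (z0 + d * Complex.I)) - (G z1 - G z0)‖ + ‖((G (z1 + d * Complex.I) - G (z0 + d * Complex.I)) - (G z1 - G z0)) - d * D‖ := by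
        have := norm_sub_le ((G (z1 + d * Complex.I) - G (z0 + d * Complex.I)) - (G z1 - G z0)) (((G (z1 + d * Complex.I) - G (z0 + d * Complex.I)) - (G z1 - G z0)) - d * D)
        rwa [sub_sub_cancel] at this
      rw [norm_mul, Complex.norm_real, Real.norm_of_nonneg hd.le] at this
      linarith
    have q4 := le_of_mul_le_mul_right q3 hd
    have a1 := ha _ (mx d id')
    have a0 := ha _ m0
    have n1 := norm_dG_le' (F z1 - f z1) (P z1 - p z1) Complex.I a1.2.1 a1.2.2
    have n0 := norm_dG_le' (F z0 - f z0) (P z0 - p z0) Complex.I a0.2.1 a0.2.2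
    rw [← dG_sub, Complex.norm_I, mul_one, sub_apply] at n1 n0
    rw [← dG_sub, sub_apply]
    have := tri3 ((norm_sub_rev _ _).trans_le n1) ((norm_sub_rev _ _).trans_le n0) q4
    linarith
  rw [dG_I_norm] at hmain
  linarith

lemma Chart.normal' {k γ A B Ω Bc g f p} (h : Chart k γ A B Ω Bc g f p) (hk0 : 0 ≤ k) (hk : k < 1) (hγ : 0 < γ) (hB : 0 ≤ B)
    {x x' y h0 T : ℝ} (hT0 : 0 ≤ T) (hxx : x ≤ x') (hx' : x' - x ≤ h0)
    (hm : ∀ s ∈ Icc x x', ∀ t ∈ Icc 0 h0, (s : ℂ) + (y + t : ℝ) * Complex.I ∈ Ω)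
    (hT : ∀ s ∈ Icc x x', ∀ t ∈ Icc 0 h0,
      |f (s + (y + t : ℝ) * Complex.I) - f (s + y * Complex.I)| ≤ T * t ^ γ ∧
      ‖p (s + (y + t : ℝ) * Complex.I) - p (s + y * Complex.I)‖ ≤ T * t ^ γ) :
      |f (x' + y * Complex.I) - f (x + y * Complex.I)| ≤ (6 * T + B) / (1 - k) * (x' - x) ^ γ ∧
      ‖p (x' + y * Complex.I) - p (x + y * Complex.I)‖ ≤ (6 * T + B) / (1 - k) * (x' - x) ^ γ := by
  rcases hxx.eq_or_lt with e | hlt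
  · rw [← e]; simp [Real.zero_rpow hγ.ne']
  have hd : 0 < x' - x := by linarith
  have := h.normal hk0 hk (x := x) (y := y) (d := x' - x) (T := T * (x' - x) ^ γ) hd
    (fun s hs t ht => hm (x + s) ⟨by linarith [hs.1], by linarith [hs.2]⟩ t ⟨ht.1, ht.2.trans hx'⟩)
    (fun s hs t ht => by
      have h1 := hT (x + s) ⟨by linarith [hs.1], by linarith [hs.2]⟩ t ⟨ht.1, ht.2.trans hx'⟩
      have h2 : T * t ^ γ ≤ T * (x' - x) ^ γ := mul_le_mul_of_nonneg_left (Real.rpow_le_rpow ht.1 ht.2 hγ.le) hT0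
      exact ⟨h1.1.trans h2, h1.2.trans h2⟩)
  rw [add_sub_cancel] at this
  convert this using 2 <;> ring

/-- improvement of the Hölder constant on a rectangle -/
lemma Chart.improve {k : ℝ} (hk0 : 0 ≤ k) (hk : k < 1) {δ r0 : ℝ} (hδ : 0 < δ) (hr0 : 0 < r0) :
    ∃ h0 C : ℝ, 0 < h0 ∧ h0 ≤ r0 ∧ 0 ≤ C ∧ ∀ {A B Ω Bc g f p}, Chart k (gam k) A B Ω Bc g f p → 0 ≤ A → 0 ≤ B →
      ∀ x0 x1 y0 y1, (∀ x ∈ Icc x0 x1, ∀ y ∈ Icc (y0 - r0) (y1 + r0), Good Ω Bc r0 x y) →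
      ∀ z z' : ℂ, z.re ∈ Icc x0 x1 → z'.re ∈ Icc x0 x1 → z.im ∈ Icc y0 y1 → z'.im ∈ Icc y0 y1 → ‖z - z'‖ ≤ h0 →
      |f z - f z'| ≤ (δ * A + C * B) * ‖z - z'‖ ^ gam k ∧ ‖p z - p z'‖ ≤ (δ * A + C * B) * ‖z - z'‖ ^ gam k := by
  have hγ := gam_pos hk0 hk
  have hk' : 0 < 1 - k := by linarith
  obtain ⟨h0, C, hh0, hhr, hC, H⟩ := Chart.tang hk0 hk (δ := δ * (1 - k) / 7) (r0 := r0) (by positivity) hr0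
  refine ⟨h0, (7 * C + 1) / (1 - k), hh0, hhr, by positivity, ?_⟩
  intro A B Ω Bc g f p hCh hA hB x0 x1 y0 y1 hG z z' hx hx' hy hy' hzz
  set T := δ * (1 - k) / 7 * A + C * B with hTdef
  have hT0 : 0 ≤ T := by positivity
  have tang : ∀ x ∈ Icc x0 x1, ∀ y ∈ Icc y0 y1, ∀ h ∈ Icc 0 h0, |f (x + (y + h : ℝ) * Complex.I) - f (x + y * Complex.I)| ≤ T * h ^ gam k ∧
      ‖p (x + (y + h : ℝ) * Complex.I) - p (x + y * Complex.I)‖ ≤ T * h ^ gam k := fun x hx y hy =>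
    H hCh hA hB x y (fun y' hy' => hG x hx y' (by rw [abs_le] at hy'; exact ⟨by linarith [hy.1], by linarith [hy.2]⟩))
  -- tangential, symmetric
  have tang2 : ∀ x ∈ Icc x0 x1, ∀ y ∈ Icc y0 y1, ∀ y' ∈ Icc y0 y1, |y - y'| ≤ h0 → |f (x + y * Complex.I) - f (x + y' * Complex.I)| ≤ T * |y - y'| ^ gam k ∧
      ‖p (x + y * Complex.I) - p (x + y' * Complex.I)‖ ≤ T * |y - y'| ^ gam k := by
    intro x hx y hy y' hy' hyy
    rcases le_total y' y with hle | hle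
    · have := tang x hx y' hy' (y - y') ⟨by linarith, by rwa [abs_of_nonneg (by linarith)] at hyy⟩
      rw [add_sub_cancel] at this
      rwa [abs_of_nonneg (show 0 ≤ y - y' by linarith)]
    · rw [abs_sub_comm] at hyy
      have := tang x hx y hy (y' - y) ⟨by linarith, by rwa [abs_of_nonneg (by linarith)] at hyy⟩
      rw [add_sub_cancel, abs_sub_comm, norm_sub_rev] at this
      rwa [abs_sub_comm y y', abs_of_nonneg (show 0 ≤ y' - y by linarith)]
  have norm1 : ∀ x ∈ Icc x0 x1, ∀ x' ∈ Icc x0 x1, ∀ y ∈ Icc y0 y1, x ≤ x' → x' - x ≤ h0 →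
      |f (x' + y * Complex.I) - f (x + y * Complex.I)| ≤ (6 * T + B) / (1 - k) * (x' - x) ^ gam k ∧
      ‖p (x' + y * Complex.I) - p (x + y * Complex.I)‖ ≤ (6 * T + B) / (1 - k) * (x' - x) ^ gam k := by
    intro x hx x' hx' y hy h1 h2
    refine hCh.normal' hk0 hk hγ hB hT0 h1 h2 (fun s hs t ht => ?_) (fun s hs t ht => ?_)
    · exact (hG s ⟨hx.1.trans hs.1, hs.2.trans hx'.2⟩ (y + t) ⟨by linarith [hy.1, ht.1], by linarith [hy.2, ht.2]⟩).mem hr0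
    · exact tang s ⟨hx.1.trans hs.1, hs.2.trans hx'.2⟩ y hy t ht
  have norm2 : ∀ x ∈ Icc x0 x1, ∀ x' ∈ Icc x0 x1, ∀ y ∈ Icc y0 y1, |x - x'| ≤ h0 →
      |f (x + y * Complex.I) - f (x' + y * Complex.I)| ≤ (6 * T + B) / (1 - k) * |x - x'| ^ gam k ∧
      ‖p (x + y * Complex.I) - p (x' + y * Complex.I)‖ ≤ (6 * T + B) / (1 - k) * |x - x'| ^ gam k := by
    intro x hx x' hx' y hy h1
    rcases le_total x' x with hle | hle
    · rw [abs_of_nonneg (show 0 ≤ x - x' by linarith)] at h1 ⊢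
      exact norm1 x' hx' x hx y hy hle h1
    · rw [abs_sub_comm, norm_sub_rev, abs_sub_comm x x'] at *
      rw [abs_of_nonneg (show 0 ≤ x' - x by linarith)] at h1 ⊢
      exact norm1 x hx x' hx' y hy hle h1
  have e : ∀ z : ℂ, z = (z.re : ℂ) + z.im * Complex.I := fun z => (Complex.re_add_im z).symm
  have hre : |z.re - z'.re| ≤ ‖z - z'‖ := by rw [← Complex.sub_re]; exact Complex.abs_re_le_norm _
  have him : |z.im - z'.im| ≤ ‖z - z'‖ := by rw [← Complex.sub_im]; exact Complex.abs_im_le_norm _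
  have n := norm2 z.re hx z'.re hx' z.im hy (hre.trans hzz)
  have t := tang2 z'.re hx' z.im hy z'.im hy' (him.trans hzz)
  rw [← e z] at n
  rw [← e z'] at t
  have r1 : |z.re - z'.re| ^ gam k ≤ ‖z - z'‖ ^ gam k := Real.rpow_le_rpow (abs_nonneg _) hre hγ.le
  have r2 : |z.im - z'.im| ^ gam k ≤ ‖z - z'‖ ^ gam k := Real.rpow_le_rpow (abs_nonneg _) him hγ.le
  have hr : 0 ≤ ‖z - z'‖ ^ gam k := by positivity
  have b1 : (6 * T + B) / (1 - k) * |z.re - z'.re| ^ gam k ≤ (6 * T + B) / (1 - k) * ‖z - z'‖ ^ gam k := by gcongr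
  have b2 : T * |z.im - z'.im| ^ gam k ≤ T * ‖z - z'‖ ^ gam k := by gcongr
  have b3 : (6 * T + B) / (1 - k) + T ≤ δ * A + (7 * C + 1) / (1 - k) * B := by
    have : δ * A + (7 * C + 1) / (1 - k) * B = (7 * T + B) / (1 - k) := by rw [hTdef]; field_simp; ring
    rw [this, ← sub_nonneg]
    have : (7 * T + B) / (1 - k) - ((6 * T + B) / (1 - k) + T) = T * k / (1 - k) := by field_simp; ring
    rw [this]; positivity
  have b4 := mul_le_mul_of_nonneg_right b3 hr
  rw [add_mul] at b4
  constructor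
  · have := abs_sub_le (f z) (f (z'.re + z.im * Complex.I)) (f z')
    linarith [n.1, t.1]
  · have := norm_sub_le_norm_sub_add_norm_sub (p z) (p (z'.re + z.im * Complex.I)) (p z')
    linarith [n.2, t.2]

end FN

namespace FN
open MeasureTheory intervalIntegral

abbrev Jt : Type := ℝ × ℂ × ℝ × ℂ

def jw (J : ℂ → Jt) (z : ℂ) : ℝ := (J z).1
def jg (J : ℂ → Jt) (z : ℂ) : ℂ := (J z).2.1
def jf (J : ℂ → Jt) (z : ℂ) : ℝ := (J z).2.2.1
def jp (J : ℂ → Jt) (z : ℂ) : ℂ := (J z).2.2.2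

lemma jw_sub (J K : ℂ → Jt) (z : ℂ) : jw (J - K) z = jw J z - jw K z := rfl
lemma jg_sub (J K : ℂ → Jt) (z : ℂ) : jg (J - K) z = jg J z - jg K z := rfl
lemma jf_sub (J K : ℂ → Jt) (z : ℂ) : jf (J - K) z = jf J z - jf K z := rfl
lemma jp_sub (J K : ℂ → Jt) (z : ℂ) : jp (J - K) z = jp J z - jp K z := rfl

lemma Jt_le {a : Jt} {r : ℝ} : ‖a‖ ≤ r ↔ |a.1| ≤ r ∧ ‖a.2.1‖ ≤ r ∧ |a.2.2.1| ≤ r ∧ ‖a.2.2.2‖ ≤ r := by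
  rw [Prod.norm_def, Prod.norm_def, Prod.norm_def]; simp [and_assoc]

lemma jw_cont {J : ℂ → Jt} (h : Continuous J) : Continuous (jw J) := continuous_fst.comp h
lemma jg_cont {J : ℂ → Jt} (h : Continuous J) : Continuous (jg J) := by unfold jg; fun_prop
lemma jf_cont {J : ℂ → Jt} (h : Continuous J) : Continuous (jf J) := by unfold jf; fun_prop
lemma jp_cont {J : ℂ → Jt} (h : Continuous J) : Continuous (jp J) := by unfold jp; fun_prop

/-- Differential of a real function with complex gradient `g`. -/
def dW (g : ℂ) : ℂ →L[ℝ] ℝ := Complex.reCLM.comp (ContinuousLinearMap.mul ℝ ℂ g)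

lemma dW_apply (g v : ℂ) : dW g v = (g * v).re := rfl

lemma norm_dW_le (g v : ℂ) : |dW g v| ≤ ‖g‖ * ‖v‖ := by
  rw [dW_apply, ← norm_mul]; exact Complex.abs_re_le_norm _

structure SJet (J : ℂ → Jt) : Prop where
  gj : GJet (jg J) (jf J) (jp J)
  dw : ∀ z, HasFDerivAt (jw J) (dW (jg J z)) z
  bd : ∀ z : ℂ, ‖z‖ = 1 → jw J z = 0

lemma SJet.sub {J K : ℂ → Jt} (hJ : SJet J) (hK : SJet K) : SJet (J - K) where
  gj := ⟨hJ.gj.cd.sub hK.gj.cd, fun z => ((hJ.gj.d z).sub (hK.gj.d z)).congr_fderiv (by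
    ext v; simp [dG_apply, jf_sub, jp_sub]; ring)⟩
  dw z := ((hJ.dw z).sub (hK.dw z)).congr_fderiv (by ext v; simp [dW_apply, jg_sub]; ring)
  bd z hz := by rw [jw_sub, hJ.bd z hz, hK.bd z hz, sub_zero]

def Adm (J : ℂ → Jt) : Prop := Continuous J ∧
  ∀ ε > 0, ∃ S, SJet S ∧ ∀ z : ℂ, ‖z‖ ≤ 1 → ‖S z - J z‖ ≤ ε

lemma Adm.sub {J K : ℂ → Jt} (hJ : Adm J) (hK : Adm K) : Adm (J - K) := by
  refine ⟨hJ.1.sub hK.1, fun ε hε => ?_⟩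
  obtain ⟨S, hS, h1⟩ := hJ.2 (ε / 2) (by positivity)
  obtain ⟨T, hT, h2⟩ := hK.2 (ε / 2) (by positivity)
  refine ⟨S - T, hS.sub hT, fun z hz => ?_⟩
  have : (S - T) z - (J - K) z = (S z - J z) - (T z - K z) := by simp [Pi.sub_apply]; abel
  rw [this]
  linarith [norm_sub_le (S z - J z) (T z - K z), h1 z hz, h2 z hz]

/-- integration over the unit disc in polar coordinates -/
def II (h : ℂ → ℝ) : ℝ := ∫ s in (0 : ℝ)..1, s * ∫ t in (-π)..π, h (pol 0 s t)

lemma pol0_norm {s t : ℝ} (hs : s ∈ Icc (0 : ℝ) 1) : ‖pol 0 s t‖ ≤ 1 := by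
  simp [pol, Complex.norm_exp_ofReal_mul_I, abs_of_nonneg hs.1]; exact hs.2

lemma II_in_cont {h : ℂ → ℝ} (hc : Continuous h) :
    Continuous fun s : ℝ => ∫ t in (-π)..π, h (pol 0 s t) := by
  apply continuous_parametric_intervalIntegral_of_continuous' (f := fun s t => h (pol 0 s t))
  have := pol_cont 0
  simp only [Function.uncurry_def]; fun_prop

lemma II_t_cont {h : ℂ → ℝ} (hc : Continuous h) (s : ℝ) :
    Continuous fun t : ℝ => h (pol 0 s t) :=
  hc.comp ((pol_cont 0).comp (Continuous.prodMk_right s))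

lemma pi_le : -π ≤ π := by linarith [Real.pi_pos]

lemma II_mono {h k : ℂ → ℝ} (hh : Continuous h) (hk : Continuous k)
    (hle : ∀ z : ℂ, ‖z‖ ≤ 1 → h z ≤ k z) : II h ≤ II k := by
  have c1 := II_in_cont hh; have c2 := II_in_cont hk
  refine integral_mono_on zero_le_one (Continuous.intervalIntegrable (by fun_prop) _ _)
    (Continuous.intervalIntegrable (by fun_prop) _ _) fun s hs => ?_
  refine mul_le_mul_of_nonneg_left ?_ hs.1
  refine integral_mono_on pi_le ((II_t_cont hh s).intervalIntegrable _ _)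
    ((II_t_cont hk s).intervalIntegrable _ _) fun t _ => hle _ (pol0_norm hs)

lemma II_add {h k : ℂ → ℝ} (hh : Continuous h) (hk : Continuous k) :
    II (fun z => h z + k z) = II h + II k := by
  have c1 := II_in_cont hh; have c2 := II_in_cont hk
  unfold II
  rw [← intervalIntegral.integral_add (Continuous.intervalIntegrable (by fun_prop) _ _)
    (Continuous.intervalIntegrable (by fun_prop) _ _)]
  refine intervalIntegral.integral_congr fun s _ => ?_
  simp only
  rw [intervalIntegral.integral_add ((II_t_cont hh s).intervalIntegrable _ _)
    ((II_t_cont hk s).intervalIntegrable _ _), mul_add]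

lemma II_const_mul (c : ℝ) (h : ℂ → ℝ) : II (fun z => c * h z) = c * II h := by
  unfold II
  rw [← intervalIntegral.integral_const_mul]
  refine intervalIntegral.integral_congr fun s _ => ?_
  simp only
  rw [intervalIntegral.integral_const_mul]; ring

lemma II_const (c : ℝ) : II (fun _ => c) = π * c := by
  unfold II
  simp only [intervalIntegral.integral_const]
  rw [intervalIntegral.integral_mul_const]
  simp; ring

lemma SJet.energy {J} (h : SJet J) :
    II (fun z => ‖jp J z‖ ^ 2) ≤ II (fun z => jf J z ^ 2) := by
  have hB : Bd (jg J) 0 (-π) π := Or.inl (by ring)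
  have h1 := h.gj.energy hB zero_le_one
  have c0 := h.gj.cd.continuous
  have c1 := h.gj.cont_f; have c2 := h.gj.cont_p
  have e1 : II (fun z => 1 / 4 * ‖jp J z‖ ^ 2 + -(1 / 4) * jf J z ^ 2)
      = GG (jg J) (jf J) (jp J) 0 (-π) π 1 := by
    rw [← h1]; unfold II
    refine intervalIntegral.integral_congr fun s _ => ?_
    simp only
    congr 1
    refine intervalIntegral.integral_congr fun t _ => ?_
    ring
  rw [II_add (by fun_prop) (by fun_prop), II_const_mul, II_const_mul] at e1
  suffices GG (jg J) (jf J) (jp J) 0 (-π) π 1 ≤ 0 by linarith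
  set X : ℝ → ℝ := fun t => (jg J (pol 0 1 t)).re with hX
  set Y : ℝ → ℝ := fun t => -(jg J (pol 0 1 t)).im with hY
  set X' : ℝ → ℝ := fun t => (dG (jf J (pol 0 1 t)) (jp J (pol 0 1 t))
    ((1 : ℝ) * (Complex.exp (t * Complex.I) * Complex.I))).re with hX'
  set Y' : ℝ → ℝ := fun t => -(dG (jf J (pol 0 1 t)) (jp J (pol 0 1 t))
    ((1 : ℝ) * (Complex.exp (t * Complex.I) * Complex.I))).im with hY'
  have dX : ∀ t, HasDerivAt X (X' t) t := fun t => hd_re (h.gj.dt 0 1 t)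
  have dY : ∀ t, HasDerivAt Y (Y' t) t := fun t => (hd_im (h.gj.dt 0 1 t)).neg
  have hc : Continuous fun t => pol 0 1 t := (pol_cont 0).comp (Continuous.prodMk_right 1)
  have cX : Continuous X := by simp only [hX]; exact Complex.continuous_re.comp (by fun_prop)
  have cY : Continuous Y := by simp only [hY]; exact (Complex.continuous_im.comp (by fun_prop)).neg
  have cX' : Continuous X' := by
    simp only [hX', dG_apply]; exact Complex.continuous_re.comp (by fun_prop)
  have cY' : Continuous Y' := by
    simp only [hY', dG_apply]; exact (Complex.continuous_im.comp (by fun_prop)).neg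
  have con : ∀ t, X t * sin t = Y t * cos t := by
    intro t
    have d1 := (h.dw (pol 0 1 t)).comp_hasDerivAt t (pol_dt 0 1 t)
    have e : (fun t => jw J (pol 0 1 t)) = fun _ => 0 := by
      funext t; exact h.bd _ (by simp [pol, Complex.norm_exp_ofReal_mul_I])
    have d2 : HasDerivAt (fun t => jw J (pol 0 1 t)) 0 t := by rw [e]; exact hasDerivAt_const _ _
    have d3 := d1.unique d2
    rw [dW_apply, Complex.exp_mul_I, ← Complex.ofReal_cos, ← Complex.ofReal_sin] at d3
    simp at d3
    rw [Complex.cos_ofReal_re, Complex.sin_ofReal_re] at d3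
    simp only [hX, hY]
    linarith
  have con' : ∀ t, X' t * sin t + X t * cos t = Y' t * cos t - Y t * sin t := by
    intro t
    have d1 := (dX t).mul (Real.hasDerivAt_sin t)
    have d2 := (dY t).mul (Real.hasDerivAt_cos t)
    have e : (X * sin) = (Y * cos) := by funext t; exact con t
    rw [e] at d1
    have := d1.unique d2
    linarith
  have key : ∀ t, Y t * X' t = (X' t * Y t + X t * Y' t) / 2 - (X t ^ 2 + Y t ^ 2) / 2 := by
    intro t
    have h1 := Real.cos_sq_add_sin_sq t
    have h2 := con t; have h3 := con' t
    have hx : X t = (X t * cos t + Y t * sin t) * cos t := by linear_combination (- X t) * h1 + sin t * h2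
    have hy : Y t = (X t * cos t + Y t * sin t) * sin t := by linear_combination (- Y t) * h1 - cos t * h2
    generalize X t * cos t + Y t * sin t = r at hx hy
    rw [hx, hy] at h3 ⊢
    linear_combination (r / 2) * h3
  have dT : ∀ t, HasDerivAt (fun t => X t * Y t / 2) ((X' t * Y t + X t * Y' t) / 2) t :=
    fun t => ((dX t).mul (dY t)).div_const 2
  have per : pol 0 1 (-π) = pol 0 1 π := by
    have := pol_periodic 0 1 (-π)
    rw [show -π + 2 * π = π by ring] at this; exact this.symm
  have eT := integral_eq_sub_of_hasDerivAt (a := -π) (b := π) (fun t _ => dT t)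
    (Continuous.intervalIntegrable (by fun_prop) _ _)
  have eT0 : X π * Y π / 2 - X (-π) * Y (-π) / 2 = 0 := by simp only [hX, hY, per]; ring
  rw [eT0] at eT
  have : GG (jg J) (jf J) (jp J) 0 (-π) π 1 = ∫ t in (-π)..π, ((X' t * Y t + X t * Y' t) / 2 - (X t ^ 2 + Y t ^ 2) / 2) := by
    unfold GG
    exact intervalIntegral.integral_congr fun t _ => key t
  rw [this, intervalIntegral.integral_sub (Continuous.intervalIntegrable (by fun_prop) _ _)
    (Continuous.intervalIntegrable (by fun_prop) _ _), eT]
  have : 0 ≤ ∫ t in (-π)..π, (X t ^ 2 + Y t ^ 2) / 2 := integral_nonneg pi_le fun t _ => by positivity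
  linarith

lemma Adm.bdd {J} (h : Adm J) : ∃ M, 0 ≤ M ∧ ∀ z : ℂ, ‖z‖ ≤ 1 → ‖J z‖ ≤ M := by
  obtain ⟨M, hM⟩ := (isCompact_closedBall (0 : ℂ) 1).exists_bound_of_continuousOn h.1.continuousOn
  exact ⟨M, (norm_nonneg _).trans (hM 0 (by simp)), fun z hz => hM z (by simpa using hz)⟩

lemma sq_close {a b e M : ℝ} (h : |a - b| ≤ e) (he : e ≤ 1) (hb : |b| ≤ M) :
    a ^ 2 ≤ b ^ 2 + e * (2 * M + 1) := by
  have h1 : a ^ 2 = b ^ 2 + (a - b) * (a - b + 2 * b) := by ring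
  have h2 : (a - b) * (a - b + 2 * b) ≤ e * (2 * M + 1) := by
    refine (le_abs_self _).trans ?_
    rw [abs_mul]
    refine mul_le_mul h ?_ (abs_nonneg _) ((abs_nonneg _).trans h)
    have := abs_add_le (a - b) (2 * b)
    rw [abs_mul, abs_two] at this
    linarith
  linarith

lemma Adm.energy {J} (h : Adm J) :
    II (fun z => ‖jp J z‖ ^ 2) ≤ II (fun z => jf J z ^ 2) := by
  obtain ⟨M, hM0, hM⟩ := h.bdd
  have c1 := jf_cont h.1; have c2 := jp_cont h.1
  refine le_of_eps (Z := 2 * (π * (2 * (M + 1) + 1))) (by positivity) fun ε0 hε0 => ?_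
  set ε := min ε0 1 with hε
  have he0 : 0 < ε := by positivity
  have he1 : ε ≤ 1 := min_le_right _ _
  obtain ⟨S, hS, hc⟩ := h.2 ε he0
  have s1 := hS.gj.cont_f; have s2 := hS.gj.cont_p
  have hcl : ∀ z : ℂ, ‖z‖ ≤ 1 → |jf S z - jf J z| ≤ ε ∧ ‖jp S z - jp J z‖ ≤ ε := fun z hz =>
    (Jt_le.1 (hc z hz)).2.2
  have hb : ∀ z : ℂ, ‖z‖ ≤ 1 → |jf J z| ≤ M ∧ ‖jp J z‖ ≤ M := fun z hz => (Jt_le.1 (hM z hz)).2.2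
  have i1 : II (fun z => ‖jp J z‖ ^ 2) ≤ II (fun z => ‖jp S z‖ ^ 2) + π * (ε * (2 * (M + 1) + 1)) := by
    rw [← II_const, ← II_add (by fun_prop) (by fun_prop)]
    refine II_mono (by fun_prop) (by fun_prop) fun z hz => ?_
    refine sq_close ?_ he1 ?_
    · rw [abs_sub_comm]; exact (abs_norm_sub_norm_le _ _).trans (hcl z hz).2
    · rw [abs_of_nonneg (norm_nonneg _)]
      have := norm_sub_norm_le (jp S z) (jp J z)
      linarith [(hcl z hz).2, (hb z hz).2]
  have i2 : II (fun z => jf S z ^ 2) ≤ II (fun z => jf J z ^ 2) + π * (ε * (2 * (M + 1) + 1)) := by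
    rw [← II_const, ← II_add (by fun_prop) (by fun_prop)]
    refine II_mono (by fun_prop) (by fun_prop) fun z hz => ?_
    exact sq_close (hcl z hz).1 he1 (by linarith [(hb z hz).1])
  have i3 := hS.energy
  have : ε * (2 * (π * (2 * (M + 1) + 1))) ≤ ε0 * (2 * (π * (2 * (M + 1) + 1))) :=
    mul_le_mul_of_nonneg_right (min_le_left _ _) (by positivity)
  linarith

lemma Adm.L2 {J} (h : Adm J) {k : ℝ} (hk0 : 0 ≤ k) (hk : k < 1) {b : ℂ → ℝ} (hb : Continuous b)
    (hf : ∀ z : ℂ, ‖z‖ ≤ 1 → |jf J z| ≤ k * ‖jp J z‖ + b z) :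
    II (fun z => ‖jp J z‖ ^ 2) ≤ II (fun z => b z ^ 2) / (1 - k) ^ 2 := by
  have c1 := jf_cont h.1; have c2 := jp_cont h.1
  have hk1 : 0 < 1 - k := by linarith
  have h1 : II (fun z => jf J z ^ 2) ≤ k * II (fun z => ‖jp J z‖ ^ 2) + 1 / (1 - k) * II (fun z => b z ^ 2) := by
    rw [← II_const_mul, ← II_const_mul, ← II_add (by fun_prop) (by fun_prop)]
    refine II_mono (by fun_prop) (by fun_prop) fun z hz => ?_
    have h2 : jf J z ^ 2 ≤ (k * ‖jp J z‖ + b z) ^ 2 := by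
      rw [← sq_abs (jf J z)]; exact pow_le_pow_left₀ (abs_nonneg _) (hf z hz) 2
    refine h2.trans ?_
    generalize ‖jp J z‖ = x
    obtain ⟨B, hB⟩ : ∃ B, b z = (1 - k) * B := ⟨b z / (1 - k), by field_simp⟩
    rw [hB]
    have : 1 / (1 - k) * ((1 - k) * B) ^ 2 = (1 - k) * B ^ 2 := by field_simp
    rw [this]
    nlinarith [mul_nonneg (mul_nonneg hk0 hk1.le) (sq_nonneg (x - B))]
  have h2 := h.energy.trans h1
  rw [le_div_iff₀ (by positivity)]
  have h3 : (1 - k) * II (fun z => ‖jp J z‖ ^ 2) ≤ 1 / (1 - k) * II (fun z => b z ^ 2) := by linarith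
  have := mul_le_mul_of_nonneg_left h3 hk1.le
  have e : (1 - k) * (1 / (1 - k) * II fun z => b z ^ 2) = II fun z => b z ^ 2 := by field_simp
  rw [e] at this
  linarith

/-- Hölder condition on the closed unit disc -/
def HolD {V : Type*} [Norm V] [Sub V] (γ A : ℝ) (p : ℂ → V) : Prop :=
  ∀ z z' : ℂ, ‖z‖ ≤ 1 → ‖z'‖ ≤ 1 → ‖p z - p z'‖ ≤ A * ‖z - z'‖ ^ γ

lemma pol_dist {s s' t t' : ℝ} (hs' : s' ∈ Icc (0 : ℝ) 1) :
    ‖pol 0 s t - pol 0 s' t'‖ ≤ |s - s'| + |t - t'| := by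
  have h1 : pol 0 s t - pol 0 s' t' = ((s - s' : ℝ) : ℂ) * Complex.exp (t * Complex.I)
    + s' * (Complex.exp (t * Complex.I) - Complex.exp (t' * Complex.I)) := by
    simp [pol]; ring
  have h2 : ‖Complex.exp (t * Complex.I) - Complex.exp (t' * Complex.I)‖ ≤ |t - t'| := by
    have : Complex.exp (t * Complex.I) - Complex.exp (t' * Complex.I)
      = Complex.exp (t' * Complex.I) * (Complex.exp (Complex.I * ((t - t' : ℝ) : ℂ)) - 1) := by
      rw [mul_sub, ← Complex.exp_add]; congr 2
      · push_cast; ring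
      · ring
    rw [this, norm_mul, Complex.norm_exp_ofReal_mul_I, one_mul]
    exact Real.norm_exp_I_mul_ofReal_sub_one_le
  rw [h1]
  refine (norm_add_le _ _).trans ?_
  rw [norm_mul, norm_mul, Complex.norm_exp_ofReal_mul_I, Complex.norm_real, Complex.norm_real,
    Real.norm_eq_abs, Real.norm_eq_abs, abs_of_nonneg hs'.1, mul_one]
  have := mul_le_mul hs'.2 h2 (norm_nonneg _) zero_le_one
  linarith

lemma exists_sub_interval {a b x ρ : ℝ} (hx : x ∈ Icc a b) (hρ : 0 ≤ ρ) (hab : a + ρ ≤ b) :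
    ∃ c, a ≤ c ∧ c + ρ ≤ b ∧ ∀ y ∈ Icc c (c + ρ), |x - y| ≤ ρ := by
  by_cases h : x + ρ ≤ b
  · refine ⟨x, hx.1, h, fun y hy => ?_⟩
    rw [abs_le]; constructor <;> linarith [hy.1, hy.2]
  · refine ⟨b - ρ, by linarith, by linarith, fun y hy => ?_⟩
    push Not at h
    rw [abs_le]; constructor <;> linarith [hy.1, hy.2, hx.2]

lemma sup_interp {p : ℂ → ℂ} (hp : Continuous p) {γ A m ρ : ℝ} (hγ : 0 < γ) (hA : 0 ≤ A) (hm : 0 ≤ m)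
    (hρ : 0 < ρ) (hρ1 : ρ ≤ 1) (hH : HolD γ A p) (hI : II (fun z => ‖p z‖ ^ 2) ≤ m ^ 2) {z : ℂ}
    (hz : ‖z‖ ≤ 1) : ‖p z‖ ≤ A * (2 * ρ) ^ γ + 2 * m / ρ ^ 2 := by
  by_contra! hcon
  set L := ‖p z‖ - A * (2 * ρ) ^ γ with hL
  have hL1 : 2 * m / ρ ^ 2 < L := by linarith
  have hL0 : 0 < L := lt_of_le_of_lt (by positivity) hL1
  have pz : pol 0 ‖z‖ z.arg = z := by simpa using pol_arg 0 z
  obtain ⟨a, ha0, ha1, ha⟩ := exists_sub_interval (a := 0) (b := 1) (x := ‖z‖) ⟨norm_nonneg _, hz⟩ hρ.le (by linarith)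
  obtain ⟨b, hb0, hb1, hb⟩ := exists_sub_interval (a := -π) (b := π) (x := z.arg)
    ⟨(Complex.neg_pi_lt_arg z).le, Complex.arg_le_pi z⟩ hρ.le (by linarith [Real.pi_gt_three])
  have hlow : ∀ s ∈ Icc a (a + ρ), ∀ t ∈ Icc b (b + ρ), L ^ 2 ≤ ‖p (pol 0 s t)‖ ^ 2 := by
    intro s hs t ht
    have hs1 : s ∈ Icc (0 : ℝ) 1 := ⟨ha0.trans hs.1, hs.2.trans ha1⟩
    refine pow_le_pow_left₀ hL0.le ?_ 2
    have h1 := hH z (pol 0 s t) hz (pol0_norm hs1)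
    have h2 : ‖z - pol 0 s t‖ ≤ 2 * ρ := by
      have := pol_dist (s := ‖z‖) (t := z.arg) (t' := t) hs1
      rw [pz] at this
      linarith [ha s hs, hb t ht]
    have h3 : A * ‖z - pol 0 s t‖ ^ γ ≤ A * (2 * ρ) ^ γ :=
      mul_le_mul_of_nonneg_left (Real.rpow_le_rpow (norm_nonneg _) h2 hγ.le) hA
    have := norm_sub_norm_le (p z) (p (pol 0 s t))
    linarith
  have hc : Continuous fun z => ‖p z‖ ^ 2 := by fun_prop
  have c1 := II_in_cont hc
  have inn : ∀ s ∈ Icc a (a + ρ), ρ * L ^ 2 ≤ ∫ t in (-π)..π, ‖p (pol 0 s t)‖ ^ 2 := by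
    intro s hs
    have ct := II_t_cont hc s
    have h1 := intervalIntegral.integral_mono_interval (μ := volume) hb0 (by linarith : b ≤ b + ρ) hb1
      (Filter.Eventually.of_forall fun t => sq_nonneg ‖p (pol 0 s t)‖) (ct.intervalIntegrable _ _)
    refine le_trans ?_ h1
    have h2 : ∫ t in b..(b + ρ), L ^ 2 = ρ * L ^ 2 := by simp
    rw [← h2]
    exact integral_mono_on (by linarith) (by simp) (ct.intervalIntegrable _ _) fun t ht => hlow s hs t ht
  have nn : ∀ s, 0 ≤ ∫ t in (-π)..π, ‖p (pol 0 s t)‖ ^ 2 := fun s => integral_nonneg pi_le fun t _ => sq_nonneg _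
  have out : (ρ * L ^ 2) * (ρ ^ 2 / 2) ≤ II (fun z => ‖p z‖ ^ 2) := by
    have h1 : ∫ s in a..(a + ρ), s * ∫ t in (-π)..π, ‖p (pol 0 s t)‖ ^ 2 ≤ II (fun z => ‖p z‖ ^ 2) := by
      refine intervalIntegral.integral_mono_interval ha0 (by linarith) ha1 ?_ (Continuous.intervalIntegrable (by fun_prop) _ _)
      filter_upwards [ae_restrict_mem measurableSet_Ioc] with s hs
      exact mul_nonneg hs.1.le (nn s)
    refine le_trans ?_ h1
    have h2 : ∫ s in a..(a + ρ), (ρ * L ^ 2) * s = (ρ * L ^ 2) * (((a + ρ) ^ 2 - a ^ 2) / 2) := by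
      rw [intervalIntegral.integral_const_mul, integral_id]
    have h3 : (ρ * L ^ 2) * (ρ ^ 2 / 2) ≤ (ρ * L ^ 2) * (((a + ρ) ^ 2 - a ^ 2) / 2) := by
      refine mul_le_mul_of_nonneg_left ?_ (by positivity)
      nlinarith [mul_nonneg ha0 hρ.le]
    refine h3.trans ?_
    rw [← h2]
    refine integral_mono_on (by linarith) (Continuous.intervalIntegrable (by fun_prop) _ _)
      (Continuous.intervalIntegrable (by fun_prop) _ _) fun s hs => ?_
    rw [mul_comm]
    exact mul_le_mul_of_nonneg_left (inn s hs) (ha0.trans hs.1)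
  rw [div_lt_iff₀ (by positivity)] at hL1
  have h5 : (2 * m) ^ 2 < (L * ρ ^ 2) ^ 2 := pow_lt_pow_left₀ hL1 (by positivity) (by norm_num)
  have h6 : L ^ 2 * ρ ^ 4 ≤ L ^ 2 * ρ ^ 3 :=
    mul_le_mul_of_nonneg_left (pow_le_pow_of_le_one hρ.le hρ1 (by norm_num)) (by positivity)
  nlinarith [sq_nonneg m]

lemma SJet.gw_bound {J} (h : SJet J) {S : ℝ} (hf : ∀ z : ℂ, ‖z‖ ≤ 1 → |jf J z| ≤ S)
    (hp : ∀ z : ℂ, ‖z‖ ≤ 1 → ‖jp J z‖ ≤ S) {z : ℂ} (hz : ‖z‖ ≤ 1) : ‖jg J z‖ ≤ 4 * S ∧ |jw J z| ≤ 8 * S := by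
  have S0 : 0 ≤ S := (abs_nonneg _).trans (hf 0 (by simp))
  have hconv : Convex ℝ (closedBall (0 : ℂ) 1) := convex_closedBall _ _
  have lip : ∀ z z' : ℂ, ‖z‖ ≤ 1 → ‖z'‖ ≤ 1 → ‖jg J z - jg J z'‖ ≤ S * ‖z - z'‖ := by
    intro z z' hz hz'
    refine hconv.norm_image_sub_le_of_norm_hasFDerivWithin_le (fun x _ => (h.gj.d x).hasFDerivWithinAt)
      (fun x hx => ?_) (by simpa using hz') (by simpa using hz)
    have hx : ‖x‖ ≤ 1 := by simpa using hx
    exact ContinuousLinearMap.opNorm_le_bound _ S0 fun v => norm_dG_le' _ _ v (hf x hx) (hp x hx)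
  have rolle : ∀ v : ℂ, ‖v‖ = 1 → ∃ t : ℝ, ‖(t : ℂ) * v‖ ≤ 1 ∧ (jg J (t * v) * v).re = 0 := by
    intro v hv
    have d : ∀ t : ℝ, HasDerivAt (fun t : ℝ => jw J (t * v)) ((jg J (t * v) * v).re) t := fun t => by
      have := (h.dw (t * v)).comp_hasDerivAt t ((Complex.ofRealCLM.hasDerivAt (x := t)).mul_const v)
      exact this.congr_deriv (by simp [dW_apply])
    obtain ⟨t, ht, e⟩ := exists_hasDerivAt_eq_zero (a := -1) (b := 1) (by norm_num)
      (f := fun t : ℝ => jw J (t * v)) (fun t _ => (d t).continuousAt.continuousWithinAt)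
      (by rw [h.bd _ (by simp [hv]), h.bd _ (by simp [hv])]) (fun t _ => d t)
    refine ⟨t, ?_, e⟩
    rw [norm_mul, hv, mul_one, Complex.norm_real, Real.norm_eq_abs, abs_le]
    exact ⟨ht.1.le, ht.2.le⟩
  have gb : ∀ z : ℂ, ‖z‖ ≤ 1 → ‖jg J z‖ ≤ 4 * S := by
    intro z hz
    have dist2 : ∀ y : ℂ, ‖y‖ ≤ 1 → ‖jg J z - jg J y‖ ≤ 2 * S := fun y hy => by
      have h1 := lip z y hz hy
      have h2 : ‖z - y‖ ≤ 2 := by linarith [norm_sub_le z y]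
      nlinarith [mul_le_mul_of_nonneg_left h2 S0]
    obtain ⟨t, ht, e⟩ := rolle 1 (by simp)
    obtain ⟨t', ht', e'⟩ := rolle Complex.I (by simp)
    have a1 : |(jg J z).re| ≤ 2 * S := by
      have h1 := (Complex.abs_re_le_norm _).trans (dist2 _ ht)
      rw [Complex.sub_re] at h1
      rw [mul_one] at e; rwa [e, sub_zero] at h1
    have a2 : |(jg J z).im| ≤ 2 * S := by
      have h1 := (Complex.abs_im_le_norm _).trans (dist2 _ ht')
      rw [Complex.sub_im] at h1
      simp only [Complex.mul_re, Complex.I_re, Complex.I_im, mul_zero, mul_one, zero_sub, neg_eq_zero] at e'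
      rwa [e', sub_zero] at h1
    linarith [Complex.norm_le_abs_re_add_abs_im (jg J z)]
  refine ⟨gb z hz, ?_⟩
  have := hconv.norm_image_sub_le_of_norm_hasFDerivWithin_le (fun x _ => (h.dw x).hasFDerivWithinAt)
    (C := 4 * S) (fun x hx => ContinuousLinearMap.opNorm_le_bound _ (by positivity) fun v =>
      (norm_dW_le _ v).trans (mul_le_mul_of_nonneg_right (gb x (by simpa using hx)) (norm_nonneg _)))
    (x := 1) (y := z) (by simp) (by simpa using hz)
  rw [h.bd 1 (by simp), sub_zero, Real.norm_eq_abs] at this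
  have h2 : ‖z - 1‖ ≤ 2 := by
    have := norm_sub_le z 1; simp at this; linarith
  nlinarith [mul_le_mul_of_nonneg_left h2 S0]

lemma Adm.gw_bound {J} (h : Adm J) {S : ℝ} (hf : ∀ z : ℂ, ‖z‖ ≤ 1 → |jf J z| ≤ S)
    (hp : ∀ z : ℂ, ‖z‖ ≤ 1 → ‖jp J z‖ ≤ S) {z : ℂ} (hz : ‖z‖ ≤ 1) : ‖jg J z‖ ≤ 4 * S ∧ |jw J z| ≤ 8 * S := by
  have key : ∀ ε > 0, ‖jg J z‖ ≤ 4 * S + ε * 5 ∧ |jw J z| ≤ 8 * S + ε * 9 := by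
    intro ε hε
    obtain ⟨T, hT, hc⟩ := h.2 ε hε
    have hcl := fun z hz => Jt_le.1 (hc z hz)
    obtain ⟨h1, h2⟩ := hT.gw_bound (S := S + ε) (fun z hz => by
      have h1 : |jf T z - jf J z| ≤ ε := (hcl z hz).2.2.1
      have := abs_sub_abs_le_abs_sub (jf T z) (jf J z)
      linarith [hf z hz]) (fun z hz => by
      have h1 : ‖jp T z - jp J z‖ ≤ ε := (hcl z hz).2.2.2
      have := norm_sub_norm_le (jp T z) (jp J z)
      linarith [hp z hz]) hz
    have e1 : |jw T z - jw J z| ≤ ε := (hcl z hz).1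
    have e2 : ‖jg T z - jg J z‖ ≤ ε := (hcl z hz).2.1
    have e3 := norm_sub_norm_le (jg J z) (jg T z)
    have e4 := abs_sub_abs_le_abs_sub (jw J z) (jw T z)
    rw [norm_sub_rev] at e3; rw [abs_sub_comm (jw J z)] at e4
    constructor <;> linarith
  exact ⟨le_of_eps (by norm_num) fun ε hε => (key ε hε).1, le_of_eps (by norm_num) fun ε hε => (key ε hε).2⟩

end FN

namespace FN
open MeasureTheory intervalIntegral

lemma SJet.g_lip {J} (h : SJet J) {S : ℝ} (hf : ∀ z : ℂ, ‖z‖ ≤ 1 → |jf J z| ≤ S)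
    (hp : ∀ z : ℂ, ‖z‖ ≤ 1 → ‖jp J z‖ ≤ S) {z z' : ℂ} (hz : ‖z‖ ≤ 1) (hz' : ‖z'‖ ≤ 1) :
    ‖jg J z - jg J z'‖ ≤ S * ‖z - z'‖ := by
  have S0 : 0 ≤ S := (abs_nonneg _).trans (hf 0 (by simp))
  have hconv : Convex ℝ (closedBall (0 : ℂ) 1) := convex_closedBall _ _
  refine hconv.norm_image_sub_le_of_norm_hasFDerivWithin_le (fun x _ => (h.gj.d x).hasFDerivWithinAt)
    (fun x hx => ?_) (by simpa using hz') (by simpa using hz)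
  have hx : ‖x‖ ≤ 1 := by simpa using hx
  exact ContinuousLinearMap.opNorm_le_bound _ S0 fun v => norm_dG_le' _ _ v (hf x hx) (hp x hx)

lemma Adm.g_lip {J} (h : Adm J) {S : ℝ} (hf : ∀ z : ℂ, ‖z‖ ≤ 1 → |jf J z| ≤ S)
    (hp : ∀ z : ℂ, ‖z‖ ≤ 1 → ‖jp J z‖ ≤ S) {z z' : ℂ} (hz : ‖z‖ ≤ 1) (hz' : ‖z'‖ ≤ 1) :
    ‖jg J z - jg J z'‖ ≤ S * ‖z - z'‖ := by
  refine le_of_eps (Z := ‖z - z'‖ + 2) (by positivity) fun ε hε => ?_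
  obtain ⟨T, hT, hc⟩ := h.2 ε hε
  have hcl := fun z hz => Jt_le.1 (hc z hz)
  have h1 := hT.g_lip (S := S + ε) (fun z hz => by
    have h1 : |jf T z - jf J z| ≤ ε := (hcl z hz).2.2.1
    have := abs_sub_abs_le_abs_sub (jf T z) (jf J z)
    linarith [hf z hz]) (fun z hz => by
    have h1 : ‖jp T z - jp J z‖ ≤ ε := (hcl z hz).2.2.2
    have := norm_sub_norm_le (jp T z) (jp J z)
    linarith [hp z hz]) hz hz'
  have e1 : ‖jg T z - jg J z‖ ≤ ε := (hcl z hz).2.1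
  have e2 : ‖jg T z' - jg J z'‖ ≤ ε := (hcl z' hz').2.1
  rw [norm_sub_rev] at e1 e2
  have := tri3 e1 e2 h1
  linarith

/-- plain chart -/
lemma Adm.chart0 {J} (h : Adm J) {k γ A B : ℝ} (hf : HolD γ A (jf J)) (hp : HolD γ A (jp J))
    (pair : ∀ z z' : ℂ, ‖z‖ ≤ 1 → ‖z'‖ ≤ 1 → |jf J z - jf J z'| ≤ k * ‖jp J z - jp J z'‖ + B * ‖z - z'‖ ^ γ) :
    Chart k γ A B (closedBall 0 1) (fun _ => True) (jg J) (jf J) (jp J) where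
  cg := jg_cont h.1
  lj ε hε := by
    obtain ⟨T, hT, hc⟩ := h.2 ε hε
    refine ⟨jg T, jf T, jp T, hT.gj, trivial, fun z hz => ?_⟩
    exact (Jt_le.1 (hc z (by simpa using hz))).2
  conv := convex_closedBall _ _
  hf z hz z' hz' := hf z z' (by simpa using hz) (by simpa using hz')
  hp z hz z' hz' := hp z z' (by simpa using hz) (by simpa using hz')
  pair z hz z' hz' := pair z z' (by simpa using hz) (by simpa using hz')

def gU (J : ℂ → Jt) (ζ : ℂ) : ℂ := -Complex.exp (-ζ) * jg J (Complex.exp (-ζ))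
def fU (J : ℂ → Jt) (ζ : ℂ) : ℝ := ‖Complex.exp (-ζ)‖ ^ 2 * jf J (Complex.exp (-ζ))
def pU (J : ℂ → Jt) (ζ : ℂ) : ℂ := Complex.exp (-ζ) ^ 2 * jp J (Complex.exp (-ζ)) +
  2 * Complex.exp (-ζ) * jg J (Complex.exp (-ζ))

lemma exp_neg_fd (ζ : ℂ) : HasFDerivAt (fun ζ : ℂ => Complex.exp (-ζ))
    (ContinuousLinearMap.mul ℝ ℂ (-Complex.exp (-ζ))) ζ := by
  have h : HasDerivAt (fun ζ : ℂ => Complex.exp (-ζ)) (-Complex.exp (-ζ)) ζ :=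
    (((hasDerivAt_id ζ).neg).cexp).congr_deriv (by simp)
  exact (h.hasFDerivAt.restrictScalars ℝ).congr_fderiv (by ext v; simp; ring)

lemma SJet.gjU {J} (h : SJet J) : GJet (gU J) (fU J) (pU J) where
  cd := by
    have : ContDiff ℝ 2 fun ζ : ℂ => Complex.exp (-ζ) := contDiff_neg.cexp
    exact (this.neg).mul (h.gj.cd.comp this)
  d ζ := by
    have h1 := exp_neg_fd ζ
    have h2 := (h.gj.d (Complex.exp (-ζ))).comp ζ h1
    refine (h1.neg.mul h2).congr_fderiv ?_
    ext v
    simp only [fU, pU, dG_apply, add_apply, ContinuousLinearMap.smul_apply, ContinuousLinearMap.comp_apply,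
      ContinuousLinearMap.mul_apply', smul_eq_mul, neg_apply, Pi.neg_apply, Function.comp_apply, map_mul, map_neg]
    have e : (((‖Complex.exp (-ζ)‖ ^ 2 * jf J (Complex.exp (-ζ)) : ℝ)) : ℂ)
      = Complex.exp (-ζ) * (starRingEnd ℂ) (Complex.exp (-ζ)) * jf J (Complex.exp (-ζ)) := by
      rw [Complex.mul_conj, Complex.normSq_eq_norm_sq]; push_cast; ring
    rw [e]
    ring

lemma SJet.bdU {J} (h : SJet J) (s : ℝ) : (gU J (s * Complex.I)).im = 0 := by
  have d0 : HasDerivAt (fun s : ℝ => (s : ℂ) * Complex.I) Complex.I s :=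
    ((Complex.ofRealCLM.hasDerivAt (x := s)).mul_const Complex.I).congr_deriv (by simp)
  have d1 := (exp_neg_fd (s * Complex.I)).comp_hasDerivAt s d0
  have d2 := (h.dw _).comp_hasDerivAt s d1
  have e : (fun s : ℝ => jw J (Complex.exp (-(s * Complex.I)))) = fun _ => 0 := by
    funext s; refine h.bd _ ?_
    rw [Complex.norm_exp]; simp
  have d3 : HasDerivAt (fun s : ℝ => jw J (Complex.exp (-(s * Complex.I)))) 0 s := by
    rw [e]; exact hasDerivAt_const _ _
  have d4 := d2.unique d3
  rw [dW_apply] at d4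
  have : gU J (s * Complex.I) = -Complex.I * (jg J (Complex.exp (-(↑s * Complex.I))) *
    ((ContinuousLinearMap.mul ℝ ℂ (-Complex.exp (-(↑s * Complex.I)))) Complex.I)) := by
    simp only [gU, ContinuousLinearMap.mul_apply']
    linear_combination (-jg J (Complex.exp (-(↑s * Complex.I))) * Complex.exp (-(↑s * Complex.I))) * Complex.I_sq
  rw [this, neg_mul, Complex.neg_im, Complex.mul_im]
  simp at d4 ⊢
  linarith

def strip : Set ℂ := {z | 0 ≤ z.re ∧ z.re ≤ 3}

lemma exp_strip {ζ : ℂ} (h : ζ ∈ strip) : ‖Complex.exp (-ζ)‖ ≤ 1 := by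
  rw [Complex.norm_exp, Real.exp_le_one_iff]; simpa using h.1

lemma strip_convex : Convex ℝ strip := by
  have h1 : Convex ℝ (Complex.reLm ⁻¹' (Icc 0 3)) := (convex_Icc 0 3).linear_preimage Complex.reLm
  exact h1

lemma exp_lip {ζ ζ' : ℂ} (h : ζ ∈ strip) (h' : ζ' ∈ strip) :
    ‖Complex.exp (-ζ) - Complex.exp (-ζ')‖ ≤ ‖ζ - ζ'‖ := by
  have := strip_convex.norm_image_sub_le_of_norm_hasFDerivWithin_le
    (fun x _ => (exp_neg_fd x).hasFDerivWithinAt) (C := 1) (fun x hx => by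
      refine ContinuousLinearMap.opNorm_le_bound _ zero_le_one fun v => ?_
      rw [ContinuousLinearMap.mul_apply', norm_mul, norm_neg]
      exact mul_le_mul_of_nonneg_right (exp_strip hx) (norm_nonneg _)) h' h
  simpa using this

/-- algebraic comparison -/
lemma sq_diff {z z' : ℂ} (hz : ‖z‖ ≤ 1) (hz' : ‖z'‖ ≤ 1) :
    |‖z‖ ^ 2 - ‖z'‖ ^ 2| ≤ 2 * ‖z - z'‖ ∧ ‖z ^ 2 - z' ^ 2‖ ≤ 2 * ‖z - z'‖ := by
  constructor
  · rw [show ‖z‖ ^ 2 - ‖z'‖ ^ 2 = (‖z‖ + ‖z'‖) * (‖z‖ - ‖z'‖) by ring, abs_mul]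
    refine mul_le_mul ?_ (abs_norm_sub_norm_le _ _) (abs_nonneg _) (by norm_num)
    rw [abs_of_nonneg (by positivity)]; linarith
  · rw [show z ^ 2 - z' ^ 2 = (z + z') * (z - z') by ring, norm_mul]
    refine mul_le_mul_of_nonneg_right ?_ (norm_nonneg _)
    linarith [norm_add_le z z']

structure Bnds (J : ℂ → Jt) (S : ℝ) : Prop where
  f : ∀ z : ℂ, ‖z‖ ≤ 1 → |jf J z| ≤ S
  p : ∀ z : ℂ, ‖z‖ ≤ 1 → ‖jp J z‖ ≤ S

lemma Adm.cmpU {J} (h : Adm J) {S : ℝ} (hS : Bnds J S) {z z' : ℂ} (hz : ‖z‖ ≤ 1) (hz' : ‖z'‖ ≤ 1) :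
    |(‖z‖ ^ 2 * jf J z - ‖z'‖ ^ 2 * jf J z') - ‖z‖ ^ 2 * (jf J z - jf J z')| ≤ 2 * S * ‖z - z'‖ ∧
    ‖((z ^ 2 * jp J z + 2 * z * jg J z) - (z' ^ 2 * jp J z' + 2 * z' * jg J z')) - z ^ 2 * (jp J z - jp J z')‖
      ≤ 12 * S * ‖z - z'‖ := by
  have S0 : 0 ≤ S := (abs_nonneg _).trans (hS.f 0 (by simp))
  obtain ⟨s1, s2⟩ := sq_diff hz hz'
  constructor
  · rw [show (‖z‖ ^ 2 * jf J z - ‖z'‖ ^ 2 * jf J z') - ‖z‖ ^ 2 * (jf J z - jf J z')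
      = (‖z‖ ^ 2 - ‖z'‖ ^ 2) * jf J z' by ring, abs_mul]
    have := mul_le_mul s1 (hS.f z' hz') (abs_nonneg _) (by positivity)
    linarith
  · rw [show ((z ^ 2 * jp J z + 2 * z * jg J z) - (z' ^ 2 * jp J z' + 2 * z' * jg J z')) - z ^ 2 * (jp J z - jp J z')
      = (z ^ 2 - z' ^ 2) * jp J z' + 2 * ((z - z') * jg J z' + z * (jg J z - jg J z')) by ring]
    refine (norm_add_le _ _).trans ?_
    have h1 := mul_le_mul s2 (hS.p z' hz') (norm_nonneg _) (by positivity)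
    have h2 := norm_add_le ((z - z') * jg J z') (z * (jg J z - jg J z'))
    have h3 := mul_le_mul_of_nonneg_left (h.gw_bound hS.f hS.p hz').1 (norm_nonneg (z - z'))
    have h4 := mul_le_mul hz (h.g_lip hS.f hS.p hz hz') (norm_nonneg _) zero_le_one
    simp only [norm_mul, Complex.norm_ofNat] at h2 ⊢
    linarith

lemma le_two_rpow {d γ : ℝ} (hd : 0 ≤ d) (hd2 : d ≤ 2) (hγ : 0 < γ) (hγ1 : γ ≤ 1) : d ≤ 2 * d ^ γ := by
  rcases hd.eq_or_lt with rfl | hd0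
  · rw [Real.zero_rpow hγ.ne']; simp
  have h1 : d = d ^ (1 - γ) * d ^ γ := by rw [← Real.rpow_add hd0]; simp
  have h2 : d ^ (1 - γ) ≤ 2 := by
    refine (Real.rpow_le_rpow hd hd2 (by linarith)).trans ?_
    refine (Real.rpow_le_rpow_of_exponent_le (by norm_num) (by linarith : 1 - γ ≤ 1)).trans ?_
    simp
  calc d = d ^ (1 - γ) * d ^ γ := h1
    _ ≤ _ := mul_le_mul_of_nonneg_right h2 (by positivity)

lemma disc_dist {z z' : ℂ} (hz : ‖z‖ ≤ 1) (hz' : ‖z'‖ ≤ 1) : ‖z - z'‖ ≤ 2 := by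
  linarith [norm_sub_le z z']

lemma Adm.chartU {J} (h : Adm J) {k γ A B S : ℝ} (hk0 : 0 ≤ k) (hk : k ≤ 1) (hγ : 0 < γ) (hγ1 : γ ≤ 1)
    (hA : 0 ≤ A) (hB : 0 ≤ B) (hS : Bnds J S) (hf : HolD γ A (jf J)) (hp : HolD γ A (jp J))
    (pair : ∀ z z' : ℂ, ‖z‖ ≤ 1 → ‖z'‖ ≤ 1 → |jf J z - jf J z'| ≤ k * ‖jp J z - jp J z'‖ + B * ‖z - z'‖ ^ γ) :
    Chart k γ (A + 24 * S) (B + 28 * S) strip (fun G => ∀ s : ℝ, (G (s * Complex.I)).im = 0) (gU J) (fU J) (pU J) := by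
  have S0 : 0 ≤ S := (abs_nonneg _).trans (hS.f 0 (by simp))
  have main : ∀ ζ ∈ strip, ∀ ζ' ∈ strip, ∃ d : ℝ, 0 ≤ d ∧ d ≤ ‖ζ - ζ'‖ ^ γ ∧
      |fU J ζ - fU J ζ'| ≤ (A + 24 * S) * d ∧ ‖pU J ζ - pU J ζ'‖ ≤ (A + 24 * S) * d ∧
      |fU J ζ - fU J ζ'| ≤ k * ‖pU J ζ - pU J ζ'‖ + (B + 28 * S) * d := by
    intro ζ hζ ζ' hζ'
    have hd := exp_lip hζ hζ'
    have hz := exp_strip hζ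
    have hz' := exp_strip hζ'
    refine ⟨‖Complex.exp (-ζ) - Complex.exp (-ζ')‖ ^ γ, by positivity, Real.rpow_le_rpow (norm_nonneg _) hd hγ.le, ?_⟩
    simp only [fU, pU]
    generalize Complex.exp (-ζ) = z at *
    generalize Complex.exp (-ζ') = z' at *
    obtain ⟨c1, c2⟩ := h.cmpU hS hz hz'
    have hd2 := le_two_rpow (norm_nonneg _) (disc_dist hz hz') hγ hγ1
    have f1 : |jf J z - jf J z'| ≤ _ := hf z z' hz hz'
    have p1 := hp z z' hz hz'
    have q1 := pair z z' hz hz'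
    set FF := ‖z‖ ^ 2 * jf J z - ‖z'‖ ^ 2 * jf J z'
    set PP := (z ^ 2 * jp J z + 2 * z * jg J z) - (z' ^ 2 * jp J z' + 2 * z' * jg J z')
    have n2 : ‖z‖ ^ 2 ≤ 1 := pow_le_one₀ (norm_nonneg _) hz
    have n0 : 0 ≤ ‖z‖ ^ 2 := by positivity
    have a1 := abs_sub_abs_le_abs_sub FF (‖z‖ ^ 2 * (jf J z - jf J z'))
    have a2 := norm_sub_norm_le PP (z ^ 2 * (jp J z - jp J z'))
    have a3 := norm_sub_norm_le (z ^ 2 * (jp J z - jp J z')) PP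
    rw [norm_sub_rev (z ^ 2 * (jp J z - jp J z')) PP] at a3
    rw [abs_mul, abs_of_nonneg n0] at a1
    rw [norm_mul, norm_pow] at a2 a3
    set D := ‖z - z'‖ ^ γ
    have D0 : 0 ≤ D := by positivity
    have SD := mul_le_mul_of_nonneg_left hd2 S0
    have m1 := mul_le_mul n2 f1 (abs_nonneg _) zero_le_one
    have m2 := mul_le_mul n2 p1 (norm_nonneg _) zero_le_one
    have m3 := mul_le_mul_of_nonneg_left q1 n0
    have m4 : ‖z‖ ^ 2 * (B * D) ≤ B * D := mul_le_of_le_one_left (by positivity) n2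
    have m5 : k * (‖z‖ ^ 2 * ‖jp J z - jp J z'‖) ≤ k * (‖PP‖ + 12 * S * ‖z - z'‖) :=
      mul_le_mul_of_nonneg_left (by linarith) hk0
    have m6 : k * (12 * S * ‖z - z'‖) ≤ 12 * S * ‖z - z'‖ := mul_le_of_le_one_left (by positivity) hk
    have SD0 : 0 ≤ S * D := by positivity
    refine ⟨?_, ?_, ?_⟩
    · linarith
    · linarith
    · linarith
  have w : ∀ {X d e : ℝ}, 0 ≤ X → d ≤ e → X * d ≤ X * e := fun hX h => mul_le_mul_of_nonneg_left h hX
  refine ⟨?_, ?_, strip_convex, ?_, ?_, ?_⟩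
  · have := jg_cont h.1
    unfold gU; fun_prop
  · intro ε hε
    obtain ⟨T, hT, hc⟩ := h.2 (ε / 3) (by positivity)
    refine ⟨gU T, fU T, pU T, hT.gjU, hT.bdU, fun ζ hζ => ?_⟩
    have hz := exp_strip hζ
    simp only [gU, fU, pU]
    generalize Complex.exp (-ζ) = z at *
    obtain ⟨-, c1, c2, c3⟩ := Jt_le.1 (hc z hz)
    change ‖jg T z - jg J z‖ ≤ _ at c1
    change |jf T z - jf J z| ≤ _ at c2
    change ‖jp T z - jp J z‖ ≤ _ at c3
    have n2 : ‖z‖ ^ 2 ≤ 1 := pow_le_one₀ (norm_nonneg _) hz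
    refine ⟨?_, ?_, ?_⟩
    · rw [← mul_sub, norm_mul, norm_neg]
      have := mul_le_mul hz c1 (norm_nonneg _) zero_le_one
      linarith
    · rw [← mul_sub, abs_mul, abs_of_nonneg (by positivity : 0 ≤ ‖z‖ ^ 2)]
      have := mul_le_mul n2 c2 (abs_nonneg _) zero_le_one
      linarith
    · rw [show z ^ 2 * jp T z + 2 * z * jg T z - (z ^ 2 * jp J z + 2 * z * jg J z)
        = z ^ 2 * (jp T z - jp J z) + 2 * (z * (jg T z - jg J z)) by ring]
      refine (norm_add_le _ _).trans ?_
      simp only [norm_mul, norm_pow, Complex.norm_ofNat]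
      have := mul_le_mul hz c1 (norm_nonneg _) zero_le_one
      have := mul_le_mul n2 c3 (norm_nonneg _) zero_le_one
      linarith
  · intro ζ hζ ζ' hζ'
    obtain ⟨d, d0, d1, h1, h2, h3⟩ := main ζ hζ ζ' hζ'
    exact h1.trans (w (by positivity) d1)
  · intro ζ hζ ζ' hζ'
    obtain ⟨d, d0, d1, h1, h2, h3⟩ := main ζ hζ ζ' hζ'
    exact h2.trans (w (by positivity) d1)
  · intro ζ hζ ζ' hζ'
    obtain ⟨d, d0, d1, h1, h2, h3⟩ := main ζ hζ ζ' hζ'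
    have := w (X := B + 28 * S) (by positivity) d1
    linarith

lemma good_strip {x y : ℝ} (hx : x ∈ Icc (0 : ℝ) 1) :
    Good strip (fun G => ∀ s : ℝ, (G (s * Complex.I)).im = 0) 1 x y := by
  intro r hr
  by_cases h : x < r
  · right
    refine ⟨hx.1, h, fun G hG => hG, fun z h0 h1 => ⟨h0, ?_⟩⟩
    have := (Complex.abs_re_le_norm _).trans h1
    simp at this
    linarith [le_abs_self z.re]
  · left
    push Not at h
    intro z hz
    rw [mem_closedBall, dist_eq_norm] at hz
    have := (Complex.abs_re_le_norm _).trans hz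
    simp [abs_le] at this
    constructor <;> linarith [hx.1, hx.2, hr.2]

lemma good_ball {x y : ℝ} (hx : x ∈ Icc (-1 / 2 : ℝ) (1 / 2)) (hy : y ∈ Icc (-1 / 2 - 1 / 10 : ℝ) (1 / 2 + 1 / 10)) :
    Good (closedBall 0 1) (fun _ => True) (1 / 10) x y := by
  intro r hr
  left
  intro z hz
  rw [mem_closedBall, dist_eq_norm] at hz
  rw [mem_closedBall, dist_zero_right]
  have h1 : ‖(x : ℂ) + y * Complex.I‖ ≤ 9 / 10 := by
    rw [Complex.norm_add_mul_I]
    refine Real.sqrt_le_iff.2 ⟨by norm_num, ?_⟩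
    nlinarith [hx.1, hx.2, hy.1, hy.2]
  have := norm_sub_norm_le z ((x : ℂ) + y * Complex.I)
  linarith [hr.2]

lemma log_pair {z z' : ℂ} (hz : ‖z‖ ≤ 1) (hz' : ‖z'‖ ≤ 1) (h1 : rexp (-1) ≤ ‖z‖) (h1' : rexp (-1) ≤ ‖z'‖)
    (hd : ‖z - z'‖ ≤ 1 / 10) : ∃ ζ ζ' : ℂ, Complex.exp (-ζ) = z ∧ Complex.exp (-ζ') = z' ∧
      ζ.re ∈ Icc (0 : ℝ) 1 ∧ ζ'.re ∈ Icc (0 : ℝ) 1 ∧ ‖ζ - ζ'‖ ≤ 5 * ‖z - z'‖ := by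
  have e3 : 1 / 3 < rexp (-1) := by linarith [Real.exp_neg_one_gt_d9]
  have hz0 : 0 < ‖z‖ := by linarith
  have hz0' : 0 < ‖z'‖ := by linarith
  have z0 : z ≠ 0 := norm_pos_iff.1 hz0
  have z0' : z' ≠ 0 := norm_pos_iff.1 hz0'
  set η := (z' - z) / z with hη
  have hη1 : ‖η‖ ≤ 3 * ‖z - z'‖ := by
    rw [hη, norm_div, div_le_iff₀ hz0, norm_sub_rev]
    nlinarith [norm_nonneg (z - z')]
  have e1 : (1 : ℂ) + η = z' / z := by rw [hη]; field_simp; ring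
  have re_mem : ∀ {ζ : ℂ} {z : ℂ}, Complex.exp (-ζ) = z → ‖z‖ ≤ 1 → rexp (-1) ≤ ‖z‖ → ζ.re ∈ Icc (0 : ℝ) 1 := by
    intro ζ z e a b
    rw [← e, Complex.norm_exp] at a b
    rw [Real.exp_le_one_iff] at a; rw [Real.exp_le_exp] at b
    simp at a b; exact ⟨a, b⟩
  have E1 : Complex.exp (-(-Complex.log z)) = z := by rw [neg_neg, Complex.exp_log z0]
  have E2 : Complex.exp (-(-Complex.log z - Complex.log (1 + η))) = z' := by
    rw [show -(-Complex.log z - Complex.log (1 + η)) = Complex.log z + Complex.log (1 + η) by ring, Complex.exp_add,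
      Complex.exp_log z0, Complex.exp_log (by rw [e1]; exact div_ne_zero z0' z0), e1]
    field_simp
  refine ⟨_, _, E1, E2, re_mem E1 hz h1, re_mem E2 hz' h1', ?_⟩
  rw [sub_sub_cancel]
  have := Complex.norm_log_one_add_half_le_self (z := η) (by linarith)
  linarith [norm_nonneg (z - z')]

lemma Adm.near {k : ℝ} (hk0 : 0 ≤ k) (hk : k < 1) : ∃ h0 C : ℝ, 0 < h0 ∧ h0 ≤ 1 ∧ 0 ≤ C ∧ ∀ {J A B S}, Adm J → 0 ≤ A → 0 ≤ B →
    Bnds J S → HolD (gam k) A (jf J) → HolD (gam k) A (jp J) →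
    (∀ z z' : ℂ, ‖z‖ ≤ 1 → ‖z'‖ ≤ 1 → |jf J z - jf J z'| ≤ k * ‖jp J z - jp J z'‖ + B * ‖z - z'‖ ^ gam k) →
    ∀ z z' : ℂ, ‖z‖ ≤ 1 → ‖z'‖ ≤ 1 → ‖z - z'‖ ≤ h0 →
      |jf J z - jf J z'| ≤ (A / 4 + C * (B + S)) * ‖z - z'‖ ^ gam k ∧
      ‖jp J z - jp J z'‖ ≤ (A / 4 + C * (B + S)) * ‖z - z'‖ ^ gam k := by
  obtain ⟨h1, C1, h1p, h1l, hC1, H1⟩ := Chart.improve hk0 hk (δ := 1 / 180) (r0 := 1) (by norm_num) (by norm_num)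
  obtain ⟨h2, C2, h2p, h2l, hC2, H2⟩ := Chart.improve hk0 hk (δ := 1 / 4) (r0 := 1 / 10) (by norm_num) (by norm_num)
  have hγ := gam_pos hk0 hk
  have hγ1 := gam_le hk0 hk
  refine ⟨min (1 / 10) (min (h1 / 5) h2), C2 + (6 + 45 * 28 * C1 + 108), by positivity, ?_, by positivity, ?_⟩
  · exact (min_le_left _ _).trans (by norm_num)
  intro J A B S hJ hA hB hS hf hp pair z z' hz hz' hd
  have S0 : 0 ≤ S := (abs_nonneg _).trans (hS.f 0 (by simp))
  have hd1 : ‖z - z'‖ ≤ 1 / 10 := hd.trans (min_le_left _ _)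
  have hd2 : ‖z - z'‖ ≤ h1 / 5 := hd.trans ((min_le_right _ _).trans (min_le_left _ _))
  have hd3 : ‖z - z'‖ ≤ h2 := hd.trans ((min_le_right _ _).trans (min_le_right _ _))
  have e3 : 1 / 3 < rexp (-1) := by linarith [Real.exp_neg_one_gt_d9]
  have e4 : rexp (-1) < 4 / 10 := by linarith [Real.exp_neg_one_lt_d9]
  have fin : ∀ {X Y : ℝ}, X ≤ Y → X * ‖z - z'‖ ^ gam k ≤ Y * ‖z - z'‖ ^ gam k := fun h =>
    mul_le_mul_of_nonneg_right h (by positivity)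
  have int_case : ‖z‖ ≤ 1 / 2 → ‖z'‖ ≤ 1 / 2 → 
      |jf J z - jf J z'| ≤ (A / 4 + (C2 + (6 + 45 * 28 * C1 + 108)) * (B + S)) * ‖z - z'‖ ^ gam k ∧
      ‖jp J z - jp J z'‖ ≤ (A / 4 + (C2 + (6 + 45 * 28 * C1 + 108)) * (B + S)) * ‖z - z'‖ ^ gam k := by
    intro a a'
    have rm : ∀ {z : ℂ}, ‖z‖ ≤ 1 / 2 → z.re ∈ Icc (-1 / 2 : ℝ) (1 / 2) ∧ z.im ∈ Icc (-1 / 2 : ℝ) (1 / 2) := by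
      intro z h
      have r1 := abs_le.1 ((Complex.abs_re_le_norm z).trans h)
      have r2 := abs_le.1 ((Complex.abs_im_le_norm z).trans h)
      exact ⟨⟨by linarith [r1.1], r1.2⟩, ⟨by linarith [r2.1], r2.2⟩⟩
    have := H2 (hJ.chart0 hf hp pair) hA hB (-1 / 2) (1 / 2) (-1 / 2) (1 / 2) (fun x hx y hy => good_ball hx hy) z z'
      (rm a).1 (rm a').1 (rm a).2 (rm a').2 hd3
    have le : 1 / 4 * A + C2 * B ≤ A / 4 + (C2 + (6 + 45 * 28 * C1 + 108)) * (B + S) := by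
      nlinarith [mul_nonneg hC2 S0, mul_nonneg hC1 S0, mul_nonneg hC1 hB]
    exact ⟨this.1.trans (fin le), this.2.trans (fin le)⟩
  by_cases c1 : ‖z‖ < rexp (-1)
  · refine int_case (by linarith) ?_
    have := norm_sub_norm_le z' z
    rw [norm_sub_rev] at this; linarith
  by_cases c2 : ‖z'‖ < rexp (-1)
  · refine int_case ?_ (by linarith)
    have := norm_sub_norm_le z z'
    linarith
  push Not at c1 c2
  obtain ⟨ζ, ζ', E, E', m, m', hζ⟩ := log_pair hz hz' c1 c2 hd1
  have := H1 (hJ.chartU hk0 hk.le hγ (by linarith) hA hB hS hf hp pair) (by positivity) (by positivity) 0 1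
    (min ζ.im ζ'.im) (max ζ.im ζ'.im) (fun x hx y _ => good_strip hx) ζ ζ' m m' ⟨min_le_left _ _, le_max_left _ _⟩
    ⟨min_le_right _ _, le_max_right _ _⟩ (by linarith)
  simp only [fU, pU, E, E'] at this
  obtain ⟨r1, r2⟩ := this
  set X := 1 / 180 * (A + 24 * S) + C1 * (B + 28 * S) with hX
  have X0 : 0 ≤ X := by positivity
  have pw : X * ‖ζ - ζ'‖ ^ gam k ≤ X * (5 * ‖z - z'‖ ^ gam k) := by
    refine mul_le_mul_of_nonneg_left ?_ X0
    refine (Real.rpow_le_rpow (norm_nonneg _) hζ hγ.le).trans ?_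
    rw [Real.mul_rpow (by norm_num) (norm_nonneg _)]
    refine mul_le_mul_of_nonneg_right ?_ (by positivity)
    refine (Real.rpow_le_rpow_of_exponent_le (by norm_num) (by linarith : gam k ≤ 1)).trans ?_
    simp
  have hd4 : ‖z - z'‖ ≤ ‖z - z'‖ ^ gam k :=
    Real.self_le_rpow_of_le_one (norm_nonneg _) (by linarith) (by linarith)
  set D := ‖z - z'‖ ^ gam k with hD
  have D0 : 0 ≤ D := by positivity
  obtain ⟨q1, q2⟩ := hJ.cmpU hS hz hz'
  have n9 : 1 / 9 ≤ ‖z‖ ^ 2 := by nlinarith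
  have SD := mul_le_mul_of_nonneg_left hd4 S0
  have le : 9 * (5 * X + 12 * S) ≤ A / 4 + (C2 + (6 + 45 * 28 * C1 + 108)) * (B + S) := by
    rw [hX]
    nlinarith [mul_nonneg hC2 S0, mul_nonneg hC1 S0, mul_nonneg hC1 hB, mul_nonneg hC2 hB]
  constructor
  · refine le_trans ?_ (fin le)
    have t1 := abs_sub_abs_le_abs_sub (‖z‖ ^ 2 * (jf J z - jf J z')) (‖z‖ ^ 2 * jf J z - ‖z'‖ ^ 2 * jf J z')
    rw [abs_sub_comm (‖z‖ ^ 2 * (jf J z - jf J z')), abs_mul, abs_of_nonneg (by positivity : 0 ≤ ‖z‖ ^ 2)] at t1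
    have := mul_le_mul_of_nonneg_right n9 (abs_nonneg (jf J z - jf J z'))
    linarith [mul_nonneg S0 D0]
  · refine le_trans ?_ (fin le)
    have t1 := norm_sub_norm_le (z ^ 2 * (jp J z - jp J z')) ((z ^ 2 * jp J z + 2 * z * jg J z) - (z' ^ 2 * jp J z' + 2 * z' * jg J z'))
    rw [norm_sub_rev (z ^ 2 * (jp J z - jp J z')), norm_mul, norm_pow] at t1
    have := mul_le_mul_of_nonneg_right n9 (norm_nonneg (jp J z - jp J z'))
    linarith [mul_nonneg S0 D0]

end FN

namespace FN
open MeasureTheory intervalIntegral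

def Pair (k γ B : ℝ) (J : ℂ → Jt) : Prop :=
  ∀ z z' : ℂ, ‖z‖ ≤ 1 → ‖z'‖ ≤ 1 → |jf J z - jf J z'| ≤ k * ‖jp J z - jp J z'‖ + B * ‖z - z'‖ ^ γ

lemma exists_rho {γ ε : ℝ} (hγ : 0 < γ) (hε : 0 < ε) : ∃ ρ : ℝ, 0 < ρ ∧ ρ ≤ 1 ∧ (2 * ρ) ^ γ ≤ ε := by
  refine ⟨min 1 (ε ^ (1 / γ) / 2), by positivity, min_le_left _ _, ?_⟩
  have h1 : 2 * min 1 (ε ^ (1 / γ) / 2) ≤ ε ^ (1 / γ) := by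
    have := min_le_right 1 (ε ^ (1 / γ) / 2); linarith
  refine (Real.rpow_le_rpow (by positivity) h1 hγ.le).trans ?_
  rw [← Real.rpow_mul hε.le]; simp [hγ.ne']

lemma Adm.sup_est {k γ ε : ℝ} (hk0 : 0 ≤ k) (hk : k < 1) (hγ : 0 < γ) (hε : 0 < ε) :
    ∃ C : ℝ, 0 ≤ C ∧ ∀ {J A B}, Adm J → 0 ≤ A → 0 ≤ B → HolD γ A (jp J) →
      (∀ z : ℂ, ‖z‖ ≤ 1 → |jf J z| ≤ k * ‖jp J z‖ + B) → Bnds J (ε * A + C * B) := by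
  have hk1 : 0 < 1 - k := by linarith
  obtain ⟨ρ, hρ, hρ1, hρε⟩ := exists_rho hγ hε
  refine ⟨4 / ((1 - k) * ρ ^ 2) + 1, by positivity, ?_⟩
  intro J A B hJ hA hB hH hf
  have L2 := hJ.L2 hk0 hk (b := fun _ => B) continuous_const hf
  rw [II_const] at L2
  have hm : II (fun z => ‖jp J z‖ ^ 2) ≤ (2 * B / (1 - k)) ^ 2 := by
    refine L2.trans ?_
    rw [div_pow]
    refine div_le_div_of_nonneg_right ?_ (by positivity)
    nlinarith [Real.pi_le_four, sq_nonneg B]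
  have hp : ∀ z : ℂ, ‖z‖ ≤ 1 → ‖jp J z‖ ≤ ε * A + 4 / ((1 - k) * ρ ^ 2) * B := by
    intro z hz
    have h1 := sup_interp (jp_cont hJ.1) hγ hA (by positivity) hρ hρ1 hH hm hz
    have h2 := mul_le_mul_of_nonneg_left hρε hA
    have h3 : 2 * (2 * B / (1 - k)) / ρ ^ 2 = 4 / ((1 - k) * ρ ^ 2) * B := by field_simp; ring
    rw [h3] at h1; linarith
  refine ⟨fun z hz => ?_, fun z hz => ?_⟩
  · have h1 := hf z hz
    have h2 := hp z hz
    have h3 : k * ‖jp J z‖ ≤ ‖jp J z‖ := mul_le_of_le_one_left (norm_nonneg _) hk.le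
    linarith
  · have h2 := hp z hz
    linarith

lemma Adm.step {k : ℝ} (hk0 : 0 ≤ k) (hk : k < 1) : ∃ C : ℝ, 0 ≤ C ∧ ∀ {J A B}, Adm J → 0 ≤ A → 0 ≤ B →
    HolD (gam k) A (jf J) → HolD (gam k) A (jp J) → Pair k (gam k) B J →
    (∀ z : ℂ, ‖z‖ ≤ 1 → |jf J z| ≤ k * ‖jp J z‖ + B) →
    HolD (gam k) (A / 2 + C * B) (jf J) ∧ HolD (gam k) (A / 2 + C * B) (jp J) := by
  have hγ := gam_pos hk0 hk
  obtain ⟨h0, C1, h0p, h01, hC1, near⟩ := Adm.near hk0 hk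
  set q := h0 ^ (-gam k) with hq
  have q0 : 0 < q := by positivity
  set ε := 1 / (4 * (C1 + 2 * q)) with hε
  have ε0 : 0 < ε := by positivity
  have hεq : (C1 + 2 * q) * ε = 1 / 4 := by rw [hε]; field_simp
  obtain ⟨C2, hC2, sup⟩ := Adm.sup_est hk0 hk hγ ε0
  refine ⟨C1 + (C1 + 2 * q) * C2, by positivity, ?_⟩
  intro J A B hJ hA hB hf hp pair hb
  have hS := sup hJ hA hB hp hb
  set S := ε * A + C2 * B with hSdef
  have S0 : 0 ≤ S := by positivity
  have hle : A / 4 + C1 * B + (C1 + 2 * q) * S ≤ A / 2 + (C1 + (C1 + 2 * q) * C2) * B := by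
    have : (C1 + 2 * q) * S = (C1 + 2 * q) * ε * A + (C1 + 2 * q) * C2 * B := by rw [hSdef]; ring
    rw [this, hεq]; linarith
  have far : ∀ d : ℝ, h0 ≤ d → 2 * S ≤ (2 * q * S) * d ^ gam k := by
    intro d hd
    have : 1 ≤ q * d ^ gam k := by
      have h1 : q * h0 ^ gam k = 1 := by rw [hq, ← Real.rpow_add h0p]; simp
      rw [← h1]
      exact mul_le_mul_of_nonneg_left (Real.rpow_le_rpow h0p.le hd hγ.le) q0.le
    nlinarith
  have fin : ∀ {X Y d : ℝ}, X ≤ Y * d ^ gam k → Y ≤ A / 4 + C1 * B + (C1 + 2 * q) * S → 0 ≤ d →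
      X ≤ (A / 2 + (C1 + (C1 + 2 * q) * C2) * B) * d ^ gam k := fun h1 h2 h3 =>
    h1.trans (mul_le_mul_of_nonneg_right (h2.trans hle) (by positivity))
  constructor
  · intro z z' hz hz'
    by_cases hd : ‖z - z'‖ ≤ h0
    · refine fin (near hJ hA hB hS hf hp pair z z' hz hz' hd).1 ?_ (norm_nonneg _)
      nlinarith [mul_nonneg q0.le S0]
    · refine fin (le_trans ?_ (far _ (not_le.1 hd).le)) ?_ (norm_nonneg _)
      · have := norm_sub_le (jf J z) (jf J z')
        have h1 : ‖jf J z‖ ≤ S := hS.f z hz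
        have h2 : ‖jf J z'‖ ≤ S := hS.f z' hz'
        linarith
      · nlinarith [mul_nonneg hC1 S0, mul_nonneg hC1 hB]
  · intro z z' hz hz'
    by_cases hd : ‖z - z'‖ ≤ h0
    · refine fin (near hJ hA hB hS hf hp pair z z' hz hz' hd).2 ?_ (norm_nonneg _)
      nlinarith [mul_nonneg q0.le S0]
    · refine fin (le_trans ?_ (far _ (not_le.1 hd).le)) ?_ (norm_nonneg _)
      · have := norm_sub_le (jp J z) (jp J z')
        linarith [hS.p z hz, hS.p z' hz']
      · nlinarith [mul_nonneg hC1 S0, mul_nonneg hC1 hB]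

lemma HolD.lim {V : Type*} [SeminormedAddCommGroup V] {γ A B : ℝ} {p : ℂ → V}
    (h : ∀ n : ℕ, HolD γ (A / 2 ^ n + B) p) : HolD γ B p := by
  intro z z' hz hz'
  have t1 : Filter.Tendsto (fun n : ℕ => (A / 2 ^ n + B) * ‖z - z'‖ ^ γ) Filter.atTop
      (nhds ((0 + B) * ‖z - z'‖ ^ γ)) := by
    refine Filter.Tendsto.mul_const _ (Filter.Tendsto.add_const _ ?_)
    have := (tendsto_pow_atTop_nhds_zero_of_lt_one (by norm_num : (0 : ℝ) ≤ 1 / 2) (by norm_num)).const_mul A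
    rw [mul_zero] at this
    refine this.congr fun n => ?_
    rw [one_div, inv_pow]; rfl
  rw [zero_add] at t1
  exact ge_of_tendsto' t1 fun n => h n z z' hz hz'

lemma apriori {k : ℝ} (hk0 : 0 ≤ k) (hk : k < 1) : ∃ C : ℝ, 0 < C ∧ ∀ {J A B}, Adm J → 0 ≤ A → 0 ≤ B →
    HolD (gam k) A (jf J) → HolD (gam k) A (jp J) → Pair k (gam k) B J →
    (∀ z : ℂ, ‖z‖ ≤ 1 → |jf J z| ≤ k * ‖jp J z‖ + B) →
    HolD (gam k) (C * B) (jf J) ∧ HolD (gam k) (C * B) (jp J) ∧ ∀ z : ℂ, ‖z‖ ≤ 1 → ‖J z‖ ≤ C * B := by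
  have hγ := gam_pos hk0 hk
  obtain ⟨C1, hC1, step⟩ := Adm.step hk0 hk
  obtain ⟨C2, hC2, sup⟩ := Adm.sup_est hk0 hk hγ one_pos
  refine ⟨8 * (2 * C1 + C2) + 1, by positivity, ?_⟩
  intro J A B hJ hA hB hf hp pair hb
  have it : ∀ n : ℕ, HolD (gam k) (A / 2 ^ n + 2 * C1 * B) (jf J) ∧ HolD (gam k) (A / 2 ^ n + 2 * C1 * B) (jp J) := by
    intro n
    induction n with
    | zero =>
      have w : ∀ z z' : ℂ, A * ‖z - z'‖ ^ gam k ≤ (A / 2 ^ 0 + 2 * C1 * B) * ‖z - z'‖ ^ gam k := by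
        intro z z'
        refine mul_le_mul_of_nonneg_right ?_ (by positivity)
        have : 0 ≤ 2 * C1 * B := by positivity
        simp; linarith
      exact ⟨fun z z' hz hz' => (hf z z' hz hz').trans (w z z'), fun z z' hz hz' => (hp z z' hz hz').trans (w z z')⟩
    | succ n ih =>
      have := step hJ (by positivity) hB ih.1 ih.2 pair hb
      have e : (A / 2 ^ n + 2 * C1 * B) / 2 + C1 * B = A / 2 ^ (n + 1) + 2 * C1 * B := by
        rw [pow_succ]; field_simp; ring
      rwa [e] at this
  have f1 := HolD.lim fun n => (it n).1
  have p1 := HolD.lim fun n => (it n).2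
  have S := sup hJ (by positivity) hB p1 hb
  rw [one_mul] at S
  have e0 : 0 ≤ C1 * B := by positivity
  have e1 : 0 ≤ C2 * B := by positivity
  have le : 2 * C1 * B ≤ (8 * (2 * C1 + C2) + 1) * B := by nlinarith
  have w : ∀ z z' : ℂ, 2 * C1 * B * ‖z - z'‖ ^ gam k ≤ (8 * (2 * C1 + C2) + 1) * B * ‖z - z'‖ ^ gam k :=
    fun z z' => mul_le_mul_of_nonneg_right le (by positivity)
  refine ⟨fun z z' hz hz' => (f1 z z' hz hz').trans (w z z'), fun z z' hz hz' => (p1 z z' hz hz').trans (w z z'), ?_⟩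
  intro z hz
  obtain ⟨g1, w1⟩ := hJ.gw_bound S.f S.p hz
  have a1 := S.f z hz; have a2 := S.p z hz
  refine Jt_le.2 ⟨?_, ?_, ?_, ?_⟩
  · change |jw J z| ≤ _; linarith
  · change ‖jg J z‖ ≤ _; linarith
  · change |jf J z| ≤ _; linarith
  · change ‖jp J z‖ ≤ _; linarith

/-- retraction onto the disc -/
def ret (z : ℂ) : ℂ := z / (max 1 ‖z‖ : ℝ)

lemma ret_norm (z : ℂ) : ‖ret z‖ ≤ 1 := by
  have h : 0 < max 1 ‖z‖ := by positivity
  rw [ret, norm_div, Complex.norm_real, Real.norm_of_nonneg h.le, div_le_one h]; exact le_max_right _ _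

lemma ret_id {z : ℂ} (hz : ‖z‖ ≤ 1) : ret z = z := by simp [ret, max_eq_left hz]

lemma ret_cont : Continuous ret := by
  refine continuous_id.div (by fun_prop) fun z => ?_
  have h : 0 < max 1 ‖z‖ := by positivity
  exact_mod_cast h.ne'

def UCauchy (J : ℕ → ℂ → Jt) : Prop :=
  ∀ ε > 0, ∃ N, ∀ m ≥ N, ∀ n ≥ N, ∀ z : ℂ, ‖z‖ ≤ 1 → ‖J m z - J n z‖ ≤ ε

lemma Adm.limit {J : ℕ → ℂ → Jt} (hJ : ∀ n, Adm (J n)) (hc : UCauchy J) :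
    ∃ K, Adm K ∧ ∀ ε > 0, ∃ N, ∀ n ≥ N, ∀ z : ℂ, ‖z‖ ≤ 1 → ‖J n z - K z‖ ≤ ε := by
  have cs : ∀ z : ℂ, CauchySeq fun n => J n (ret z) := by
    intro z
    rw [Metric.cauchySeq_iff]
    intro ε hε
    obtain ⟨N, hN⟩ := hc (ε / 2) (by positivity)
    refine ⟨N, fun m hm n hn => ?_⟩
    rw [dist_eq_norm]
    linarith [hN m hm n hn _ (ret_norm z)]
  choose K hK using fun z => cauchySeq_tendsto_of_complete (cs z)
  have uni : ∀ ε > 0, ∃ N, ∀ n ≥ N, ∀ z : ℂ, ‖J n (ret z) - K z‖ ≤ ε := by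
    intro ε hε
    obtain ⟨N, hN⟩ := hc ε hε
    refine ⟨N, fun n hn z => ?_⟩
    have := ((tendsto_const_nhds (x := J n (ret z))).sub (hK z)).norm
    refine le_of_tendsto this ?_
    filter_upwards [Filter.eventually_ge_atTop N] with m hm
    exact hN n hn m hm _ (ret_norm z)
  have uni' : ∀ ε > 0, ∃ N, ∀ n ≥ N, ∀ z : ℂ, ‖z‖ ≤ 1 → ‖J n z - K z‖ ≤ ε := by
    intro ε hε
    obtain ⟨N, hN⟩ := uni ε hε
    refine ⟨N, fun n hn z hz => ?_⟩
    have := hN n hn z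
    rwa [ret_id hz] at this
  refine ⟨K, ⟨?_, fun ε hε => ?_⟩, uni'⟩
  · have tu : TendstoUniformly (fun n z => J n (ret z)) K Filter.atTop := by
      rw [Metric.tendstoUniformly_iff]
      intro ε hε
      obtain ⟨N, hN⟩ := uni (ε / 2) (by positivity)
      filter_upwards [Filter.eventually_ge_atTop N] with n hn z
      rw [dist_comm, dist_eq_norm]
      linarith [hN n hn z]
    exact tu.continuous (Filter.Frequently.of_forall fun n => (hJ n).1.comp ret_cont)
  · obtain ⟨N, hN⟩ := uni' (ε / 2) (by positivity)
    obtain ⟨S, hS, h1⟩ := (hJ N).2 (ε / 2) (by positivity)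
    refine ⟨S, hS, fun z hz => ?_⟩
    rw [show S z - K z = (S z - J N z) + (J N z - K z) by abel]
    linarith [norm_add_le (S z - J N z) (J N z - K z), h1 z hz, hN N le_rfl z hz]

lemma ucauchy_of_fp {J : ℕ → ℂ → Jt} (hJ : ∀ n, Adm (J n))
    (hf : ∀ ε > 0, ∃ N, ∀ m ≥ N, ∀ n ≥ N, ∀ z : ℂ, ‖z‖ ≤ 1 → |jf (J m) z - jf (J n) z| ≤ ε)
    (hp : ∀ ε > 0, ∃ N, ∀ m ≥ N, ∀ n ≥ N, ∀ z : ℂ, ‖z‖ ≤ 1 → ‖jp (J m) z - jp (J n) z‖ ≤ ε) : UCauchy J := by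
  intro ε hε
  obtain ⟨N1, h1⟩ := hf (ε / 8) (by positivity)
  obtain ⟨N2, h2⟩ := hp (ε / 8) (by positivity)
  refine ⟨max N1 N2, fun m hm n hn z hz => ?_⟩
  have a1 := h1 m (le_of_max_le_left hm) n (le_of_max_le_left hn)
  have a2 := h2 m (le_of_max_le_right hm) n (le_of_max_le_right hn)
  obtain ⟨g1, w1⟩ := ((hJ m).sub (hJ n)).gw_bound (S := ε / 8) a1 a2 hz
  refine Jt_le.2 ⟨?_, ?_, ?_, ?_⟩
  · change |jw (J m - J n) z| ≤ _; linarith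
  · change ‖jg (J m - J n) z‖ ≤ _; linarith
  · change |jf (J m) z - jf (J n) z| ≤ _; linarith [a1 z hz]
  · change ‖jp (J m) z - jp (J n) z‖ ≤ _; linarith [a2 z hz]

lemma HolD.sub {V : Type*} [SeminormedAddCommGroup V] {γ A B : ℝ} {p q : ℂ → V}
    (hp : HolD γ A p) (hq : HolD γ B q) : HolD γ (A + B) (fun z => p z - q z) := by
  intro z z' hz hz'
  have h1 := hp z z' hz hz'
  have h2 := hq z z' hz hz'
  rw [show p z - q z - (p z' - q z') = (p z - p z') - (q z - q z') by abel]
  have := norm_sub_le (p z - p z') (q z - q z')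
  linarith

lemma p_cauchy {J : ℕ → ℂ → Jt} (hJ : ∀ n, Adm (J n)) {γ A : ℝ} (hγ : 0 < γ) (hA : 0 ≤ A)
    (hH : ∀ n, HolD γ A (jp (J n)))
    (h2 : ∀ ε > 0, ∃ N, ∀ m ≥ N, ∀ n ≥ N, II (fun z => ‖jp (J m) z - jp (J n) z‖ ^ 2) ≤ ε) :
    ∀ ε > 0, ∃ N, ∀ m ≥ N, ∀ n ≥ N, ∀ z : ℂ, ‖z‖ ≤ 1 → ‖jp (J m) z - jp (J n) z‖ ≤ ε := by
  intro ε hε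
  obtain ⟨ρ, hρ, hρ1, hρε⟩ := exists_rho hγ (ε := ε / (2 * (A + A + 1))) (by positivity)
  obtain ⟨N, hN⟩ := h2 ((ε / 4 * ρ ^ 2) ^ 2) (by positivity)
  refine ⟨N, fun m hm n hn z hz => ?_⟩
  have cm := jp_cont (hJ m).1; have cn := jp_cont (hJ n).1
  have := sup_interp (p := fun z => jp (J m) z - jp (J n) z) (by fun_prop) hγ (by positivity) (by positivity) hρ hρ1
    ((hH m).sub (hH n)) (hN m hm n hn) hz
  refine this.trans ?_
  have h3 : (A + A) * (2 * ρ) ^ γ ≤ (A + A + 1) * (ε / (2 * (A + A + 1))) :=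
    mul_le_mul (by linarith) hρε (by positivity) (by positivity)
  have h4 : (A + A + 1) * (ε / (2 * (A + A + 1))) = ε / 2 := by field_simp
  have h5 : 2 * (ε / 4 * ρ ^ 2) / ρ ^ 2 = ε / 2 := by field_simp; norm_num
  linarith

end FN

namespace FN
open MeasureTheory intervalIntegral

lemma SJet.add {J K : ℂ → Jt} (hJ : SJet J) (hK : SJet K) : SJet (J + K) where
  gj := ⟨hJ.gj.cd.add hK.gj.cd, fun z => ((hJ.gj.d z).add (hK.gj.d z)).congr_fderiv (by
    ext v
    have e1 : jf (J + K) z = jf J z + jf K z := rfl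
    have e2 : jp (J + K) z = jp J z + jp K z := rfl
    simp [dG_apply, e1, e2]; ring)⟩
  dw z := ((hJ.dw z).add (hK.dw z)).congr_fderiv (by
    ext v
    have e1 : jg (J + K) z = jg J z + jg K z := rfl
    simp [dW_apply, e1]; ring)
  bd z hz := by
    have e1 : jw (J + K) z = jw J z + jw K z := rfl
    rw [e1, hJ.bd z hz, hK.bd z hz, add_zero]

/-- functions that are Laplacians of smooth jets -/
def Pol (h : ℂ → ℝ) : Prop :=
  ∃ J, SJet J ∧ ContDiff ℝ 1 (jf J) ∧ ContDiff ℝ 1 (jp J) ∧ ∀ z, jf J z = h z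

lemma Pol.add {h k : ℂ → ℝ} (hh : Pol h) (hk : Pol k) : Pol (fun z => h z + k z) := by
  obtain ⟨J, a1, a2, a3, a4⟩ := hh
  obtain ⟨K, b1, b2, b3, b4⟩ := hk
  refine ⟨J + K, a1.add b1, a2.add b2, a3.add b3, fun z => ?_⟩
  change _ = h z + k z
  rw [← a4, ← b4]; rfl

lemma conj_hasFDerivAt (z : ℂ) : HasFDerivAt (fun z : ℂ => (starRingEnd ℂ) z)
    (Complex.conjCLE : ℂ →L[ℝ] ℂ) z := (Complex.conjCLE : ℂ →L[ℝ] ℂ).hasFDerivAt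

lemma pow_hasFDerivAt (n : ℕ) (z : ℂ) : HasFDerivAt (fun z : ℂ => z ^ n)
    (ContinuousLinearMap.mul ℝ ℂ ((n : ℂ) * z ^ (n - 1))) z := by
  have := ((hasDerivAt_pow n z).hasFDerivAt.restrictScalars ℝ)
  refine this.congr_fderiv ?_
  ext <;> simp [mul_comm]

lemma cpow_hasFDerivAt (n : ℕ) (z : ℂ) : HasFDerivAt (fun z : ℂ => (starRingEnd ℂ) z ^ n)
    ((ContinuousLinearMap.mul ℝ ℂ ((n : ℂ) * (starRingEnd ℂ) z ^ (n - 1))).comp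
      (Complex.conjCLE : ℂ →L[ℝ] ℂ)) z :=
  (pow_hasFDerivAt n ((starRingEnd ℂ) z)).comp z (conj_hasFDerivAt z)

/-- derivative of `z^a conj z^b` -/
lemma mono_hasFDerivAt (a b : ℕ) (z : ℂ) :
    HasFDerivAt (fun z : ℂ => z ^ a * (starRingEnd ℂ) z ^ b)
      (ContinuousLinearMap.mul ℝ ℂ (a * z ^ (a - 1) * (starRingEnd ℂ) z ^ b) +
        (ContinuousLinearMap.mul ℝ ℂ (b * z ^ a * (starRingEnd ℂ) z ^ (b - 1))).comp
          (Complex.conjCLE : ℂ →L[ℝ] ℂ)) z := by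
  refine ((pow_hasFDerivAt a z).mul (cpow_hasFDerivAt b z)).congr_fderiv ?_
  ext v <;> simp <;> ring_nf <;> simp

lemma mono_contDiff (a b : ℕ) {n : WithTop ℕ∞} :
    ContDiff ℝ n (fun z : ℂ => z ^ a * (starRingEnd ℂ) z ^ b) := by
  have : ContDiff ℝ n (fun z : ℂ => (starRingEnd ℂ) z) := Complex.conjCLE.contDiff
  fun_prop

def mw (C : ℂ) (b m : ℕ) (z : ℂ) : ℝ :=
  (C * (z ^ (b + m + 1) * (starRingEnd ℂ) z ^ (b + 1)) - C * (z ^ m * (starRingEnd ℂ) z ^ 0)).re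
def mg (C : ℂ) (b m : ℕ) (z : ℂ) : ℂ :=
  C * (b + m + 1) * (z ^ (b + m) * (starRingEnd ℂ) z ^ (b + 1)) -
    C * m * (z ^ (m - 1) * (starRingEnd ℂ) z ^ 0) +
    (starRingEnd ℂ) C * (b + 1) * (z ^ b * (starRingEnd ℂ) z ^ (b + m + 1))
def mp (C : ℂ) (b m : ℕ) (z : ℂ) : ℂ :=
  2 * (C * (b + m + 1) * (b + m) * (z ^ (b + m - 1) * (starRingEnd ℂ) z ^ (b + 1)) -
    C * m * (m - 1 : ℕ) * (z ^ (m - 1 - 1) * (starRingEnd ℂ) z ^ 0) +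
    (starRingEnd ℂ) C * (b + 1) * b * (z ^ (b - 1) * (starRingEnd ℂ) z ^ (b + m + 1)))
def mf (C : ℂ) (b m : ℕ) (z : ℂ) : ℝ :=
  (4 * C * (b + m + 1) * (b + 1) * (z ^ (b + m) * (starRingEnd ℂ) z ^ b)).re

lemma mono_sjet (C : ℂ) (b m : ℕ) : SJet (fun z => (mw C b m z, mg C b m z, mf C b m z, mp C b m z)) where
  gj := by
    refine ⟨?_, fun z => ?_⟩
    · change ContDiff ℝ 2 (mg C b m)
      unfold mg
      exact ((contDiff_const.mul (mono_contDiff _ _)).sub (contDiff_const.mul (mono_contDiff _ _))).add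
        (contDiff_const.mul (mono_contDiff _ _))
    · change HasFDerivAt (mg C b m) (dG (mf C b m z) (mp C b m z)) z
      refine ((((mono_hasFDerivAt _ _ z).const_mul _).sub ((mono_hasFDerivAt _ _ z).const_mul _)).add
        ((mono_hasFDerivAt _ _ z).const_mul _)).congr_fderiv ?_
      refine ContinuousLinearMap.ext fun v => ?_
      have c4 : (starRingEnd ℂ) 4 = 4 := Complex.conj_ofNat 4
      rw [dG_apply, mf, Complex.re_eq_add_conj, mp]
      simp [c4]
      ring
  dw z := by
    change HasFDerivAt (mw C b m) (dW (mg C b m z)) z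
    refine (Complex.reCLM.hasFDerivAt.comp z (((mono_hasFDerivAt _ _ z).const_mul _).sub
      ((mono_hasFDerivAt _ _ z).const_mul _))).congr_fderiv ?_
    refine ContinuousLinearMap.ext fun v => ?_
    rw [dW_apply, mg]
    apply Complex.ofReal_injective
    simp only [ContinuousLinearMap.comp_apply, Complex.reCLM_apply]
    rw [Complex.re_eq_add_conj, Complex.re_eq_add_conj]
    simp
    ring
  bd z hz := by
    change mw C b m z = 0
    have h1 : z * (starRingEnd ℂ) z = 1 := by rw [Complex.mul_conj']; simp [hz]
    have : z ^ (b + m + 1) * (starRingEnd ℂ) z ^ (b + 1) = z ^ m := by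
      rw [show b + m + 1 = (b + 1) + m by ring, pow_add, mul_right_comm, ← mul_pow, h1]; simp
    rw [mw, this]; simp
end FN

namespace FN
open MeasureTheory intervalIntegral

lemma Pol.congr {h k : ℂ → ℝ} (hh : Pol h) (e : ∀ z, h z = k z) : Pol k := by
  rw [← (funext e : h = k)]; exact hh

lemma mp_contDiff (C : ℂ) (b m : ℕ) : ContDiff ℝ 1 (mp C b m) := by
  unfold mp
  exact contDiff_const.mul (((contDiff_const.mul (mono_contDiff _ _)).sub
    (contDiff_const.mul (mono_contDiff _ _))).add (contDiff_const.mul (mono_contDiff _ _)))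

lemma mf_contDiff (C : ℂ) (b m : ℕ) : ContDiff ℝ 1 (mf C b m) := by
  unfold mf
  exact Complex.reCLM.contDiff.comp (contDiff_const.mul (mono_contDiff _ _))

lemma pol_mono' (c : ℂ) (b m : ℕ) : Pol (fun z => (c * (z ^ (b + m) * (starRingEnd ℂ) z ^ b)).re) := by
  refine ⟨_, mono_sjet (c / (4 * (b + m + 1) * (b + 1))) b m, mf_contDiff _ b m, mp_contDiff _ b m, fun z => ?_⟩
  change mf _ b m z = _
  have h1 : (b + m + 1 : ℂ) ≠ 0 := by exact_mod_cast (by positivity : (b + m + 1 : ℕ) ≠ 0)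
  have h2 : (b + 1 : ℂ) ≠ 0 := by exact_mod_cast (by positivity : (b + 1 : ℕ) ≠ 0)
  rw [mf]; congr 1; field_simp

lemma pol_mono (c : ℂ) (a b : ℕ) : Pol (fun z => (c * (z ^ a * (starRingEnd ℂ) z ^ b)).re) := by
  rcases le_total b a with h | h
  · obtain ⟨m, rfl⟩ := Nat.exists_eq_add_of_le h
    exact pol_mono' c b m
  · obtain ⟨m, rfl⟩ := Nat.exists_eq_add_of_le h
    refine (pol_mono' ((starRingEnd ℂ) c) a m).congr fun z => ?_
    rw [← Complex.conj_re]
    congr 1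
    simp only [map_mul, map_pow, Complex.conj_conj]; ring

inductive Q : (ℂ → ℂ → ℂ) → Prop
  | mono (c : ℂ → ℂ) (hc : Continuous c) (a b : ℕ) : Q (fun z s => c s * (z ^ a * (starRingEnd ℂ) z ^ b))
  | add (K L : ℂ → ℂ → ℂ) (hK : Q K) (hL : Q L) : Q (fun z s => K z s + L z s)

lemma Q.mul_mono {K : ℂ → ℂ → ℂ} (hK : Q K) (c : ℂ → ℂ) (hc : Continuous c) (a b : ℕ) :
    Q (fun z s => c s * (z ^ a * (starRingEnd ℂ) z ^ b) * K z s) := by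
  induction hK with
  | mono d hd a' b' =>
    have := Q.mono (fun s => c s * d s) (hc.mul hd) (a + a') (b + b')
    convert this using 3
    ring
  | add K L hK hL h1 h2 =>
    convert Q.add _ _ h1 h2 using 3
    ring

lemma Q.mul {K L : ℂ → ℂ → ℂ} (hK : Q K) (hL : Q L) : Q (fun z s => K z s * L z s) := by
  induction hK with
  | mono c hc a b => exact hL.mul_mono c hc a b
  | add K1 K2 hK hL h1 h2 =>
    convert Q.add _ _ h1 h2 using 3
    ring

lemma Q.one : Q (fun _ _ => 1) := by
  convert Q.mono (fun _ => 1) continuous_const 0 0 using 3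
  simp

lemma Q.pow {K : ℂ → ℂ → ℂ} (hK : Q K) (n : ℕ) : Q (fun z s => K z s ^ n) := by
  induction n with
  | zero => simpa using Q.one
  | succ n ih => simpa only [pow_succ] using ih.mul hK

lemma Q.cont {K : ℂ → ℂ → ℂ} (hK : Q K) (z : ℂ) : Continuous (K z) := by
  induction hK with
  | mono c hc a b => exact hc.mul continuous_const
  | add K L hK hL h1 h2 => exact h1.add h2

lemma Q.base : Q (fun z s => 1 - (z - s) * ((starRingEnd ℂ) z - (starRingEnd ℂ) s) / 49) := by
  have cc : Continuous fun s : ℂ => (starRingEnd ℂ) s := Complex.continuous_conj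
  have h1 := Q.mono (fun _ => -1/49) continuous_const 1 1
  have h2 := Q.mono (fun s => (starRingEnd ℂ) s / 49) (by fun_prop) 1 0
  have h3 := Q.mono (fun s => s / 49) (by fun_prop) 0 1
  have h4 := Q.mono (fun s => 1 - s * (starRingEnd ℂ) s / 49) (by fun_prop) 0 0
  convert Q.add _ _ (Q.add _ _ h1 h2) (Q.add _ _ h3 h4) using 3
  ring

lemma pol_int {φ : ℂ → ℝ} (hφ : Continuous φ) (hc : HasCompactSupport φ) {K : ℂ → ℂ → ℂ} (hK : Q K) :
    Pol (fun z => (∫ s, (φ s : ℂ) * K z s).re) := by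
  have integ : ∀ {k : ℂ → ℂ}, Continuous k → Integrable fun s => (φ s : ℂ) * k s := by
    intro k hk
    refine Continuous.integrable_of_hasCompactSupport (by fun_prop) ?_
    refine HasCompactSupport.mul_right ?_
    exact hc.comp_left (g := fun x : ℝ => (x : ℂ)) (by simp)
  induction hK with
  | mono c hk a b =>
    refine (pol_mono (∫ s, (φ s : ℂ) * c s) a b).congr fun z => ?_
    rw [← MeasureTheory.integral_mul_const]
    simp only [mul_assoc]
  | add K L hK hL h1 h2 =>
    refine (h1.add h2).congr fun z => ?_
    rw [← Complex.add_re, ← MeasureTheory.integral_add (integ (hK.cont z)) (integ (hL.cont z))]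
    simp only [mul_add]
end FN

namespace FN
open MeasureTheory intervalIntegral

lemma ret_lip (z z' : ℂ) : ‖ret z - ret z'‖ ≤ 2 * ‖z - z'‖ := by
  set m := max 1 ‖z‖ with hm
  set m' := max 1 ‖z'‖ with hm'
  have m1 : 1 ≤ m := le_max_left _ _
  have m1' : 1 ≤ m' := le_max_left _ _
  have hmm : |m' - m| ≤ ‖z - z'‖ := by
    rw [norm_sub_rev]
    refine le_trans ?_ (abs_norm_sub_norm_le z' z)
    have := abs_max_sub_max_le_abs ‖z'‖ ‖z‖ 1
    rwa [max_comm, max_comm ‖z‖] at this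
  have e : ret z - ret z' = (z - z' + ret z' * ((m' - m : ℝ) : ℂ)) / (m : ℂ) := by
    have c1 : (m : ℂ) ≠ 0 := by exact_mod_cast (by linarith : m ≠ 0)
    have c2 : (m' : ℂ) ≠ 0 := by exact_mod_cast (by linarith : m' ≠ 0)
    rw [ret, ret, ← hm, ← hm']
    push_cast
    field_simp; ring
  rw [e, norm_div, Complex.norm_real, Real.norm_of_nonneg (by linarith)]
  refine (div_le_self (norm_nonneg _) m1).trans ?_
  refine (norm_add_le _ _).trans ?_
  rw [norm_mul, Complex.norm_real, Real.norm_eq_abs]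
  nlinarith [ret_norm z', abs_nonneg (m' - m), norm_nonneg (ret z')]

def chi (s : ℂ) : ℝ := max 0 (min 1 (3 - ‖s‖))

lemma chi_nonneg (s : ℂ) : 0 ≤ chi s := le_max_left _ _
lemma chi_le (s : ℂ) : chi s ≤ 1 := max_le zero_le_one (min_le_left _ _)
lemma chi_one {s : ℂ} (h : ‖s‖ ≤ 1) : chi s = 1 := by
  rw [chi, min_eq_left (by linarith), max_eq_right zero_le_one]
lemma chi_zero {s : ℂ} (h : 3 ≤ ‖s‖) : chi s = 0 := by
  rw [chi, max_eq_left]; exact (min_le_right _ _).trans (by linarith)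
lemma chi_lip (s t : ℂ) : |chi s - chi t| ≤ ‖s - t‖ := by
  unfold chi
  rw [max_comm, max_comm 0, min_comm, min_comm 1]
  refine (abs_max_sub_max_le_abs _ _ _).trans ?_
  refine (abs_min_sub_min_le_max _ _ _ _).trans ?_
  simp only [sub_self, abs_zero]
  refine max_le ?_ (norm_nonneg _)
  rw [show (3 - ‖s‖) - (3 - ‖t‖) = ‖t‖ - ‖s‖ by ring, norm_sub_rev]
  exact abs_norm_sub_norm_le t s

lemma ext_hol {γ A M : ℝ} (h0 : 0 < γ) (h1 : γ ≤ 1) {f : ℂ → ℝ} (hA : 0 ≤ A) (hM : 0 ≤ M)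
    (hf : HolD γ A f) (hfM : ∀ z : ℂ, ‖z‖ ≤ 1 → |f z| ≤ M) (s t : ℂ) :
    |chi s * f (ret s) - chi t * f (ret t)| ≤ (2 * A + M) * ‖s - t‖ ^ γ := by
  have a1 := hf _ _ (ret_norm s) (ret_norm t)
  have a2 : ‖ret s - ret t‖ ^ γ ≤ 2 * ‖s - t‖ ^ γ := by
    refine (Real.rpow_le_rpow (norm_nonneg _) (ret_lip s t) h0.le).trans ?_
    rw [Real.mul_rpow (by norm_num) (norm_nonneg _)]
    refine mul_le_mul_of_nonneg_right ?_ (by positivity)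
    have := Real.rpow_le_rpow_of_exponent_le (by norm_num : (1 : ℝ) ≤ 2) h1
    simpa using this
  have a3 : |chi s - chi t| ≤ ‖s - t‖ ^ γ := by
    rcases le_total ‖s - t‖ 1 with h | h
    · refine (chi_lip s t).trans ?_
      have := Real.rpow_le_rpow_of_exponent_ge' (norm_nonneg (s - t)) h h0.le h1
      simpa using this
    · refine le_trans ?_ (Real.one_le_rpow h h0.le)
      rw [abs_le]; constructor <;> linarith [chi_nonneg s, chi_nonneg t, chi_le s, chi_le t]
  rw [Real.norm_eq_abs] at a1
  have e : chi s * f (ret s) - chi t * f (ret t) =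
    chi s * (f (ret s) - f (ret t)) + (chi s - chi t) * f (ret t) := by ring
  rw [e]
  refine (abs_add_le _ _).trans ?_
  rw [abs_mul, abs_mul, abs_of_nonneg (chi_nonneg s)]
  have b1 : chi s * |f (ret s) - f (ret t)| ≤ 1 * (A * (2 * ‖s - t‖ ^ γ)) :=
    mul_le_mul (chi_le s) (a1.trans (mul_le_mul_of_nonneg_left a2 hA)) (abs_nonneg _) zero_le_one
  have b2 : |chi s - chi t| * |f (ret t)| ≤ ‖s - t‖ ^ γ * M :=
    mul_le_mul a3 (hfM _ (ret_norm t)) (abs_nonneg _) (by positivity)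
  linarith

lemma HolD.bdd {γ A : ℝ} {f : ℂ → ℝ} (h0 : 0 < γ) (h1 : γ ≤ 1) (hA : 0 ≤ A) (hf : HolD γ A f) (z : ℂ) (hz : ‖z‖ ≤ 1) :
    |f z| ≤ |f 0| + A := by
  have a := hf z 0 hz (by simp)
  rw [sub_zero, Real.norm_eq_abs] at a
  have b : ‖z‖ ^ γ ≤ 1 := Real.rpow_le_one (norm_nonneg _) hz h0.le
  have c : |f z| ≤ |f z - f 0| + |f 0| := by
    have := abs_add_le (f z - f 0) (f 0); simpa using this
  nlinarith

def lc (u : ℂ) : ℝ := 1 - ‖u‖ ^ 2 / 49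
lemma lc_cont : Continuous lc := by unfold lc; fun_prop

lemma lc_nonneg {u : ℂ} (h : u ∈ closedBall (0 : ℂ) 7) : 0 ≤ lc u := by
  have : ‖u‖ ≤ 7 := by simpa using h
  unfold lc; nlinarith [norm_nonneg u]

lemma lc_peak {g : ℂ → ℝ} (hg : Continuous g) :
    Filter.Tendsto (fun n : ℕ => (∫ x in closedBall (0 : ℂ) 7, lc x ^ n)⁻¹ *
      ∫ x in closedBall (0 : ℂ) 7, lc x ^ n * g x) Filter.atTop (nhds (g 0)) := by
  refine tendsto_setIntegral_pow_smul_of_unique_maximum_of_isCompact_of_continuousOn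
    (isCompact_closedBall _ _) lc_cont.continuousOn ?_ (fun x hx => lc_nonneg hx) (by simp [lc]) ?_ hg.continuousOn
  · intro y _ hy
    have := norm_pos_iff.2 hy
    unfold lc; simp; positivity
  · exact subset_closure (by rw [interior_closedBall _ (by norm_num)]; simp)

lemma lc_pow (z s : ℂ) (n : ℕ) :
    (1 - (z - s) * ((starRingEnd ℂ) z - (starRingEnd ℂ) s) / 49) ^ n = ((lc (z - s) ^ n : ℝ) : ℂ) := by
  rw [← map_sub, Complex.mul_conj', lc]; push_cast; rfl

lemma approx_pol {γ A : ℝ} (h0 : 0 < γ) (h1 : γ ≤ 1) {f : ℂ → ℝ} (hA : 0 ≤ A) (hf : HolD γ A f) :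
    ∃ A', 0 ≤ A' ∧ ∃ h : ℕ → ℂ → ℝ, (∀ n, Pol (h n)) ∧ (∀ n, HolD γ A' (h n)) ∧
      ∀ ε > 0, ∃ N, ∀ n ≥ N, ∀ z : ℂ, ‖z‖ ≤ 1 → |h n z - f z| ≤ ε := by
  set M := |f 0| + A
  have hM : 0 ≤ M := by positivity
  have hol := ext_hol h0 h1 hA hM hf (hf.bdd h0 h1 hA)
  set A' := 2 * A + M
  have hA' : 0 ≤ A' := by positivity
  set φ : ℂ → ℝ := fun s => chi s * f (ret s) with hφ
  have φc : Continuous φ := by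
    rw [continuous_iff_continuousAt]
    intro t
    rw [ContinuousAt, tendsto_iff_norm_sub_tendsto_zero]
    have t1 : Filter.Tendsto (fun s => A' * ‖s - t‖ ^ γ) (nhds t) (nhds (A' * ‖t - t‖ ^ γ)) := by
      have : Continuous fun s : ℂ => A' * ‖s - t‖ ^ γ :=
        continuous_const.mul ((by fun_prop : Continuous fun s : ℂ => ‖s - t‖).rpow_const fun _ => Or.inr h0.le)
      exact this.continuousAt
    rw [sub_self, norm_zero, Real.zero_rpow h0.ne', mul_zero] at t1
    exact squeeze_zero (fun _ => norm_nonneg _) (fun s => hol s t) t1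
  have φz : ∀ s : ℂ, 3 ≤ ‖s‖ → φ s = 0 := fun s hs => by simp [hφ, chi_zero hs]
  have φs : HasCompactSupport φ := by
    refine HasCompactSupport.intro (isCompact_closedBall (0 : ℂ) 3) fun s hs => φz s ?_
    have : ¬ ‖s‖ ≤ 3 := by simpa using hs
    linarith
  have φf : ∀ z : ℂ, ‖z‖ ≤ 1 → φ z = f z := fun z hz => by simp [hφ, chi_one hz, ret_id hz]
  set N : ℕ → ℝ := fun n => ∫ x in closedBall (0 : ℂ) 7, lc x ^ n with hN
  have N0 : ∀ n, 0 ≤ N n := fun n =>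
    setIntegral_nonneg measurableSet_closedBall fun x hx => pow_nonneg (lc_nonneg hx) n
  have NN : ∀ n, (N n)⁻¹ * N n ≤ 1 := fun n => inv_mul_le_one
  have io : ∀ {k : ℂ → ℝ}, Continuous k → IntegrableOn k (closedBall (0 : ℂ) 7) := fun hk =>
    hk.continuousOn.integrableOn_compact (isCompact_closedBall _ _)
  have hlc := lc_cont
  set h : ℕ → ℂ → ℝ := fun n z => (∫ s, (((N n)⁻¹ * φ s : ℝ) : ℂ) *
    (1 - (z - s) * ((starRingEnd ℂ) z - (starRingEnd ℂ) s) / 49) ^ n).re with hh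
  have heq : ∀ n (z : ℂ), ‖z‖ ≤ 1 → h n z = (N n)⁻¹ * ∫ u in closedBall (0 : ℂ) 7, lc u ^ n * φ (z - u) := by
    intro n z hz
    have e1 : h n z = ∫ s, (N n)⁻¹ * (lc (z - s) ^ n * φ s) := by
      simp only [hh, lc_pow]
      rw [← Complex.ofReal_re (∫ s, (N n)⁻¹ * (lc (z - s) ^ n * φ s)), ← integral_complex_ofReal]
      congr 2; ext s; push_cast; ring
    rw [e1, MeasureTheory.integral_const_mul]
    congr 1
    rw [← MeasureTheory.integral_sub_left_eq_self _ volume z]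
    simp only [sub_sub_cancel]
    rw [setIntegral_eq_integral_of_forall_compl_eq_zero]
    intro u hu
    have : ¬ ‖u‖ ≤ 7 := by simpa using hu
    rw [φz, mul_zero]
    have := norm_sub_norm_le u z
    rw [norm_sub_rev]; linarith
  refine ⟨A', hA', h, fun n => ?_, fun n => ?_, ?_⟩
  · exact pol_int (φ := fun s => (N n)⁻¹ * φ s) (by fun_prop) φs.mul_left (Q.base.pow n)
  · intro z z' hz hz'
    rw [heq n z hz, heq n z' hz', ← mul_sub, ← MeasureTheory.integral_sub (io (by fun_prop)) (io (by fun_prop)),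
      norm_mul, Real.norm_of_nonneg (inv_nonneg.2 (N0 n))]
    have b : ‖∫ u in closedBall (0 : ℂ) 7, (lc u ^ n * φ (z - u) - lc u ^ n * φ (z' - u))‖ ≤
        ∫ u in closedBall (0 : ℂ) 7, lc u ^ n * (A' * ‖z - z'‖ ^ γ) := by
      refine norm_integral_le_of_norm_le (io (by fun_prop)) ?_
      rw [ae_restrict_iff' measurableSet_closedBall]
      refine Filter.Eventually.of_forall fun u hu => ?_
      rw [← mul_sub, norm_mul, Real.norm_of_nonneg (pow_nonneg (lc_nonneg hu) n)]
      refine mul_le_mul_of_nonneg_left ?_ (pow_nonneg (lc_nonneg hu) n)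
      have := hol (z - u) (z' - u)
      rwa [sub_sub_sub_cancel_right] at this
    rw [MeasureTheory.integral_mul_const] at b
    have b2 := mul_le_mul_of_nonneg_left b (inv_nonneg.2 (N0 n))
    have b3 : 0 ≤ A' * ‖z - z'‖ ^ γ := by positivity
    have b4 := mul_le_mul_of_nonneg_right (NN n) b3
    change _ ≤ (N n)⁻¹ * (N n * _) at b2
    linarith
  · intro ε hε
    have cg : Continuous fun u : ℂ => A' * ‖u‖ ^ γ :=
      continuous_const.mul (continuous_norm.rpow_const fun _ => Or.inr h0.le)
    have p1 := lc_peak cg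
    have p2 := lc_peak (g := fun _ => 1) continuous_const
    simp only [norm_zero, Real.zero_rpow h0.ne', mul_zero] at p1
    simp only [mul_one] at p2
    have q1 := p1.eventually_le_const hε
    have q2 := p2.eventually_const_lt (show (0 : ℝ) < 1 by norm_num)
    obtain ⟨N', hN'⟩ := Filter.eventually_atTop.1 (q1.and q2)
    refine ⟨N', fun n hn z hz => ?_⟩
    obtain ⟨r1, r2⟩ := hN' n hn
    change 0 < (N n)⁻¹ * N n at r2
    change (N n)⁻¹ * _ ≤ ε at r1
    have Nne : N n ≠ 0 := by intro h; rw [h] at r2; simp at r2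
    have e : f z = (N n)⁻¹ * ∫ u in closedBall (0 : ℂ) 7, lc u ^ n * φ z := by
      rw [MeasureTheory.integral_mul_const, ← φf z hz]
      change _ = (N n)⁻¹ * (N n * _)
      field_simp
    rw [heq n z hz, e, ← mul_sub, ← MeasureTheory.integral_sub (io (by fun_prop)) (io (by fun_prop)),
      abs_mul, abs_of_nonneg (inv_nonneg.2 (N0 n))]
    refine le_trans (mul_le_mul_of_nonneg_left ?_ (inv_nonneg.2 (N0 n))) r1
    rw [← Real.norm_eq_abs]
    refine norm_integral_le_of_norm_le (io (by fun_prop)) ?_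
    rw [ae_restrict_iff' measurableSet_closedBall]
    refine Filter.Eventually.of_forall fun u hu => ?_
    rw [← mul_sub, norm_mul, Real.norm_of_nonneg (pow_nonneg (lc_nonneg hu) n)]
    refine mul_le_mul_of_nonneg_left ?_ (pow_nonneg (lc_nonneg hu) n)
    have := hol (z - u) z
    rwa [sub_sub_cancel_left, norm_neg] at this
end FN

namespace FN
open MeasureTheory intervalIntegral

lemma HolD.mono {V : Type*} [SeminormedAddCommGroup V] {γ A B : ℝ} {p : ℂ → V}
    (h : HolD γ A p) (hAB : A ≤ B) : HolD γ B p := fun z z' hz hz' =>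
  (h z z' hz hz').trans (mul_le_mul_of_nonneg_right hAB (by positivity))

lemma hol_of_contDiff {V : Type*} [NormedAddCommGroup V] [NormedSpace ℝ V] {p : ℂ → V} (hp : ContDiff ℝ 1 p)
    {γ : ℝ} (h0 : 0 < γ) (h1 : γ ≤ 1) : ∃ A, 0 ≤ A ∧ HolD γ A p := by
  obtain ⟨C, hC⟩ := (isCompact_closedBall (0 : ℂ) 1).exists_bound_of_continuousOn
    (hp.continuous_fderiv one_ne_zero).continuousOn
  refine ⟨2 * |C|, by positivity, fun z z' hz hz' => ?_⟩
  have := (convex_closedBall (0 : ℂ) 1).norm_image_sub_le_of_norm_fderiv_le (𝕜 := ℝ) (f := p) (C := |C|)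
    (fun x _ => hp.differentiable one_ne_zero x) (fun x hx => (hC x hx).trans (le_abs_self C))
    (x := z') (y := z) (by simpa using hz') (by simpa using hz)
  have h2 := le_two_rpow (norm_nonneg (z - z')) (disc_dist hz hz') h0 h1
  have := mul_le_mul_of_nonneg_left h2 (abs_nonneg C)
  linarith

lemma HolD.of_unif {V : Type*} [SeminormedAddCommGroup V] {γ A : ℝ} {p : ℕ → ℂ → V} {q : ℂ → V}
    (h : ∀ n, HolD γ A (p n))
    (hl : ∀ ε > 0, ∃ N, ∀ n ≥ N, ∀ z : ℂ, ‖z‖ ≤ 1 → ‖p n z - q z‖ ≤ ε) : HolD γ A q := by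
  intro z z' hz hz'
  refine le_of_eps (Z := 2) (by norm_num) fun ε hε => ?_
  obtain ⟨N, hN⟩ := hl ε hε
  have a := hN N le_rfl z hz
  have b := hN N le_rfl z' hz'
  have c := h N z z' hz hz'
  rw [norm_sub_rev (p N z)] at a
  have e : q z - q z' = (q z - p N z) + (p N z - p N z') + (p N z' - q z') := by abel
  rw [e]
  linarith [norm_add₃_le (a := q z - p N z) (b := p N z - p N z') (c := p N z' - q z')]

lemma SJet.adm {J} (h : SJet J) (hf : Continuous (jf J)) (hp : Continuous (jp J)) : Adm J := by
  refine ⟨?_, fun ε hε => ⟨J, h, fun z _ => by simpa using hε.le⟩⟩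
  have c1 : Continuous (jw J) := continuous_iff_continuousAt.2 fun z => (h.dw z).continuousAt
  have c2 : Continuous (jg J) := h.gj.cd.continuous
  exact c1.prodMk (c2.prodMk (hf.prodMk hp))

lemma II_small {h : ℂ → ℝ} (hc : Continuous h) {ε : ℝ} (hh : ∀ z : ℂ, ‖z‖ ≤ 1 → h z ≤ ε) : II h ≤ π * ε := by
  rw [← II_const]; exact II_mono hc continuous_const hh

lemma jf_le {J K : ℂ → Jt} {ε : ℝ} {z : ℂ} (h : ‖J z - K z‖ ≤ ε) : ‖jf J z - jf K z‖ ≤ ε := (Jt_le.1 h).2.2.1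
lemma jp_le {J K : ℂ → Jt} {ε : ℝ} {z : ℂ} (h : ‖J z - K z‖ ≤ ε) : ‖jp J z - jp K z‖ ≤ ε := (Jt_le.1 h).2.2.2

lemma linear_solve {k : ℝ} (hk0 : 0 ≤ k) (hk : k < 1) {f : ℂ → ℝ} {A : ℝ} (hA : 0 ≤ A)
    (hf : HolD (gam k) A f) : ∃ J, Adm J ∧ (∀ z : ℂ, ‖z‖ ≤ 1 → jf J z = f z) ∧
      ∃ A', 0 ≤ A' ∧ HolD (gam k) A' (jf J) ∧ HolD (gam k) A' (jp J) := by
  have g0 := gam_pos hk0 hk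
  have g1 : gam k ≤ 1 := by linarith [gam_le hk0 hk]
  obtain ⟨C, hC, ap⟩ := apriori hk0 hk
  obtain ⟨A1, hA1, h, hP, hH, hL⟩ := approx_pol g0 g1 hA hf
  obtain ⟨N0, hN0⟩ := hL 1 one_pos
  choose J hJ hJf hJp hJh using fun n => hP (n + N0)
  have adm : ∀ n, Adm (J n) := fun n => (hJ n).adm (hJf n).continuous (hJp n).continuous
  have fe : ∀ n, jf (J n) = h (n + N0) := fun n => funext (hJh n)
  set B := |f 0| + 1 + A1 with hB
  have hB0 : 0 ≤ B := by positivity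
  have bd : ∀ n, HolD (gam k) (C * B) (jf (J n)) ∧ HolD (gam k) (C * B) (jp (J n)) := by
    intro n
    obtain ⟨a1, ha1, H1⟩ := hol_of_contDiff (hJf n) g0 g1
    obtain ⟨a2, ha2, H2⟩ := hol_of_contDiff (hJp n) g0 g1
    have Hn : HolD (gam k) A1 (jf (J n)) := by rw [fe]; exact hH _
    have := ap (adm n) (A := a1 + a2) (B := B) (by positivity) hB0 (H1.mono (by linarith)) (H2.mono (by linarith))
      (fun z z' hz hz' => ?_) (fun z hz => ?_)
    · exact ⟨this.1, this.2.1⟩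
    · have a := Hn z z' hz hz'
      rw [Real.norm_eq_abs] at a
      have b : A1 * ‖z - z'‖ ^ gam k ≤ B * ‖z - z'‖ ^ gam k :=
        mul_le_mul_of_nonneg_right (by rw [hB]; linarith [abs_nonneg (f 0)]) (by positivity)
      have c := mul_nonneg hk0 (norm_nonneg (jp (J n) z - jp (J n) z'))
      linarith
    · have a := Hn.bdd g0 g1 hA1 z hz
      have b := hN0 (n + N0) (by omega) 0 (by simp)
      rw [fe] at a ⊢
      have c : |h (n + N0) 0| ≤ |h (n + N0) 0 - f 0| + |f 0| := by
        have := abs_add_le (h (n + N0) 0 - f 0) (f 0); simpa using this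
      have d := mul_nonneg hk0 (norm_nonneg (jp (J n) z))
      linarith
  have fc : ∀ ε > 0, ∃ N, ∀ m ≥ N, ∀ n ≥ N, ∀ z : ℂ, ‖z‖ ≤ 1 → |jf (J m) z - jf (J n) z| ≤ ε := by
    intro ε hε
    obtain ⟨N, hN⟩ := hL (ε / 2) (by positivity)
    refine ⟨N, fun m hm n hn z hz => ?_⟩
    rw [fe, fe]
    have a := abs_le.1 (hN (m + N0) (by omega) z hz)
    have b := abs_le.1 (hN (n + N0) (by omega) z hz)
    rw [abs_le]; constructor <;> linarith [a.1, a.2, b.1, b.2]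
  have pc := p_cauchy adm g0 (A := C * B) (by positivity) (fun n => (bd n).2) (by
    intro ε hε
    have hs : 0 < Real.sqrt (ε / π) := Real.sqrt_pos.2 (by positivity)
    obtain ⟨N, hN⟩ := fc _ hs
    refine ⟨N, fun m hm n hn => ?_⟩
    have en := ((adm m).sub (adm n)).energy
    have c1 := jf_cont (adm m).1
    have c2 := jf_cont (adm n).1
    simp only [jp_sub, jf_sub] at en
    refine en.trans ?_
    refine (II_small (ε := ε / π) (by fun_prop) fun z hz => ?_).trans_eq (by field_simp)
    have := hN m hm n hn z hz
    rw [← sq_abs, ← Real.sq_sqrt (show 0 ≤ ε / π by positivity)]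
    exact pow_le_pow_left₀ (abs_nonneg _) this 2)
  obtain ⟨K, hK, lim⟩ := Adm.limit adm (ucauchy_of_fp adm fc pc)
  refine ⟨K, hK, fun z hz => ?_, C * B, by positivity, ?_, ?_⟩
  · have : ‖jf K z - f z‖ ≤ 0 := by
      refine le_of_eps (Z := 2) (by norm_num) fun ε hε => ?_
      obtain ⟨N1, h1⟩ := lim ε hε
      obtain ⟨N2, h2⟩ := hL ε hε
      have a := jf_le (h1 (max N1 N2) (le_max_left _ _) z hz)
      have b := h2 (max N1 N2 + N0) ((le_max_right _ _).trans (Nat.le_add_right _ _)) z hz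
      rw [fe, Real.norm_eq_abs] at a
      have a := abs_le.1 a
      have b := abs_le.1 b
      rw [Real.norm_eq_abs, abs_le]; constructor <;> linarith [a.1, a.2, b.1, b.2]
    exact sub_eq_zero.1 (norm_le_zero_iff.1 this)
  · exact HolD.of_unif (fun n => (bd n).1) fun ε hε => by
      obtain ⟨N, hN⟩ := lim ε hε
      exact ⟨N, fun n hn z hz => jf_le (hN n hn z hz)⟩
  · exact HolD.of_unif (fun n => (bd n).2) fun ε hε => by
      obtain ⟨N, hN⟩ := lim ε hε
      exact ⟨N, fun n hn z hz => jp_le (hN n hn z hz)⟩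
end FN

namespace FN
open MeasureTheory intervalIntegral

lemma zero_adm : Adm (fun _ => (0, 0, 0, 0)) := by
  refine SJet.adm (J := fun _ => (0, 0, 0, 0)) ⟨⟨contDiff_const, fun z => ?_⟩, fun z => ?_, fun z _ => rfl⟩ continuous_const continuous_const
  · refine (hasFDerivAt_const (0 : ℂ) z).congr_fderiv ?_
    ext v <;> simp [dG_apply, jf, jp]
  · refine (hasFDerivAt_const (0 : ℝ) z).congr_fderiv ?_
    ext v <;> simp [dW_apply, jg]

/-- data for the nonlinear problem -/
structure Data (γ Q : ℝ) (q : ℂ → ℂ) (e : ℂ → ℝ) : Prop where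
  hq : HolD γ Q q
  he : HolD γ Q e
  bq : ∀ z : ℂ, ‖z‖ ≤ 1 → ‖q z‖ ≤ Q
  be : ∀ z : ℂ, ‖z‖ ≤ 1 → |e z| ≤ Q

structure Lip (k : ℝ) (Φ : ℂ → ℝ) : Prop where
  l : ∀ a b, |Φ a - Φ b| ≤ k * ‖a - b‖
  z : Φ 0 = 0

lemma Lip.b {k Φ} (h : Lip k Φ) (a : ℂ) : |Φ a| ≤ k * ‖a‖ := by
  have := h.l a 0; simpa [h.z] using this

structure Sln (k t : ℝ) (Φ : ℂ → ℝ) (q : ℂ → ℂ) (e : ℂ → ℝ) (J : ℂ → Jt) : Prop where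
  adm : Adm J
  hol : ∃ A, 0 ≤ A ∧ HolD (gam k) A (jf J) ∧ HolD (gam k) A (jp J)
  eq : ∀ z : ℂ, ‖z‖ ≤ 1 → jf J z = t * Φ (q z + jp J z) + e z

def Solv (k t : ℝ) (Φ : ℂ → ℝ) : Prop := ∀ q e Q, 0 ≤ Q → Data (gam k) Q q e → ∃ J, Sln k t Φ q e J

lemma solv_zero {k : ℝ} (hk0 : 0 ≤ k) (hk : k < 1) {Φ : ℂ → ℝ} : Solv k 0 Φ := by
  intro q e Q hQ hd
  obtain ⟨J, h1, h2, h3⟩ := linear_solve hk0 hk hQ hd.he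
  exact ⟨J, h1, h3, fun z hz => by rw [h2 z hz]; ring⟩

/-- difference bound for `t Φ(q+p) + e` -/
lemma Lip.diff {k t : ℝ} (hk0 : 0 ≤ k) (hk : k ≤ 1) (t0 : 0 ≤ t) (t1 : t ≤ 1) {Φ} (h : Lip k Φ) (a b c d : ℂ) :
    |t * Φ (a + b) - t * Φ (c + d)| ≤ ‖a - c‖ + k * ‖b - d‖ := by
  rw [← mul_sub, abs_mul, abs_of_nonneg t0]
  have h1 := h.l (a + b) (c + d)
  have h2 : ‖a + b - (c + d)‖ ≤ ‖a - c‖ + ‖b - d‖ := by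
    rw [add_sub_add_comm]; exact norm_add_le _ _
  have h3 : t * |Φ (a + b) - Φ (c + d)| ≤ 1 * |Φ (a + b) - Φ (c + d)| := mul_le_mul_of_nonneg_right t1 (abs_nonneg _)
  have h4 := mul_le_mul_of_nonneg_left h2 hk0
  have h5 := mul_le_mul_of_nonneg_right hk (norm_nonneg (a - c))
  linarith

lemma apriori_nl {k : ℝ} (hk0 : 0 ≤ k) (hk : k < 1) : ∃ C, 0 < C ∧ ∀ {t Q : ℝ} {Φ q e J}, 0 ≤ t → t ≤ 1 →
    Lip k Φ → 0 ≤ Q → Data (gam k) Q q e → Sln k t Φ q e J →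
    HolD (gam k) (C * Q) (jf J) ∧ HolD (gam k) (C * Q) (jp J) ∧ ∀ z : ℂ, ‖z‖ ≤ 1 → ‖J z‖ ≤ C * Q := by
  obtain ⟨C, hC, ap⟩ := apriori hk0 hk
  refine ⟨C * 2, by positivity, ?_⟩
  intro t Q Φ q e J t0 t1 hΦ hQ hd hs
  obtain ⟨A, hA, h1, h2⟩ := hs.hol
  rw [mul_assoc]
  refine ap hs.adm hA (by positivity) h1 h2 (fun z z' hz hz' => ?_) (fun z hz => ?_)
  · rw [hs.eq z hz, hs.eq z' hz']
    have a := hΦ.diff hk0 hk.le t0 t1 (q z) (jp J z) (q z') (jp J z')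
    have b := hd.hq z z' hz hz'
    have c := hd.he z z' hz hz'
    rw [Real.norm_eq_abs] at c
    rw [add_sub_add_comm]
    linarith [abs_add_le (t * Φ (q z + jp J z) - t * Φ (q z' + jp J z')) (e z - e z')]
  · rw [hs.eq z hz]
    have a := hΦ.diff hk0 hk.le t0 t1 (q z) (jp J z) 0 0
    simp only [add_zero, hΦ.z, mul_zero, sub_zero] at a
    linarith [abs_add_le (t * Φ (q z + jp J z)) (e z), hd.bq z hz, hd.be z hz]

lemma data_add {k X Q ε : ℝ} (hk0 : 0 ≤ k) (hk : k ≤ 1) (he0 : 0 ≤ ε) (he1 : ε ≤ 1) {Φ q e p} {γ : ℝ}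
    (hΦ : Lip k Φ) (hQ : 0 ≤ Q) (hX : 0 ≤ X) (hd : Data γ Q q e)
    (hp : HolD γ X p) (hpb : ∀ z : ℂ, ‖z‖ ≤ 1 → ‖p z‖ ≤ X) :
    Data γ (2 * Q + ε * X) q (fun z => ε * Φ (q z + p z) + e z) := by
  have eX := mul_nonneg he0 hX
  have key : ∀ a b c d : ℂ, |ε * Φ (a + b) - ε * Φ (c + d)| ≤ ‖a - c‖ + ε * ‖b - d‖ := by
    intro a b c d
    rw [← mul_sub, abs_mul, abs_of_nonneg he0]
    have h1 := hΦ.l (a + b) (c + d)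
    have h2 : ‖a + b - (c + d)‖ ≤ ‖a - c‖ + ‖b - d‖ := by
      rw [add_sub_add_comm]; exact norm_add_le _ _
    have h3 : k * ‖a + b - (c + d)‖ ≤ 1 * ‖a + b - (c + d)‖ := mul_le_mul_of_nonneg_right hk (norm_nonneg _)
    have h4 := mul_le_mul_of_nonneg_left (h1.trans (h3.trans ((one_mul _).le.trans h2))) he0
    have h5 := mul_le_mul_of_nonneg_right he1 (norm_nonneg (a - c))
    linarith
  refine ⟨hd.hq.mono (by linarith), fun z z' hz hz' => ?_, fun z hz => (hd.bq z hz).trans (by linarith), fun z hz => ?_⟩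
  · rw [Real.norm_eq_abs, add_sub_add_comm]
    have a := key (q z) (p z) (q z') (p z')
    have b := hd.hq z z' hz hz'
    have c := hd.he z z' hz hz'
    have d := mul_le_mul_of_nonneg_left (hp z z' hz hz') he0
    rw [Real.norm_eq_abs] at c
    linarith [abs_add_le (ε * Φ (q z + p z) - ε * Φ (q z' + p z')) (e z - e z')]
  · have a := key (q z) (p z) 0 0
    simp only [add_zero, hΦ.z, mul_zero, sub_zero] at a
    have d := mul_le_mul_of_nonneg_left (hpb z hz) he0
    linarith [abs_add_le (ε * Φ (q z + p z)) (e z), hd.bq z hz, hd.be z hz]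

lemma solv_step {k : ℝ} (hk0 : 0 ≤ k) (hk : k < 1) : ∃ ε0, 0 < ε0 ∧ ∀ {t ε : ℝ} {Φ}, 0 ≤ t → 0 ≤ ε → ε ≤ ε0 →
    t + ε ≤ 1 → Lip k Φ → Solv k t Φ → Solv k (t + ε) Φ := by
  have g0 := gam_pos hk0 hk
  obtain ⟨C, hC, ap⟩ := apriori_nl hk0 hk
  refine ⟨min (1 / (2 * C)) ((1 - k) / 2), lt_min (by positivity) (by linarith), ?_⟩
  intro t ε Φ t0 e0 ee te hΦ hS q e Q hQ hd
  have ε1 : C * ε ≤ 1 / 2 := by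
    have := mul_le_mul_of_nonneg_left (ee.trans (min_le_left _ _)) hC.le
    rwa [show C * (1 / (2 * C)) = 1 / 2 by field_simp] at this
  have ε2 : ε ≤ (1 - k) / 2 := ee.trans (min_le_right _ _)
  set X := 4 * C * Q with hX
  have hX0 : 0 ≤ X := by positivity
  have hCX : C * (2 * Q + ε * X) ≤ X := by
    have := mul_le_mul_of_nonneg_right ε1 hX0
    rw [hX] at this ⊢; linarith
  -- invariant
  set G : (ℂ → Jt) → Prop := fun J => Adm J ∧ HolD (gam k) X (jf J) ∧ HolD (gam k) X (jp J) ∧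
    ∀ z : ℂ, ‖z‖ ≤ 1 → ‖J z‖ ≤ X with hG
  have hG0 : G (fun _ => (0, 0, 0, 0)) := by
    refine ⟨zero_adm, fun z z' _ _ => ?_, fun z z' _ _ => ?_, fun z _ => ?_⟩
    · simp only [jf, sub_self, norm_zero]; positivity
    · simp only [jp, sub_self, norm_zero]; positivity
    · rw [show ((0, 0, 0, 0) : Jt) = 0 from rfl, norm_zero]; exact hX0
  have st : ∀ J, G J → ∃ J', G J' ∧ ∀ z : ℂ, ‖z‖ ≤ 1 →
      jf J' z = t * Φ (q z + jp J' z) + (ε * Φ (q z + jp J z) + e z) := by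
    intro J hJ
    have dd := data_add hk0 hk.le e0 (by linarith) hΦ hQ hX0 hd hJ.2.2.1 (fun z hz => (Jt_le.1 (hJ.2.2.2 z hz)).2.2.2)
    have hQ' : 0 ≤ 2 * Q + ε * X := by positivity
    obtain ⟨J', hJ'⟩ := hS _ _ _ hQ' dd
    obtain ⟨a1, a2, a3⟩ := ap t0 (by linarith) hΦ hQ' dd hJ'
    exact ⟨J', ⟨hJ'.adm, a1.mono hCX, a2.mono hCX, fun z hz => (a3 z hz).trans hCX⟩, hJ'.eq⟩
  choose nx nx1 nx2 using st
  set S : ℕ → {J // G J} := fun n => Nat.rec ⟨_, hG0⟩ (fun _ J => ⟨nx J.1 J.2, nx1 J.1 J.2⟩) n with hSdef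
  set J : ℕ → ℂ → Jt := fun n => (S n).1 with hJ
  have JG : ∀ n, G (J n) := fun n => (S n).2
  have JE : ∀ n, ∀ z : ℂ, ‖z‖ ≤ 1 →
      jf (J (n + 1)) z = t * Φ (q z + jp (J (n + 1)) z) + (ε * Φ (q z + jp (J n) z) + e z) :=
    fun n => nx2 (S n).1 (S n).2
  have adm : ∀ n, Adm (J n) := fun n => (JG n).1
  have fd : ∀ m n, ∀ z : ℂ, ‖z‖ ≤ 1 → |jf (J (m + 1)) z - jf (J (n + 1)) z| ≤
      k * ‖jp (J (m + 1)) z - jp (J (n + 1)) z‖ + ε * ‖jp (J m) z - jp (J n) z‖ := by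
    intro m n z hz
    rw [JE m z hz, JE n z hz]
    have a := hΦ.diff hk0 hk.le t0 (by linarith) (q z) (jp (J (m + 1)) z) (q z) (jp (J (n + 1)) z)
    have b := hΦ.l (q z + jp (J m) z) (q z + jp (J n) z)
    rw [add_sub_add_left_eq_sub] at b
    rw [sub_self, norm_zero, zero_add] at a
    have c : |ε * Φ (q z + jp (J m) z) - ε * Φ (q z + jp (J n) z)| ≤ ε * ‖jp (J m) z - jp (J n) z‖ := by
      rw [← mul_sub, abs_mul, abs_of_nonneg e0]
      refine mul_le_mul_of_nonneg_left (b.trans ?_) e0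
      have := mul_le_mul_of_nonneg_right hk.le (norm_nonneg (jp (J m) z - jp (J n) z))
      linarith
    have e1 : t * Φ (q z + jp (J (m + 1)) z) + (ε * Φ (q z + jp (J m) z) + e z) -
      (t * Φ (q z + jp (J (n + 1)) z) + (ε * Φ (q z + jp (J n) z) + e z)) =
      (t * Φ (q z + jp (J (m + 1)) z) - t * Φ (q z + jp (J (n + 1)) z)) +
      (ε * Φ (q z + jp (J m) z) - ε * Φ (q z + jp (J n) z)) := by ring
    rw [e1]
    exact (abs_add_le _ _).trans (add_le_add a c)
  set D : ℕ → ℕ → ℝ := fun m n => II (fun z => ‖jp (J m) z - jp (J n) z‖ ^ 2) with hD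
  have D1 : ∀ m n, D (m + 1) (n + 1) ≤ D m n / 4 := by
    intro m n
    have c1 := jp_cont (adm m).1
    have c2 := jp_cont (adm n).1
    have := ((adm (m + 1)).sub (adm (n + 1))).L2 hk0 hk (b := fun z => ε * ‖jp (J m) z - jp (J n) z‖)
      (by fun_prop) (fun z hz => fd m n z hz)
    simp only [jp_sub, mul_pow, II_const_mul] at this
    refine this.trans ?_
    have D0 : 0 ≤ D m n := by
      have := II_mono (h := fun _ => 0) continuous_const (k := fun z => ‖jp (J m) z - jp (J n) z‖ ^ 2)
        (by fun_prop) (fun z _ => by positivity)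
      rw [II_const, mul_zero] at this; exact this
    change ε ^ 2 * D m n / (1 - k) ^ 2 ≤ _
    have k1 : 0 < 1 - k := by linarith
    rw [div_le_div_iff₀ (by positivity) (by norm_num)]
    have : ε ^ 2 ≤ ((1 - k) / 2) ^ 2 := pow_le_pow_left₀ e0 ε2 2
    have := mul_le_mul_of_nonneg_right this D0
    linarith
  have D2 : ∀ m n, D m n ≤ π * (2 * X) ^ 2 := by
    intro m n
    have c1 := jp_cont (adm m).1
    have c2 := jp_cont (adm n).1
    refine II_small (by fun_prop) fun z hz => pow_le_pow_left₀ (norm_nonneg _) ?_ 2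
    have a := (Jt_le.1 ((JG m).2.2.2 z hz)).2.2.2
    have b := (Jt_le.1 ((JG n).2.2.2 z hz)).2.2.2
    have c := norm_sub_le (jp (J m) z) (jp (J n) z)
    unfold jp at c ⊢
    linarith
  have D3 : ∀ N m n, N ≤ m → N ≤ n → D m n ≤ π * (2 * X) ^ 2 * (1 / 4) ^ N := by
    intro N
    induction N with
    | zero => intro m n _ _; simpa using D2 m n
    | succ N ih =>
      intro m n hm hn
      obtain ⟨m, rfl⟩ : ∃ i, m = i + 1 := ⟨m - 1, by omega⟩
      obtain ⟨n, rfl⟩ : ∃ i, n = i + 1 := ⟨n - 1, by omega⟩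
      have a := ih m n (by omega) (by omega)
      have b := D1 m n
      have c : (1 / 4 : ℝ) ^ (N + 1) = (1 / 4) ^ N / 4 := by rw [pow_succ]; ring
      rw [c]; linarith
  have pc := p_cauchy adm g0 hX0 (fun n => (JG n).2.2.1) (by
    intro δ hδ
    have tt := (tendsto_pow_atTop_nhds_zero_of_lt_one (by norm_num : (0 : ℝ) ≤ 1 / 4) (by norm_num)).const_mul (π * (2 * X) ^ 2)
    rw [mul_zero] at tt
    obtain ⟨N, hN⟩ := Filter.eventually_atTop.1 (tt.eventually_le_const hδ)
    exact ⟨N, fun m hm n hn => (D3 N m n hm hn).trans (hN N le_rfl)⟩)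
  have fc : ∀ ε > 0, ∃ N, ∀ m ≥ N, ∀ n ≥ N, ∀ z : ℂ, ‖z‖ ≤ 1 → |jf (J m) z - jf (J n) z| ≤ ε := by
    intro δ hδ
    obtain ⟨N, hN⟩ := pc (δ / 2) (by positivity)
    refine ⟨N + 1, fun m hm n hn z hz => ?_⟩
    obtain ⟨m, rfl⟩ : ∃ i, m = i + 1 := ⟨m - 1, by omega⟩
    obtain ⟨n, rfl⟩ : ∃ i, n = i + 1 := ⟨n - 1, by omega⟩
    have a := hN (m + 1) (by omega) (n + 1) (by omega) z hz
    have b := hN m (by omega) n (by omega) z hz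
    have c := fd m n z hz
    have a' := mul_le_mul_of_nonneg_right hk.le (norm_nonneg (jp (J (m + 1)) z - jp (J (n + 1)) z))
    have b' := mul_le_mul_of_nonneg_right (by linarith : ε ≤ 1) (norm_nonneg (jp (J m) z - jp (J n) z))
    linarith
  obtain ⟨K, hK, lim⟩ := Adm.limit adm (ucauchy_of_fp adm fc pc)
  refine ⟨K, hK, ⟨X, hX0, ?_, ?_⟩, fun z hz => ?_⟩
  · exact HolD.of_unif (fun n => (JG n).2.1) fun ε hε => by
      obtain ⟨N, hN⟩ := lim ε hε
      exact ⟨N, fun n hn z hz => jf_le (hN n hn z hz)⟩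
  · exact HolD.of_unif (fun n => (JG n).2.2.1) fun ε hε => by
      obtain ⟨N, hN⟩ := lim ε hε
      exact ⟨N, fun n hn z hz => jp_le (hN n hn z hz)⟩
  · have : ‖jf K z - ((t + ε) * Φ (q z + jp K z) + e z)‖ ≤ 0 := by
      refine le_of_eps (Z := 3) (by norm_num) fun δ hδ => ?_
      obtain ⟨N, hN⟩ := lim δ hδ
      have a := jf_le (hN (N + 1) (by omega) z hz)
      have b := jp_le (hN (N + 1) (by omega) z hz)
      have c := jp_le (hN N le_rfl z hz)
      rw [JE N z hz, Real.norm_eq_abs] at a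
      have d1 := hΦ.diff hk0 hk.le t0 (by linarith) (q z) (jp (J (N + 1)) z) (q z) (jp K z)
      have d2 := hΦ.diff hk0 hk.le e0 (by linarith) (q z) (jp (J N) z) (q z) (jp K z)
      rw [sub_self, norm_zero, zero_add] at d1 d2
      have b' := mul_le_mul_of_nonneg_right hk.le (norm_nonneg (jp (J (N + 1)) z - jp K z))
      have c' := mul_le_mul_of_nonneg_right hk.le (norm_nonneg (jp (J N) z - jp K z))
      rw [one_mul] at b' c'
      have a := abs_le.1 a
      have d1 := abs_le.1 (d1.trans (b'.trans b))
      have d2 := abs_le.1 (d2.trans (c'.trans c))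
      rw [Real.norm_eq_abs, abs_le]
      constructor <;> linarith [a.1, a.2, d1.1, d1.2, d2.1, d2.2]
    exact sub_eq_zero.1 (norm_le_zero_iff.1 this)

lemma solv_one {k : ℝ} (hk0 : 0 ≤ k) (hk : k < 1) {Φ} (hΦ : Lip k Φ) : Solv k 1 Φ := by
  obtain ⟨ε0, hε0, st⟩ := solv_step hk0 hk
  obtain ⟨n, hn⟩ := exists_nat_gt (1 / ε0)
  have n0 : (0 : ℝ) < n := lt_trans (by positivity) hn
  have key : ∀ m : ℕ, m ≤ n → Solv k (m / n) Φ := by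
    intro m
    induction m with
    | zero => intro _; simpa using solv_zero hk0 hk
    | succ m ih =>
      intro hm
      have := st (t := m / n) (ε := 1 / n) (Φ := Φ) (by positivity) (by positivity)
        (by rw [div_le_iff₀ n0]; rw [div_lt_iff₀ hε0] at hn; linarith)
        (by rw [← add_div, div_le_one n0]; exact_mod_cast hm) hΦ (ih (by omega))
      rw [← add_div] at this
      exact_mod_cast this
  have := key n le_rfl
  rwa [div_self n0.ne'] at this

theorem main_solve {k : ℝ} (hk0 : 0 ≤ k) (hk : k < 1) : ∃ C, 0 < C ∧ ∀ {Q : ℝ} {Φ q e}, Lip k Φ → 0 ≤ Q →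
    Data (gam k) Q q e → ∃ J, Adm J ∧ (∀ z : ℂ, ‖z‖ ≤ 1 → jf J z = Φ (q z + jp J z) + e z) ∧
    HolD (gam k) (C * Q) (jf J) ∧ HolD (gam k) (C * Q) (jp J) ∧ ∀ z : ℂ, ‖z‖ ≤ 1 → ‖J z‖ ≤ C * Q := by
  obtain ⟨C, hC, ap⟩ := apriori_nl hk0 hk
  refine ⟨C, hC, ?_⟩
  intro Q Φ q e hΦ hQ hd
  obtain ⟨J, hJ⟩ := solv_one hk0 hk hΦ q e Q hQ hd
  exact ⟨J, hJ.adm, fun z hz => by rw [hJ.eq z hz, one_mul], ap zero_le_one le_rfl hΦ hQ hd hJ⟩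
end FN

namespace FN
open MeasureTheory intervalIntegral

/-- passing derivatives to uniform limits on a convex set -/
lemma deriv_limit {E F : Type*} [NormedAddCommGroup E] [NormedSpace ℝ E] [NormedAddCommGroup F] [NormedSpace ℝ F]
    {s : Set E} (hs : Convex ℝ s) {f : E → F} {f' : E → E →L[ℝ] F} (hc : ContinuousOn f' s)
    (h : ∀ ε > 0, ∃ (g : E → F) (g' : E → E →L[ℝ] F), (∀ x ∈ s, HasFDerivWithinAt g (g' x) s x) ∧
      (∀ x ∈ s, ‖g x - f x‖ ≤ ε) ∧ ∀ x ∈ s, ‖g' x - f' x‖ ≤ ε) {x : E} (hx : x ∈ s) :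
    HasFDerivWithinAt f (f' x) s x := by
  rw [hasFDerivWithinAt_iff_isLittleO, Asymptotics.isLittleO_iff]
  intro c hc0
  have h1 := hc x hx
  rw [Metric.continuousWithinAt_iff] at h1
  obtain ⟨δ, hδ, h2⟩ := h1 (c / 2) (by positivity)
  filter_upwards [inter_mem_nhdsWithin s (ball_mem_nhds x hδ)] with y hy
  refine le_of_eps (Z := 2) (by norm_num) fun ε hε => ?_
  obtain ⟨g, g', a1, a2, a3⟩ := h (min ε (c / 2)) (by positivity)
  have hcv : Convex ℝ (s ∩ ball x δ) := hs.inter (convex_ball x δ)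
  have key := Convex.norm_image_sub_le_of_norm_hasFDerivWithin_le' (𝕜 := ℝ) (f := g) (f' := g') (φ := f' x) (C := c)
    (fun z hz => (a1 z hz.1).mono inter_subset_left) (fun z hz => by
      have b1 := a3 z hz.1
      have b2 := (h2 hz.1 hz.2).le
      rw [dist_eq_norm] at b2
      have := norm_add_le (g' z - f' z) (f' z - f' x)
      rw [sub_add_sub_cancel] at this
      linarith [min_le_right ε (c / 2)]) hcv ⟨hx, mem_ball_self hδ⟩ hy
  have b1 := a2 y hy.1
  have b2 := a2 x hx
  have e : f y - f x - (f' x) (y - x) = (g y - g x - (f' x) (y - x)) - (g y - f y) + (g x - f x) := by abel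
  rw [e]
  have := norm_add_le ((g y - g x - (f' x) (y - x)) - (g y - f y)) (g x - f x)
  have := norm_sub_le (g y - g x - (f' x) (y - x)) (g y - f y)
  linarith [min_le_left ε (c / 2)]

lemma norm_dW_sub (a b : ℂ) : ‖dW a - dW b‖ ≤ ‖a - b‖ := by
  refine ContinuousLinearMap.opNorm_le_bound _ (norm_nonneg _) fun v => ?_
  have : (dW a - dW b) v = dW (a - b) v := by simp [dW_apply]; ring
  rw [this]; exact norm_dW_le _ _

lemma norm_dG_sub (a b : ℝ) (p q : ℂ) : ‖dG a p - dG b q‖ ≤ |a - b| + ‖p - q‖ := by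
  refine ContinuousLinearMap.opNorm_le_bound _ (by positivity) fun v => ?_
  have : (dG a p - dG b q) v = ((p - q) * v + ((a - b : ℝ) : ℂ) * (starRingEnd ℂ) v) / 2 := by
    simp [dG_apply]; ring
  rw [this, norm_div]
  have := norm_add_le ((p - q) * v) (((a - b : ℝ) : ℂ) * (starRingEnd ℂ) v)
  simp only [norm_mul, Complex.norm_real, RCLike.norm_conj, Real.norm_eq_abs] at this
  simp only [Complex.norm_ofNat]
  have : 0 ≤ (|a - b| + ‖p - q‖) * ‖v‖ := by positivity
  linarith

lemma dW_cont : Continuous dW := by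
  rw [continuous_iff_continuousAt]; intro t
  rw [ContinuousAt, tendsto_iff_norm_sub_tendsto_zero]
  refine squeeze_zero (fun _ => norm_nonneg _) (fun s => norm_dW_sub s t) ?_
  have : Continuous fun s : ℂ => ‖s - t‖ := by fun_prop
  simpa using this.tendsto t

lemma dG_cont : Continuous (fun x : ℝ × ℂ => dG x.1 x.2) := by
  rw [continuous_iff_continuousAt]; intro t
  rw [ContinuousAt, tendsto_iff_norm_sub_tendsto_zero]
  refine squeeze_zero (fun _ => norm_nonneg _) (fun s => norm_dG_sub s.1 t.1 s.2 t.2) ?_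
  have : Continuous fun s : ℝ × ℂ => |s.1 - t.1| + ‖s.2 - t.2‖ := by fun_prop
  simpa using this.tendsto t

lemma Adm.dw {J} (h : Adm J) {z : ℂ} (hz : z ∈ closedBall (0 : ℂ) 1) :
    HasFDerivWithinAt (jw J) (dW (jg J z)) (closedBall 0 1) z := by
  refine deriv_limit (convex_closedBall _ _) (f' := fun z => dW (jg J z)) (dW_cont.comp (jg_cont h.1)).continuousOn
    (fun ε hε => ?_) hz
  obtain ⟨S, hS, h1⟩ := h.2 ε hε
  refine ⟨jw S, fun z => dW (jg S z), fun x _ => (hS.dw x).hasFDerivWithinAt, fun x hx => ?_, fun x hx => ?_⟩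
  · exact (Jt_le.1 (h1 x (by simpa using hx))).1
  · exact (norm_dW_sub _ _).trans (Jt_le.1 (h1 x (by simpa using hx))).2.1

lemma Adm.dg {J} (h : Adm J) {z : ℂ} (hz : z ∈ closedBall (0 : ℂ) 1) :
    HasFDerivWithinAt (jg J) (dG (jf J z) (jp J z)) (closedBall 0 1) z := by
  refine deriv_limit (convex_closedBall _ _) (f' := fun z => dG (jf J z) (jp J z))
    (dG_cont.comp ((jf_cont h.1).prodMk (jp_cont h.1))).continuousOn (fun ε hε => ?_) hz
  obtain ⟨S, hS, h1⟩ := h.2 (ε / 2) (by positivity)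
  refine ⟨jg S, fun z => dG (jf S z) (jp S z), fun x _ => (hS.gj.d x).hasFDerivWithinAt, fun x hx => ?_, fun x hx => ?_⟩
  · exact (Jt_le.1 (h1 x (by simpa using hx))).2.1.trans (by linarith)
  · have a := jf_le (h1 x (by simpa using hx))
    have b := jp_le (h1 x (by simpa using hx))
    rw [Real.norm_eq_abs] at a
    linarith [norm_dG_sub (jf S x) (jf J x) (jp S x) (jp J x)]

lemma Adm.bd {J} (h : Adm J) {z : ℂ} (hz : ‖z‖ = 1) : jw J z = 0 := by
  have : ‖jw J z‖ ≤ 0 := by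
    refine le_of_eps (Z := 1) (by norm_num) fun ε hε => ?_
    obtain ⟨S, hS, h1⟩ := h.2 ε hε
    have a := (Jt_le.1 (h1 z hz.le)).1
    change |jw S z - jw J z| ≤ ε at a
    rw [hS.bd z hz, zero_sub, abs_neg] at a
    rw [Real.norm_eq_abs]; linarith
  exact norm_le_zero_iff.1 this

lemma per_angle {V : Type*} {φ : ℝ → V} (hφ : Function.Periodic φ (2 * π)) {θ ψ : ℝ} (h : (θ : Real.Angle) = ψ) :
    φ θ = φ ψ := by
  obtain ⟨k, hk⟩ := Real.Angle.angle_eq_iff_two_pi_dvd_sub.1 h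
  have : θ = ψ + k * (2 * π) := by linarith
  rw [this]; exact hφ.int_mul k ψ

lemma arg_deriv {φ : ℝ → ℝ} {φ' : ℝ} (hφ : Function.Periodic φ (2 * π)) {z : ℂ} (hz : z ≠ 0)
    (hd : HasDerivAt φ φ' z.arg) :
    HasFDerivAt (fun x : ℂ => φ x.arg) (φ' • dW (-Complex.I / z)) z := by
  have h1 : HasFDerivAt (fun x : ℂ => z.arg + (Complex.log (x / z)).im) (dW (-Complex.I / z)) z := by
    have a1 : HasDerivAt (fun x : ℂ => Complex.log (x / z)) (1 / z / (z / z)) z :=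
      ((hasDerivAt_id z).div_const z).clog (by rw [id, div_self hz]; simp)
    have a2 := (Complex.imCLM.hasFDerivAt.comp z (a1.hasFDerivAt.restrictScalars ℝ)).const_add z.arg
    refine a2.congr_fderiv ?_
    refine ContinuousLinearMap.ext fun v => ?_
    rw [dW_apply, div_self hz]
    simp only [ContinuousLinearMap.comp_apply, Complex.imCLM_apply]
    have : -Complex.I / z * v = -Complex.I * (v / z) := by ring
    rw [this]
    simp [div_eq_mul_inv]
  have e0 : z.arg + (Complex.log (z / z)).im = z.arg := by rw [div_self hz]; simp
  have h2 : HasFDerivAt (fun x : ℂ => φ (z.arg + (Complex.log (x / z)).im)) (φ' • dW (-Complex.I / z)) z := by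
    have hd' : HasDerivAt φ φ' (z.arg + (Complex.log (z / z)).im) := by rwa [e0]
    exact hd'.comp_hasFDerivAt z h1
  refine h2.congr_of_eventuallyEq ?_
  filter_upwards [isOpen_ne.mem_nhds hz] with x hx
  refine per_angle hφ ?_
  rw [Complex.log_im]
  rw [Real.Angle.coe_add, Complex.arg_div_coe_angle hx hz]
  abel

lemma tau_eq {z : ℂ} (v : ℂ) : ((dW (-Complex.I / z) v : ℝ) : ℂ) =
    -Complex.I / 2 * (v / z - (starRingEnd ℂ) v / (starRingEnd ℂ) z) := by
  rw [dW_apply, Complex.re_eq_add_conj]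
  simp
  ring

structure Circ (γ N : ℝ) (G0 G1 G2 : ℝ → ℝ) : Prop where
  p0 : Function.Periodic G0 (2 * π)
  p1 : Function.Periodic G1 (2 * π)
  p2 : Function.Periodic G2 (2 * π)
  d0 : ∀ t, HasDerivAt G0 (G1 t) t
  d1 : ∀ t, HasDerivAt G1 (G2 t) t
  b0 : ∀ t, |G0 t| ≤ N
  b1 : ∀ t, |G1 t| ≤ N
  b2 : ∀ t, |G2 t| ≤ N
  h2 : ∀ s t, |G2 s - G2 t| ≤ N * |s - t| ^ γ

def Hw (G0 : ℝ → ℝ) (z : ℂ) : ℝ := ‖z‖ ^ 4 * G0 z.arg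
def Hg (G0 G1 : ℝ → ℝ) (z : ℂ) : ℂ := z ^ 1 * (starRingEnd ℂ) z ^ 2 * (4 * (G0 z.arg : ℂ) - Complex.I * (G1 z.arg : ℂ))
def Hf (G0 G2 : ℝ → ℝ) (z : ℂ) : ℝ := ‖z‖ ^ 2 * (16 * G0 z.arg + G2 z.arg)
def Hp (G0 G1 G2 : ℝ → ℝ) (z : ℂ) : ℂ := (starRingEnd ℂ) z ^ 2 *
  (8 * (G0 z.arg : ℂ) - (G2 z.arg : ℂ) - 6 * Complex.I * (G1 z.arg : ℂ))

lemma Circ.N0 {γ N G0 G1 G2} (h : Circ γ N G0 G1 G2) : 0 ≤ N := (abs_nonneg _).trans (h.b0 0)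

lemma Hw_eq (G0 : ℝ → ℝ) (z : ℂ) : (Hw G0 z : ℂ) = z ^ 2 * (starRingEnd ℂ) z ^ 2 * G0 z.arg := by
  rw [← mul_pow, Complex.mul_conj', Hw]; push_cast; ring

lemma Circ.dHw {γ N G0 G1 G2} (h : Circ γ N G0 G1 G2) (z : ℂ) : HasFDerivAt (Hw G0) (dW (Hg G0 G1 z)) z := by
  have hN := h.N0
  by_cases hz : z = 0
  · subst hz
    have : dW (Hg G0 G1 0) = 0 := by ext <;> simp [Hg, dW_apply]
    rw [this]
    refine Asymptotics.IsBigO.hasFDerivAt (n := 4) ?_ (by norm_num)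
    refine Asymptotics.IsBigO.of_bound N (Filter.Eventually.of_forall fun x => ?_)
    rw [sub_zero, Hw, norm_mul, mul_comm]
    exact mul_le_mul (h.b0 _) le_rfl (norm_nonneg _) hN |>.trans_eq (by simp)
  · have a1 := mono_hasFDerivAt 2 2 z
    have a2 := arg_deriv h.p0 hz (h.d0 _)
    have a3 := Complex.reCLM.hasFDerivAt.comp z (a1.mul (Complex.ofRealCLM.hasFDerivAt.comp z a2))
    have e : Hw G0 = fun z : ℂ => Complex.reCLM (z ^ 2 * (starRingEnd ℂ) z ^ 2 * Complex.ofRealCLM (G0 z.arg)) := by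
      funext x
      have := congrArg Complex.re (Hw_eq G0 x)
      simpa using this
    rw [e]
    refine a3.congr_fderiv ?_
    refine ContinuousLinearMap.ext fun v => ?_
    have hz' : (starRingEnd ℂ) z ≠ 0 := by simpa using hz
    simp only [ContinuousLinearMap.comp_apply, Complex.reCLM_apply]
    apply Complex.ofReal_injective
    rw [dW_apply (Hg G0 G1 z), Complex.re_eq_add_conj, Complex.re_eq_add_conj, Hg]
    have c4 : (starRingEnd ℂ) 4 = 4 := Complex.conj_ofNat 4
    have c2 : (starRingEnd ℂ) 2 = 2 := Complex.conj_ofNat 2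
    have I2 := Complex.I_sq
    simp [tau_eq, c4, c2]
    field_simp
    ring_nf

lemma Circ.dHg {γ N G0 G1 G2} (h : Circ γ N G0 G1 G2) (z : ℂ) :
    HasFDerivAt (Hg G0 G1) (dG (Hf G0 G2 z) (Hp G0 G1 G2 z)) z := by
  have hN := h.N0
  by_cases hz : z = 0
  · subst hz
    have : dG (Hf G0 G2 0) (Hp G0 G1 G2 0) = 0 := by ext <;> simp [Hf, Hp, dG_apply]
    rw [this]
    refine Asymptotics.IsBigO.hasFDerivAt (n := 3) ?_ (by norm_num)
    refine Asymptotics.IsBigO.of_bound (5 * N) (Filter.Eventually.of_forall fun x => ?_)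
    rw [sub_zero, Hg, norm_mul]
    have a := norm_sub_le (4 * (G0 x.arg : ℂ)) (Complex.I * (G1 x.arg : ℂ))
    simp only [norm_mul, Complex.norm_real, Complex.norm_I, Real.norm_eq_abs, Complex.norm_ofNat] at a
    have b : ‖4 * (G0 x.arg : ℂ) - Complex.I * (G1 x.arg : ℂ)‖ ≤ 5 * N := by linarith [h.b0 x.arg, h.b1 x.arg]
    have c : ‖x ^ 1 * (starRingEnd ℂ) x ^ 2‖ = ‖x‖ ^ 3 := by simp; ring
    rw [c, mul_comm, norm_pow, norm_norm]
    exact mul_le_mul_of_nonneg_right b (by positivity)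
  · have a1 := mono_hasFDerivAt 1 2 z
    have a2 := arg_deriv h.p0 hz (h.d0 _)
    have a3 := arg_deriv h.p1 hz (h.d1 _)
    have a4 := a1.mul (((Complex.ofRealCLM.hasFDerivAt.comp z a2).const_mul (4 : ℂ)).sub
      ((Complex.ofRealCLM.hasFDerivAt.comp z a3).const_mul Complex.I))
    refine HasFDerivAt.congr_fderiv (f := Hg G0 G1) a4 ?_
    refine ContinuousLinearMap.ext fun v => ?_
    have hz' : (starRingEnd ℂ) z ≠ 0 := by simpa using hz
    have I2 := Complex.I_sq
    have e : ((Hf G0 G2 z : ℝ) : ℂ) = z * (starRingEnd ℂ) z * (16 * (G0 z.arg : ℂ) + (G2 z.arg : ℂ)) := by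
      rw [Complex.mul_conj', Hf]; push_cast; ring
    rw [dG_apply, Hp, e]
    simp [tau_eq]
    field_simp
    ring_nf
    simp only [I2]
    ring
end FN

namespace FN
open MeasureTheory intervalIntegral

lemma hol_arg_aux {φ : ℝ → ℂ} (hφ : Function.Periodic φ (2 * π)) {M γ : ℝ} (g0 : 0 < γ) (g1 : γ ≤ 1)
    (hM : 0 ≤ M) (hh : ∀ s t, ‖φ s - φ t‖ ≤ M * |s - t| ^ γ) {z z' : ℂ} (hz : ‖z‖ ≤ 1)
    (hle : ‖z‖ ≤ ‖z'‖) : ‖z‖ ^ 2 * ‖φ z.arg - φ z'.arg‖ ≤ 4 * M * ‖z - z'‖ ^ γ := by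
  by_cases h0 : z = 0
  · subst h0; simp only [norm_zero, zero_pow two_ne_zero, zero_mul]; positivity
  have r0 : 0 < ‖z‖ := norm_pos_iff.2 h0
  have r0' : 0 < ‖z'‖ := lt_of_lt_of_le r0 hle
  have h0' : z' ≠ 0 := norm_pos_iff.1 r0'
  set d := ‖z - z'‖ with hd
  set δ := (z / z').arg with hδ
  have e1 : φ z.arg = φ (z'.arg + δ) := by
    refine per_angle hφ ?_
    rw [Real.Angle.coe_add, hδ, Complex.arg_div_coe_angle h0 h0']; abel
  have e2 : ‖φ z.arg - φ z'.arg‖ ≤ M * |δ| ^ γ := by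
    have := hh (z'.arg + δ) z'.arg
    rwa [← e1, add_sub_cancel_left] at this
  -- the angle
  have c1 : (‖z‖ : ℂ) ≠ 0 := by exact_mod_cast r0.ne'
  have c2 : (‖z'‖ : ℂ) ≠ 0 := by exact_mod_cast r0'.ne'
  have e3 : |δ| ≤ π / 2 * ‖z / ‖z‖ - z' / ‖z'‖‖ := by
    have n1 : ‖z / (‖z‖ : ℂ)‖ = 1 := by simp [r0.ne']
    have n2 : ‖z' / (‖z'‖ : ℂ)‖ = 1 := by simp [r0'.ne']
    have a := Complex.angle_le_mul_norm_sub n1 n2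
    rw [Complex.angle_eq_abs_arg (by positivity) (by positivity)] at a
    have : (z / (‖z‖ : ℂ)) / (z' / (‖z'‖ : ℂ)) = ((‖z'‖ / ‖z‖ : ℝ) : ℂ) * (z / z') := by
      push_cast; field_simp
    rwa [this, Complex.arg_real_mul _ (by positivity)] at a
  have e4 : ‖z‖ * ‖z / ‖z‖ - z' / ‖z'‖‖ ≤ 2 * d := by
    have : ‖z‖ * ‖z / ‖z‖ - z' / ‖z'‖‖ = ‖(z - z') + z' * ((‖z'‖ - ‖z‖ : ℝ) / ‖z'‖ : ℝ)‖ := by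
      nth_rewrite 1 [← norm_norm z]
      rw [← Complex.norm_real, ← norm_mul]
      congr 1
      push_cast
      field_simp; ring
    rw [this]
    refine (norm_add_le _ _).trans ?_
    rw [norm_mul, Complex.norm_real, norm_div, norm_norm, mul_div_cancel₀ _ r0'.ne']
    have := abs_norm_sub_norm_le z' z
    rw [norm_sub_rev z' z] at this
    rw [Real.norm_eq_abs]; linarith
  have e5 : ‖z‖ * |δ| ≤ 4 * d := by
    have a := mul_le_mul_of_nonneg_left e3 r0.le
    have b := mul_le_mul_of_nonneg_left e4 (by positivity : 0 ≤ π / 2)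
    have d0 : 0 ≤ d := norm_nonneg _
    have := mul_le_mul_of_nonneg_right Real.pi_le_four d0
    linarith
  have e6 : ‖z‖ ^ 2 ≤ ‖z‖ ^ γ := by
    have := Real.rpow_le_rpow_of_exponent_ge r0 hz (by linarith : γ ≤ (2 : ℝ))
    simpa using this
  have e7 : (‖z‖ * |δ|) ^ γ ≤ 4 * d ^ γ := by
    refine (Real.rpow_le_rpow (by positivity) e5 g0.le).trans ?_
    rw [Real.mul_rpow (by norm_num) (norm_nonneg _)]
    refine mul_le_mul_of_nonneg_right ?_ (by positivity)
    have := Real.rpow_le_rpow_of_exponent_le (by norm_num : (1 : ℝ) ≤ 4) g1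
    simpa using this
  rw [Real.mul_rpow r0.le (abs_nonneg _)] at e7
  calc ‖z‖ ^ 2 * ‖φ z.arg - φ z'.arg‖ ≤ ‖z‖ ^ γ * (M * |δ| ^ γ) :=
        mul_le_mul e6 e2 (norm_nonneg _) (by positivity)
    _ = M * (‖z‖ ^ γ * |δ| ^ γ) := by ring
    _ ≤ M * (4 * d ^ γ) := mul_le_mul_of_nonneg_left e7 hM
    _ = 4 * M * d ^ γ := by ring

lemma hol_arg {φ : ℝ → ℂ} (hφ : Function.Periodic φ (2 * π)) {M γ : ℝ} (g0 : 0 < γ) (g1 : γ ≤ 1)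
    (hb : ∀ t, ‖φ t‖ ≤ M) (hh : ∀ s t, ‖φ s - φ t‖ ≤ M * |s - t| ^ γ) {m : ℂ → ℂ}
    (hm1 : ∀ z, ‖m z‖ ≤ ‖z‖ ^ 2) (hm2 : ∀ z z', ‖z‖ ≤ 1 → ‖z'‖ ≤ 1 → ‖m z - m z'‖ ≤ 2 * ‖z - z'‖) :
    HolD γ (8 * M) (fun z => m z * φ z.arg) ∧ ∀ z : ℂ, ‖z‖ ≤ 1 → ‖m z * φ z.arg‖ ≤ 8 * M := by
  have hM : 0 ≤ M := (norm_nonneg _).trans (hb 0)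
  have main : ∀ z z' : ℂ, ‖z‖ ≤ 1 → ‖z'‖ ≤ 1 → ‖z‖ ≤ ‖z'‖ →
      ‖m z * φ z.arg - m z' * φ z'.arg‖ ≤ 8 * M * ‖z - z'‖ ^ γ := by
    intro z z' hz hz' hle
    have a := hol_arg_aux hφ g0 g1 hM hh hz hle
    have e : m z * φ z.arg - m z' * φ z'.arg = m z * (φ z.arg - φ z'.arg) + (m z - m z') * φ z'.arg := by ring
    rw [e]
    refine (norm_add_le _ _).trans ?_
    rw [norm_mul, norm_mul]
    have b := mul_le_mul_of_nonneg_right (hm1 z) (norm_nonneg (φ z.arg - φ z'.arg))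
    have c : ‖m z - m z'‖ * ‖φ z'.arg‖ ≤ 2 * (2 * ‖z - z'‖ ^ γ) * M :=
      mul_le_mul ((hm2 z z' hz hz').trans (mul_le_mul_of_nonneg_left
        (le_two_rpow (norm_nonneg _) (disc_dist hz hz') g0 g1) (by norm_num))) (hb _) (norm_nonneg _) (by positivity)
    linarith
  refine ⟨fun z z' hz hz' => ?_, fun z hz => ?_⟩
  · rcases le_total ‖z‖ ‖z'‖ with h | h
    · exact main z z' hz hz' h
    · have := main z' z hz' hz h
      rwa [norm_sub_rev, norm_sub_rev z' z] at this
  · rw [norm_mul]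
    have a : ‖m z‖ ≤ 1 := (hm1 z).trans (pow_le_one₀ (norm_nonneg _) hz)
    have := mul_le_mul a (hb z.arg) (norm_nonneg _) zero_le_one
    linarith

lemma lip_hol {φ : ℝ → ℝ} {N γ : ℝ} (g0 : 0 < γ) (g1 : γ ≤ 1) {φ' : ℝ → ℝ} (hd : ∀ t, HasDerivAt φ (φ' t) t)
    (b0 : ∀ t, |φ t| ≤ N) (b1 : ∀ t, |φ' t| ≤ N) (s t : ℝ) : |φ s - φ t| ≤ 2 * N * |s - t| ^ γ := by
  have hN : 0 ≤ N := (abs_nonneg _).trans (b0 0)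
  rcases le_total |s - t| 1 with h | h
  · have a := (convex_univ (𝕜 := ℝ) (E := ℝ)).norm_image_sub_le_of_norm_hasDerivWithin_le (f := φ) (f' := φ') (C := N)
      (fun x _ => (hd x).hasDerivWithinAt) (fun x _ => b1 x) (mem_univ t) (mem_univ s)
    rw [Real.norm_eq_abs, Real.norm_eq_abs] at a
    have b : |s - t| ≤ |s - t| ^ γ := by
      have := Real.rpow_le_rpow_of_exponent_ge' (abs_nonneg (s - t)) h g0.le g1
      simpa using this
    have c := mul_le_mul_of_nonneg_left b hN
    have d : 0 ≤ N * |s - t| ^ γ := by positivity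
    linarith
  · have a := Real.one_le_rpow h g0.le
    have b := mul_le_mul_of_nonneg_left a hN
    have := abs_sub (φ s) (φ t)
    linarith [b0 s, b0 t]

lemma Circ.data {γ N G0 G1 G2} (h : Circ γ N G0 G1 G2) (g0 : 0 < γ) (g1 : γ ≤ 1) :
    Data γ (280 * N) (Hp G0 G1 G2) (fun z => - Hf G0 G2 z) := by
  have hN := h.N0
  have l0 := lip_hol g0 g1 h.d0 h.b0 h.b1
  have l1 := lip_hol g0 g1 h.d1 h.b1 h.b2
  have P := hol_arg (φ := fun t => 8 * (G0 t : ℂ) - (G2 t : ℂ) - 6 * Complex.I * (G1 t : ℂ))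
    (fun t => by simp only [h.p0 t, h.p1 t, h.p2 t]) (M := 35 * N) g0 g1 (fun t => ?_) (fun s t => ?_)
    (m := fun z => (starRingEnd ℂ) z ^ 2) (fun z => by simp) (fun z z' hz hz' => ?_)
  have R := hol_arg (φ := fun t => ((16 * G0 t + G2 t : ℝ) : ℂ))
    (fun t => by simp only [h.p0 t, h.p2 t]) (M := 35 * N) g0 g1 (fun t => ?_) (fun s t => ?_)
    (m := fun z => ((‖z‖ ^ 2 : ℝ) : ℂ)) (fun z => by simp) (fun z z' hz hz' => ?_)
  · rw [show 8 * (35 * N) = 280 * N by ring] at P R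
    refine ⟨P.1, fun z z' hz hz' => ?_, P.2, fun z hz => ?_⟩
    · have := R.1 z z' hz hz'
      simp only at this
      rw [← Complex.ofReal_mul, ← Complex.ofReal_mul, ← Complex.ofReal_sub, Complex.norm_real] at this
      rw [neg_sub_neg, norm_sub_rev]; exact this
    · have := R.2 z hz
      rw [← Complex.ofReal_mul, Complex.norm_real] at this
      rw [abs_neg]; exact this
  · rw [Complex.norm_real, Real.norm_eq_abs]
    have := abs_add_le (16 * G0 t) (G2 t)
    rw [abs_mul, abs_of_pos (by norm_num : (0 : ℝ) < 16)] at this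
    linarith [h.b0 t, h.b2 t]
  · rw [← Complex.ofReal_sub, Complex.norm_real, Real.norm_eq_abs,
      show 16 * G0 s + G2 s - (16 * G0 t + G2 t) = 16 * (G0 s - G0 t) + (G2 s - G2 t) by ring]
    have := abs_add_le (16 * (G0 s - G0 t)) (G2 s - G2 t)
    rw [abs_mul, abs_of_pos (by norm_num : (0 : ℝ) < 16)] at this
    have d : 0 ≤ N * |s - t| ^ γ := by positivity
    linarith [l0 s t, h.h2 s t]
  · rw [← Complex.ofReal_sub, Complex.norm_real, Real.norm_eq_abs, sq_sub_sq, abs_mul,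
      abs_of_nonneg (by positivity)]
    exact mul_le_mul (by linarith) (abs_norm_sub_norm_le _ _) (abs_nonneg _) (by norm_num)
  · have a1 := norm_sub_le (8 * (G0 t : ℂ) - (G2 t : ℂ)) (6 * Complex.I * (G1 t : ℂ))
    have a2 := norm_sub_le (8 * (G0 t : ℂ)) (G2 t : ℂ)
    simp only [norm_mul, Complex.norm_real, Complex.norm_I, Real.norm_eq_abs, Complex.norm_ofNat] at a1 a2
    linarith [h.b0 t, h.b1 t, h.b2 t]
  · rw [show 8 * (G0 s : ℂ) - (G2 s : ℂ) - 6 * Complex.I * (G1 s : ℂ) -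
      (8 * (G0 t : ℂ) - (G2 t : ℂ) - 6 * Complex.I * (G1 t : ℂ)) =
      8 * ((G0 s - G0 t : ℝ) : ℂ) - ((G2 s - G2 t : ℝ) : ℂ) - 6 * Complex.I * ((G1 s - G1 t : ℝ) : ℂ) by push_cast; ring]
    have a1 := norm_sub_le (8 * ((G0 s - G0 t : ℝ) : ℂ) - ((G2 s - G2 t : ℝ) : ℂ)) (6 * Complex.I * ((G1 s - G1 t : ℝ) : ℂ))
    have a2 := norm_sub_le (8 * ((G0 s - G0 t : ℝ) : ℂ)) ((G2 s - G2 t : ℝ) : ℂ)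
    rw [norm_mul (6 * Complex.I), norm_mul 6, Complex.norm_I, Complex.norm_real, Complex.norm_ofNat, Real.norm_eq_abs] at a1
    rw [norm_mul 8, Complex.norm_real, Complex.norm_real, Complex.norm_ofNat, Real.norm_eq_abs, Real.norm_eq_abs] at a2
    have d : 0 ≤ N * |s - t| ^ γ := by positivity
    linarith [l0 s t, l1 s t, h.h2 s t]
  · rw [← map_pow, ← map_pow, ← map_sub, RCLike.norm_conj, sq_sub_sq, norm_mul]
    exact mul_le_mul ((norm_add_le _ _).trans (by linarith)) le_rfl (norm_nonneg _) (by norm_num)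

/-- A `C^{2,γ}` function on the closed disc, with its derivatives. -/
structure CSol (γ A : ℝ) (Φ : ℂ → ℝ) (w : ℂ → ℝ) (g : ℂ → ℂ) (f : ℂ → ℝ) (p : ℂ → ℂ) : Prop where
  dw : ∀ z ∈ closedBall (0 : ℂ) 1, HasFDerivWithinAt w (dW (g z)) (closedBall 0 1) z
  dg : ∀ z ∈ closedBall (0 : ℂ) 1, HasFDerivWithinAt g (dG (f z) (p z)) (closedBall 0 1) z
  hf : HolD γ A f
  hp : HolD γ A p
  bw : ∀ z : ℂ, ‖z‖ ≤ 1 → |w z| ≤ A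
  bg : ∀ z : ℂ, ‖z‖ ≤ 1 → ‖g z‖ ≤ A
  bf : ∀ z : ℂ, ‖z‖ ≤ 1 → |f z| ≤ A
  bp : ∀ z : ℂ, ‖z‖ ≤ 1 → ‖p z‖ ≤ A
  eq : ∀ z : ℂ, ‖z‖ ≤ 1 → f z = Φ (p z)

theorem disc_solve {k : ℝ} (hk0 : 0 ≤ k) (hk : k < 1) : ∃ C, 0 < C ∧ ∀ {N : ℝ} {Φ G0 G1 G2}, Lip k Φ →
    Circ (gam k) N G0 G1 G2 → ∃ w g f p, CSol (gam k) (C * N) Φ w g f p ∧ ∀ z : ℂ, ‖z‖ = 1 → w z = G0 z.arg := by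
  obtain ⟨C, hC, ms⟩ := main_solve hk0 hk
  have g0 := gam_pos hk0 hk
  have g1 : gam k ≤ 1 := by linarith [gam_le hk0 hk]
  refine ⟨C * 280 + 280, by positivity, ?_⟩
  intro N Φ G0 G1 G2 hΦ hG
  have hN := hG.N0
  have hd := hG.data g0 g1
  obtain ⟨J, hJ, eq, hf, hp, hb⟩ := ms hΦ (by positivity) hd
  have cc : C * (280 * N) + 280 * N = (C * 280 + 280) * N := by ring
  refine ⟨fun z => jw J z + Hw G0 z, fun z => jg J z + Hg G0 G1 z, fun z => jf J z + Hf G0 G2 z,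
    fun z => jp J z + Hp G0 G1 G2 z, ⟨?_, ?_, ?_, ?_, ?_, ?_, ?_, ?_, ?_⟩, ?_⟩
  · intro z hz
    refine ((hJ.dw hz).add (hG.dHw z).hasFDerivWithinAt).congr_fderiv ?_
    refine ContinuousLinearMap.ext fun v => ?_
    simp [dW_apply]; ring
  · intro z hz
    refine ((hJ.dg hz).add (hG.dHg z).hasFDerivWithinAt).congr_fderiv ?_
    refine ContinuousLinearMap.ext fun v => ?_
    simp [dG_apply]; ring
  · have := hf.sub hd.he
    rw [cc] at this
    simpa only [sub_neg_eq_add] using this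
  · intro z z' hz hz'
    have a := hp z z' hz hz'
    have b := hd.hq z z' hz hz'
    rw [← cc, add_sub_add_comm]
    linarith [norm_add_le (jp J z - jp J z') (Hp G0 G1 G2 z - Hp G0 G1 G2 z')]
  · intro z hz
    have a : |jw J z| ≤ _ := (Jt_le.1 (hb z hz)).1
    have b : |Hw G0 z| ≤ N := by
      rw [Hw, abs_mul, abs_of_nonneg (by positivity)]
      have := mul_le_mul (pow_le_one₀ (norm_nonneg _) hz : ‖z‖ ^ 4 ≤ 1) (hG.b0 z.arg) (abs_nonneg _) zero_le_one
      linarith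
    linarith [abs_add_le (jw J z) (Hw G0 z)]
  · intro z hz
    have a : ‖jg J z‖ ≤ _ := (Jt_le.1 (hb z hz)).2.1
    have b : ‖Hg G0 G1 z‖ ≤ 5 * N := by
      rw [Hg, norm_mul]
      have a := norm_sub_le (4 * (G0 z.arg : ℂ)) (Complex.I * (G1 z.arg : ℂ))
      simp only [norm_mul, Complex.norm_real, Complex.norm_I, Real.norm_eq_abs, Complex.norm_ofNat] at a
      have b : ‖4 * (G0 z.arg : ℂ) - Complex.I * (G1 z.arg : ℂ)‖ ≤ 5 * N := by linarith [hG.b0 z.arg, hG.b1 z.arg]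
      have c : ‖z ^ 1 * (starRingEnd ℂ) z ^ 2‖ = ‖z‖ ^ 3 := by simp; ring
      have := mul_le_mul (pow_le_one₀ (norm_nonneg _) hz : ‖z‖ ^ 3 ≤ 1) b (norm_nonneg _) zero_le_one
      rw [c]; linarith
    linarith [norm_add_le (jg J z) (Hg G0 G1 z)]
  · intro z hz
    have a : |jf J z| ≤ _ := (Jt_le.1 (hb z hz)).2.2.1
    have b := hd.be z hz
    rw [abs_neg] at b
    linarith [abs_add_le (jf J z) (Hf G0 G2 z)]
  · intro z hz
    have a : ‖jp J z‖ ≤ _ := (Jt_le.1 (hb z hz)).2.2.2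
    have b := hd.bq z hz
    linarith [norm_add_le (jp J z) (Hp G0 G1 G2 z)]
  · intro z hz
    have := eq z hz
    rw [add_comm (jp J z)]; linarith
  · intro z hz
    change jw J z + Hw G0 z = _
    rw [hJ.bd hz, Hw, hz]; ring
end FN

namespace FN
open MeasureTheory intervalIntegral

theorem per_deriv {φ : ℝ → ℝ} (h : Function.Periodic φ (2 * π)) : Function.Periodic (deriv φ) (2 * π) := by
  intro t
  have : (fun x => φ (x + 2 * π)) = φ := funext h
  rw [← deriv_comp_add_const, this]

theorem bdd_of_per {φ : ℝ → ℝ} (h : Function.Periodic φ (2 * π)) (hc : Continuous φ) :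
    BddAbove (range fun t => |φ t|) := by
  have hb := h.isBounded_of_continuous (by positivity) hc
  obtain ⟨C, hC⟩ := hb.exists_norm_le
  exact ⟨C, by rintro _ ⟨t, rfl⟩; exact hC _ ⟨t, rfl⟩⟩

theorem circ_of_mem {α : ℝ} {g : E2 → ℝ} (h : MemHolderCircle α g) :
    Circ α (holderNormCircle α g) (onCircle g) (deriv (onCircle g)) (deriv (deriv (onCircle g))) := by
  obtain ⟨hd, H, hH⟩ := h
  have p0 : Function.Periodic (onCircle g) (2 * π) := by
    intro t; simp [onCircle, circPt]
  have p1 := per_deriv p0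
  have p2 := per_deriv p1
  have e1 : ContDiff ℝ 1 (deriv (onCircle g)) := by
    have : ContDiff ℝ (1 + 1) (onCircle g) := hd
    exact (contDiff_succ_iff_deriv.1 this).2.2
  have e2 : ContDiff ℝ 0 (deriv (deriv (onCircle g))) := by
    have : ContDiff ℝ (0 + 1) (deriv (onCircle g)) := e1
    exact (contDiff_succ_iff_deriv.1 this).2.2
  have b0 := bdd_of_per p0 hd.continuous
  have b1 := bdd_of_per p1 e1.continuous
  have b2 := bdd_of_per p2 e2.continuous
  set S : ℝ × ℝ → ℝ := fun p => if p.1 ≠ p.2 then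
        |deriv (deriv (onCircle g)) p.1 - deriv (deriv (onCircle g)) p.2| / |p.1 - p.2| ^ α
      else 0 with hS
  have b3 : BddAbove (range S) := by
    refine ⟨|H|, ?_⟩
    rintro _ ⟨p, rfl⟩
    simp only [hS]
    split_ifs with hp
    · have : 0 < |p.1 - p.2| ^ α := Real.rpow_pos_of_pos (abs_pos.2 (sub_ne_zero.2 hp)) _
      rw [div_le_iff₀ this]
      exact (hH _ _).trans (mul_le_mul_of_nonneg_right (le_abs_self _) this.le)
    · positivity
  have s0 : 0 ≤ ⨆ t : ℝ, |onCircle g t| := Real.iSup_nonneg fun t => abs_nonneg _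
  have s1 : 0 ≤ ⨆ t : ℝ, |deriv (onCircle g) t| := Real.iSup_nonneg fun t => abs_nonneg _
  have s2 : 0 ≤ ⨆ t : ℝ, |deriv (deriv (onCircle g)) t| := Real.iSup_nonneg fun t => abs_nonneg _
  have s3 : 0 ≤ ⨆ p, S p := Real.iSup_nonneg fun p => by
    simp only [hS]; split_ifs <;> positivity
  have hN : holderNormCircle α g = (⨆ t : ℝ, |onCircle g t|) + (⨆ t : ℝ, |deriv (onCircle g) t|) +
    (⨆ t : ℝ, |deriv (deriv (onCircle g)) t|) + ⨆ p, S p := rfl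
  refine ⟨p0, p1, p2, ?_, ?_, ?_, ?_, ?_, ?_⟩
  · intro t; exact (hd.differentiable (by norm_num) t).hasDerivAt
  · intro t; exact (e1.differentiable (by norm_num) t).hasDerivAt
  · intro t; linarith [le_ciSup b0 t]
  · intro t; linarith [le_ciSup b1 t]
  · intro t; linarith [le_ciSup b2 t]
  · intro s t
    by_cases hst : s = t
    · subst hst; simp
      have : 0 ≤ holderNormCircle α g := by linarith
      exact mul_nonneg this (Real.rpow_nonneg le_rfl _)
    · have : 0 < |s - t| ^ α := Real.rpow_pos_of_pos (abs_pos.2 (sub_ne_zero.2 hst)) _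
      have a := le_ciSup b3 (s, t)
      simp only [hS] at a
      rw [if_pos hst, div_le_iff₀ this] at a
      refine a.trans (mul_le_mul_of_nonneg_right ?_ this.le)
      linarith

end FN

namespace FN
open MeasureTheory intervalIntegral

/-- The Hessian matrix with Laplacian `f` and complex part `p`. -/
def hm (f : ℝ) (p : ℂ) : Mat2 := !![(f + p.re) / 2, -p.im / 2; -p.im / 2, (f - p.re) / 2]

theorem hm_herm (f : ℝ) (p : ℂ) : (hm f p).IsHermitian := by
  ext i j; fin_cases i <;> fin_cases j <;> simp [hm]

theorem hm_sub (f f' : ℝ) (p p' : ℂ) : hm f p - hm f' p' = hm (f - f') (p - p') := by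
  ext i j; fin_cases i <;> fin_cases j <;> simp [hm] <;> ring

theorem hm_zero : hm 0 0 = 0 := by
  ext i j; fin_cases i <;> fin_cases j <;> simp [hm]

theorem hm_surj {A : Mat2} (h : A.IsHermitian) : ∃ f p, A = hm f p := by
  have h01 : A 1 0 = A 0 1 := by simpa using h.apply 0 1
  refine ⟨A 0 0 + A 1 1, ⟨A 0 0 - A 1 1, -2 * A 0 1⟩, ?_⟩
  ext i j; fin_cases i <;> fin_cases j <;> simp [hm, h01] <;> ring

theorem alg_eig {a b f r : ℝ} (h1 : a + b = f) (h2 : a * b = (f ^ 2 - r ^ 2) / 4) (hr : 0 ≤ r) :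
    max a 0 + max b 0 = (max |f| r + f) / 2 ∧ max (-a) 0 + max (-b) 0 = (max |f| r - f) / 2 := by
  have h3 : (a - b) ^ 2 = r ^ 2 := by rw [← h1] at h2; linarith [h2, (by ring : (a-b)^2 = (a+b)^2 - 4*(a*b))]
  have h4 : |a - b| = r := by rw [← abs_of_nonneg hr]; exact (sq_eq_sq_iff_abs_eq_abs _ _).1 h3
  rw [← h4, ← h1]
  rcases le_total a 0 with ha | ha <;> rcases le_total b 0 with hb | hb <;>
    simp only [abs_eq_max_neg, max_def] <;> constructor <;>
  split_ifs <;> linarith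

theorem hm_norms (f : ℝ) (p : ℂ) : posNorm (hm f p) = (max |f| ‖p‖ + f) / 2 ∧
    negNorm (hm f p) = (max |f| ‖p‖ - f) / 2 := by
  have h := hm_herm f p
  rw [posNorm, negNorm, dif_pos h, dif_pos h, Fin.sum_univ_two, Fin.sum_univ_two]
  have t := h.trace_eq_sum_eigenvalues
  have d := h.det_eq_prod_eigenvalues
  simp [Fin.sum_univ_two, Fin.prod_univ_two, hm, Matrix.det_fin_two, Matrix.trace] at t d
  refine alg_eig ?_ ?_ (norm_nonneg _)
  · simp only [hm] at *; linarith
  · rw [← Complex.normSq_eq_norm_sq, Complex.normSq_apply]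
    simp only [hm] at *; linarith

theorem ell_hm {lam Lam : ℝ} {F : Mat2 → ℝ} (hF : UniformlyElliptic lam Lam F) (f f' : ℝ) (p p' : ℂ) :
    F (hm f p) - F (hm f' p') ≤ Lam * ((max |f - f'| ‖p - p'‖ + (f - f')) / 2)
      - lam * ((max |f - f'| ‖p - p'‖ - (f - f')) / 2) := by
  have := hF _ _ (hm_herm f p) (hm_herm f' p')
  rwa [hm_sub, (hm_norms _ _).1, (hm_norms _ _).2] at this

theorem exists_phi {lam Lam : ℝ} (hlam : 0 < lam) (hLam : lam ≤ Lam) {F : Mat2 → ℝ}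
    (hc : ContDiff ℝ 2 (fun A : Fin 2 → Fin 2 → ℝ => F (Matrix.of A)))
    (hF : UniformlyElliptic lam Lam F) (h0 : F 0 = 0) :
    ∃ Φ, Lip ((Lam - lam) / (Lam + lam)) Φ ∧ ∀ p, F (hm (Φ p) p) = 0 := by
  have mono : ∀ (p : ℂ) (f f' : ℝ), f ≤ f' → F (hm f p) + lam * (f' - f) ≤ F (hm f' p) := by
    intro p f f' h
    have := ell_hm hF f f' p p
    rw [sub_self, norm_zero, max_eq_left (abs_nonneg _), abs_of_nonpos (by linarith)] at this
    linarith
  have cont : ∀ p : ℂ, Continuous fun f : ℝ => F (hm f p) := by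
    intro p
    have : Continuous fun f : ℝ => (fun i j => hm f p i j : Fin 2 → Fin 2 → ℝ) := by
      refine continuous_pi fun i => continuous_pi fun j => ?_
      fin_cases i <;> fin_cases j <;> simp [hm] <;> fun_prop
    exact hc.continuous.comp this
  have ex : ∀ p : ℂ, ∃ f, F (hm f p) = 0 := by
    intro p
    set c := F (hm 0 p)
    set R := |c| / lam
    have R0 : 0 ≤ R := by positivity
    have hR : lam * R = |c| := by simp only [R]; field_simp
    have a := mono p (-R) 0 (by linarith)
    have b := mono p 0 R R0
    have := intermediate_value_Icc (by linarith : -R ≤ R) (cont p).continuousOn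
    obtain ⟨f, -, hf⟩ := this (show (0:ℝ) ∈ Icc _ _ from ⟨by
      have := le_abs_self c; linarith, by have := neg_abs_le c; linarith⟩)
    exact ⟨f, hf⟩
  choose Φ hΦ using ex
  have hs : 0 < Lam + lam := by linarith
  have key : ∀ a b, Φ b - Φ a ≤ (Lam - lam) / (Lam + lam) * max |Φ a - Φ b| ‖a - b‖ := by
    intro a b
    have := ell_hm hF (Φ a) (Φ b) a b
    rw [hΦ, hΦ] at this
    rw [div_mul_eq_mul_div, le_div_iff₀ hs]
    linarith
  have hk0 : 0 ≤ (Lam - lam) / (Lam + lam) := div_nonneg (by linarith) hs.le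
  have hk1 : (Lam - lam) / (Lam + lam) < 1 := by rw [div_lt_one hs]; linarith
  refine ⟨Φ, ⟨?_, ?_⟩, hΦ⟩
  · intro a b
    have k1 := key a b
    have k2 := key b a
    rw [abs_sub_comm (Φ b), norm_sub_rev b a] at k2
    have k3 : |Φ a - Φ b| ≤ (Lam - lam) / (Lam + lam) * max |Φ a - Φ b| ‖a - b‖ :=
      abs_le.2 ⟨by linarith, k2⟩
    rcases le_total |Φ a - Φ b| ‖a - b‖ with h | h
    · rwa [max_eq_right h] at k3
    · rw [max_eq_left h] at k3
      have : |Φ a - Φ b| ≤ 0 := by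
        by_contra hh
        push Not at hh
        have := mul_lt_mul_of_pos_right hk1 hh
        linarith
      exact this.trans (mul_nonneg hk0 (norm_nonneg _))
  · have z := hΦ 0
    have z0 : F (hm 0 0) = 0 := by rw [hm_zero, h0]
    rcases le_total (Φ 0) 0 with h | h
    · have a := mono 0 _ _ h
      have : lam * (0 - Φ 0) ≤ 0 := by linarith
      have := nonpos_of_mul_nonpos_right this hlam
      linarith
    · have a := mono 0 _ _ h
      have : lam * (Φ 0 - 0) ≤ 0 := by linarith
      have := nonpos_of_mul_nonpos_right this hlam
      linarith

end FN

namespace FN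
open MeasureTheory intervalIntegral

/-- The isometry between the Euclidean plane and the complex plane. -/
def TE : E2 ≃ₗᵢ[ℝ] ℂ := Complex.orthonormalBasisOneI.repr.symm

lemma TE_apply (x : E2) : TE x = x 0 + x 1 * Complex.I :=
  Complex.orthonormalBasisOneI_repr_symm_apply x

/-- The same isometry as a continuous linear map. -/
def TL : E2 →L[ℝ] ℂ := (TE.toContinuousLinearEquiv : E2 →L[ℝ] ℂ)

lemma TL_apply (x : E2) : TL x = TE x := rfl

/-- `dW` as a linear map. -/
def LW : ℂ →L[ℝ] (E2 →L[ℝ] ℝ) :=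
  LinearMap.toContinuousLinearMap
    { toFun := fun c => (dW c).comp TL
      map_add' := fun a b => by
        refine ContinuousLinearMap.ext fun v => ?_
        simp [dW_apply]; ring
      map_smul' := fun a b => by
        refine ContinuousLinearMap.ext fun v => ?_
        simp [dW_apply]; ring }

lemma LW_apply (c : ℂ) (x : E2) : LW c x = (c * TE x).re := rfl

lemma TE_mem {x : E2} : TE x ∈ closedBall (0 : ℂ) 1 ↔ x ∈ closedBall (0 : E2) 1 := by
  simp

lemma HolD_cont {γ A : ℝ} {V : Type*} [SeminormedAddCommGroup V] {p : ℂ → V} (hγ : 0 < γ) (h : HolD γ A p) :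
    ContinuousOn p (closedBall 0 1) := by
  intro z hz
  rw [ContinuousWithinAt, tendsto_iff_norm_sub_tendsto_zero]
  have hz' : ‖z‖ ≤ 1 := by simpa using hz
  refine squeeze_zero' (Filter.Eventually.of_forall fun _ => norm_nonneg _)
    (g := fun y => A * ‖y - z‖ ^ γ) ?_ ?_
  · filter_upwards [self_mem_nhdsWithin] with y hy
    exact h y z (by simpa using hy) hz'
  · have : Continuous fun y : ℂ => A * ‖y - z‖ ^ γ := by
      refine continuous_const.mul (Continuous.rpow_const (by fun_prop) fun _ => Or.inr hγ.le)
    have t := this.tendsto z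
    simp only [sub_self, norm_zero, Real.zero_rpow hγ.ne', mul_zero] at t
    exact t.mono_left nhdsWithin_le_nhds

lemma contDiffOn_two {E : Type*} [NormedAddCommGroup E] [NormedSpace ℝ E] {B : Set E}
    (hB : UniqueDiffOn ℝ B) {u : E → ℝ}
    {D : E → E →L[ℝ] ℝ} {D2 : E → E →L[ℝ] E →L[ℝ] ℝ} (h1 : ∀ x ∈ B, HasFDerivWithinAt u (D x) B x)
    (h2 : ∀ x ∈ B, HasFDerivWithinAt D (D2 x) B x) (h3 : ContinuousOn D2 B) : ContDiffOn ℝ 2 u B := by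
  have k1 : ContDiffOn ℝ (0 + 1) D B := by
    refine contDiffOn_succ_of_fderivWithin (fun x hx => (h2 x hx).differentiableWithinAt) (by simp) ?_
    rw [contDiffOn_zero]
    exact h3.congr fun x hx => (h2 x hx).fderivWithin (hB x hx)
  have k2 : ContDiffOn ℝ (1 + 1) u B := by
    refine contDiffOn_succ_of_fderivWithin (fun x hx => (h1 x hx).differentiableWithinAt) (by simp) ?_
    rw [zero_add] at k1
    exact k1.congr fun x hx => (h1 x hx).fderivWithin (hB x hx)
  exact k2

lemma matNorm_hm (f : ℝ) (p : ℂ) : matNorm (hm f p) ≤ |f| + 2 * ‖p‖ := by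
  simp only [matNorm, Fin.sum_univ_two, hm]
  simp only [Matrix.of_apply, Matrix.cons_val_zero, Matrix.cons_val_one, abs_div, abs_neg, abs_two,
    Matrix.cons_val', Matrix.cons_val_fin_one]
  have := abs_add_le f p.re
  have := abs_sub f p.re
  have := Complex.abs_re_le_norm p
  have := Complex.abs_im_le_norm p
  linarith

variable {γ A : ℝ} {Φ w : ℂ → ℝ} {g p : ℂ → ℂ} {f : ℂ → ℝ}

lemma CSol.D1 (h : CSol γ A Φ w g f p) {x : E2} (hx : x ∈ closedBall (0 : E2) 1) :
    HasFDerivWithinAt (fun x => w (TE x)) (LW (g (TE x))) (closedBall 0 1) x := by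
  have := (h.dw (TE x) (TE_mem.2 hx)).comp x (TL.hasFDerivAt.hasFDerivWithinAt (s := closedBall 0 1))
    (fun y hy => TE_mem.2 hy)
  exact this

lemma CSol.D2 (h : CSol γ A Φ w g f p) {x : E2} (hx : x ∈ closedBall (0 : E2) 1) :
    HasFDerivWithinAt (fun x => LW (g (TE x))) (LW.comp ((dG (f (TE x)) (p (TE x))).comp TL)) (closedBall 0 1) x := by
  have := (h.dg (TE x) (TE_mem.2 hx)).comp x (TL.hasFDerivAt.hasFDerivWithinAt (s := closedBall 0 1))
    (fun y hy => TE_mem.2 hy)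
  exact LW.hasFDerivAt.comp_hasFDerivWithinAt x this

lemma CSol.contDiff (hγ : 0 < γ) (h : CSol γ A Φ w g f p) :
    ContDiffOn ℝ 2 (fun x => w (TE x)) (closedBall (0 : E2) 1) := by
  refine contDiffOn_two (uniqueDiffOn_convex (convex_closedBall _ _) ?_) (fun x hx => h.D1 hx)
    (fun x hx => h.D2 hx) ?_
  · exact ⟨0, ball_subset_interior_closedBall (by simp)⟩
  · have c : ContinuousOn (fun x : E2 => dG (f (TE x)) (p (TE x))) (closedBall 0 1) := by
      have m : MapsTo TE (closedBall (0 : E2) 1) (closedBall 0 1) := fun y hy => TE_mem.2 hy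
      have c1 := (HolD_cont hγ h.hf).comp TE.continuous.continuousOn m
      have c2 := (HolD_cont hγ h.hp).comp TE.continuous.continuousOn m
      have c3 := c1.prodMk c2
      have := dG_cont.comp_continuousOn c3
      exact this
    have c4 : ContinuousOn (fun x : E2 => (dG (f (TE x)) (p (TE x))).comp TL) (closedBall 0 1) :=
      ((ContinuousLinearMap.compL ℝ E2 ℂ ℂ).flip TL).continuous.comp_continuousOn c
    exact ((ContinuousLinearMap.compL ℝ E2 ℂ (E2 →L[ℝ] ℝ)) LW).continuous.comp_continuousOn c4

lemma CSol.fderiv (h : CSol γ A Φ w g f p) {x : E2} (hx : x ∈ ball (0 : E2) 1) :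
    fderiv ℝ (fun x => w (TE x)) x = LW (g (TE x)) :=
  ((h.D1 (ball_subset_closedBall hx)).hasFDerivAt
    (Filter.mem_of_superset (isOpen_ball.mem_nhds hx) ball_subset_closedBall)).fderiv

lemma CSol.hess (h : CSol γ A Φ w g f p) {x : E2} (hx : x ∈ ball (0 : E2) 1) :
    hess (fun x => w (TE x)) x = hm (f (TE x)) (p (TE x)) := by
  have k := (h.D2 (ball_subset_closedBall hx)).hasFDerivAt
    (Filter.mem_of_superset (isOpen_ball.mem_nhds hx) ball_subset_closedBall)
  have e : ∀ i j, _root_.hess (fun x => w (TE x)) x i j =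
      (dG (f (TE x)) (p (TE x)) (TE (EuclideanSpace.single i 1)) * TE (EuclideanSpace.single j 1)).re := by
    intro i j
    have ev : (fun y => _root_.fderiv ℝ (fun x => w (TE x)) y (EuclideanSpace.single j (1:ℝ))) =ᶠ[nhds x]
        fun y => LW (g (TE y)) (EuclideanSpace.single j (1:ℝ)) := by
      filter_upwards [isOpen_ball.mem_nhds hx] with y hy
      rw [h.fderiv hy]
    have k2 := k.clm_apply (hasFDerivAt_const (EuclideanSpace.single j (1:ℝ) : E2) x)
    simp only [_root_.hess, Matrix.of_apply]
    rw [ev.fderiv_eq, k2.fderiv]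
    simp [LW_apply, TL_apply]
  ext i j
  rw [e]
  fin_cases i <;> fin_cases j <;> simp [hm, TE_apply, dG_apply] <;> ring

end FN

namespace FN
open MeasureTheory intervalIntegral

lemma second_test {h h' : ℝ → ℝ} {c : ℝ} (h1 : ∀ᶠ t in nhds (0:ℝ), HasDerivAt h (h' t) t)
    (h2 : HasDerivAt h' c 0) (hm : IsLocalMax h 0) : c ≤ 0 := by
  by_contra hc
  push Not at hc
  have e : deriv h =ᶠ[nhds 0] h' := h1.mono fun t ht => ht.deriv
  have d2 : deriv (deriv h) 0 = c := by rw [e.deriv_eq, h2.deriv]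
  have mn : IsLocalMin h 0 :=
    isLocalMin_of_deriv_deriv_pos (by rw [d2]; exact hc) hm.deriv_eq_zero h1.self_of_nhds.continuousAt
  have k : h =ᶠ[nhds 0] fun _ => h 0 := by
    filter_upwards [hm, mn] with t a b
    exact le_antisymm a b
  have k2 := k.deriv
  have : deriv (deriv h) 0 = 0 := by
    rw [k2.deriv_eq]; simp
  linarith

lemma hess_eq {u : E2 → ℝ} {x : E2} (hu : ContDiffAt ℝ 2 u x) (i j : Fin 2) :
    hess u x i j = fderiv ℝ (fderiv ℝ u) x (EuclideanSpace.single i 1) (EuclideanSpace.single j 1) := by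
  have d : DifferentiableAt ℝ (fderiv ℝ u) x :=
    (hu.fderiv_right (m := 1) (by norm_num)).differentiableAt (by norm_num)
  have k2 := d.hasFDerivAt.clm_apply (hasFDerivAt_const (EuclideanSpace.single j (1:ℝ) : E2) x)
  simp only [hess, Matrix.of_apply]
  rw [k2.fderiv]
  simp

lemma hess_herm {u : E2 → ℝ} {x : E2} (hu : ContDiffAt ℝ 2 u x) : (hess u x).IsHermitian := by
  refine Matrix.IsHermitian.ext fun i j => ?_
  rw [hess_eq hu, hess_eq hu]
  have := hu.isSymmSndFDerivAt (by simp)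
  simpa using this.eq _ _

lemma line_deriv {u : E2 → ℝ} {x : E2} (hu : ContDiffAt ℝ 2 u x) (e : E2) :
    (∀ᶠ t in nhds (0:ℝ), HasDerivAt (fun t : ℝ => u (x + t • e)) (fderiv ℝ u (x + t • e) e) t) ∧
    HasDerivAt (fun t : ℝ => fderiv ℝ u (x + t • e) e) (fderiv ℝ (fderiv ℝ u) x e e) 0 := by
  have l : ∀ t : ℝ, HasDerivAt (fun t : ℝ => x + t • e) e t := by
    intro t
    simpa using ((hasDerivAt_id t).smul_const e).const_add x
  have t0 : Filter.Tendsto (fun t : ℝ => x + t • e) (nhds 0) (nhds x) := by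
    have := (l 0).continuousAt.tendsto
    simpa using this
  constructor
  · have ev : ∀ᶠ y in nhds x, ContDiffAt ℝ 2 u y := hu.eventually (by simp)
    filter_upwards [t0.eventually ev] with t ht
    exact ((ht.differentiableAt (by norm_num)).hasFDerivAt).comp_hasDerivAt t (l t)
  · have d : DifferentiableAt ℝ (fderiv ℝ u) x :=
      (hu.fderiv_right (m := 1) (by norm_num)).differentiableAt (by norm_num)
    have d' : HasFDerivAt (fderiv ℝ u) (fderiv ℝ (fderiv ℝ u) x) (x + (0:ℝ) • e) := by
      simpa using d.hasFDerivAt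
    have k := HasFDerivAt.comp_hasDerivAt (0:ℝ) d' (l 0)
    exact ((ContinuousLinearMap.apply ℝ ℝ e).hasFDerivAt (x := fderiv ℝ u (x + (0:ℝ) • e))).comp_hasDerivAt (0:ℝ) k

lemma hess_quad {u : E2 → ℝ} {x : E2} (hu : ContDiffAt ℝ 2 u x) (a b : ℝ) :
    fderiv ℝ (fderiv ℝ u) x (a • EuclideanSpace.single 0 1 + b • EuclideanSpace.single 1 1)
      (a • EuclideanSpace.single 0 1 + b • EuclideanSpace.single 1 1) =
    a ^ 2 * hess u x 0 0 + a * b * (hess u x 0 1 + hess u x 1 0) + b ^ 2 * hess u x 1 1 := by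
  simp only [hess_eq hu, map_add, map_smul, ContinuousLinearMap.add_apply, ContinuousLinearMap.smul_apply,
    smul_eq_mul]
  ring

lemma cmp_le {lam Lam : ℝ} (hlam : 0 < lam) {F : Mat2 → ℝ} (hF : UniformlyElliptic lam Lam F)
    {α : ℝ} {g u₁ u₂ : E2 → ℝ} (h₁ : IsC2alphaSolution α F g u₁) (h₂ : IsC2alphaSolution α F g u₂)
    {x₀ : E2} (hx₀ : x₀ ∈ closedBall (0 : E2) 1) : u₁ x₀ ≤ u₂ x₀ := by
  by_contra hc
  push Not at hc
  obtain ⟨c₁, -, e₁, b₁⟩ := h₁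
  obtain ⟨c₂, -, e₂, b₂⟩ := h₂
  set ε := (u₁ x₀ - u₂ x₀) / 2 with hε
  have ε0 : 0 < ε := by rw [hε]; linarith
  set φ : E2 → ℝ := fun x => u₁ x - u₂ x + ε * ‖x‖ ^ 2 with hφ
  have cφ : ContinuousOn φ (closedBall (0 : E2) 1) :=
    (c₁.continuousOn.sub c₂.continuousOn).add (Continuous.continuousOn (by fun_prop))
  obtain ⟨x, hx, mx⟩ := (isCompact_closedBall (0 : E2) 1).exists_isMaxOn ⟨x₀, hx₀⟩ cφ
  have hge : φ x₀ ≤ φ x := mx hx₀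
  have hxb : x ∈ ball (0 : E2) 1 := by
    by_contra hn
    have hs : x ∈ sphere (0 : E2) 1 := by
      rw [mem_sphere]; exact le_antisymm hx (not_lt.1 hn)
    have n : ‖x‖ = 1 := by simpa using hs
    have a : φ x = ε := by simp only [hφ]; rw [b₁ x hs, b₂ x hs, n]; ring
    have b : 2 * ε ≤ φ x₀ := by simp only [hφ]; have : 0 ≤ ε * ‖x₀‖ ^ 2 := by positivity
                                linarith
    linarith
  have nb : closedBall (0 : E2) 1 ∈ nhds x := Filter.mem_of_superset (isOpen_ball.mem_nhds hxb) ball_subset_closedBall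
  have lm : IsLocalMax φ x := mx.isLocalMax nb
  have k₁ : ContDiffAt ℝ 2 u₁ x := c₁.contDiffAt nb
  have k₂ : ContDiffAt ℝ 2 u₂ x := c₂.contDiffAt nb
  have H : ∀ e : E2, fderiv ℝ (fderiv ℝ u₁) x e e - fderiv ℝ (fderiv ℝ u₂) x e e + ε * (2 * ‖e‖ ^ 2) ≤ 0 := by
    intro e
    obtain ⟨p₁, q₁⟩ := line_deriv k₁ e
    obtain ⟨p₂, q₂⟩ := line_deriv k₂ e
    have nn : ∀ t : ℝ, ‖x + t • e‖ ^ 2 = ‖x‖ ^ 2 + t * (2 * inner ℝ x e) + t ^ 2 * ‖e‖ ^ 2 := by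
      intro t
      rw [norm_add_sq_real, inner_smul_right, norm_smul, mul_pow, Real.norm_eq_abs, sq_abs]; ring
    have lm' : IsLocalMax (fun t : ℝ => u₁ (x + t • e) - u₂ (x + t • e) +
        ε * (‖x‖ ^ 2 + t * (2 * inner ℝ x e) + t ^ 2 * ‖e‖ ^ 2)) 0 := by
      have t0 : Filter.Tendsto (fun t : ℝ => x + t • e) (nhds 0) (nhds x) := by
        have : Continuous (fun t : ℝ => x + t • e) := by fun_prop
        simpa using this.tendsto 0
      filter_upwards [t0.eventually lm] with t ht
      simp only [hφ] at ht
      rw [nn] at ht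
      simpa using ht
    refine second_test (h' := fun t : ℝ => fderiv ℝ u₁ (x + t • e) e - fderiv ℝ u₂ (x + t • e) e +
      ε * (2 * inner ℝ x e + 2 * t * ‖e‖ ^ 2)) ?_ ?_ lm'
    · filter_upwards [p₁, p₂] with t a₁ a₂
      refine (a₁.sub a₂).add (HasDerivAt.const_mul ε ?_)
      have := (((hasDerivAt_id t).mul_const (2 * inner ℝ x e)).const_add (‖x‖ ^ 2)).add
        ((hasDerivAt_pow 2 t).mul_const (‖e‖ ^ 2))
      exact this.congr_deriv (by simp)
    · refine (q₁.sub q₂).add (HasDerivAt.const_mul ε ?_)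
      have := (((hasDerivAt_id (0:ℝ)).const_mul 2).mul_const (‖e‖ ^ 2)).const_add (2 * inner ℝ x e)
      exact this.congr_deriv (by simp)
  have H1 := hess_herm k₁
  have H2 := hess_herm k₂
  obtain ⟨f₁, q₁, m₁⟩ := hm_surj H1
  obtain ⟨f₂, q₂, m₂⟩ := hm_surj H2
  have Q : ∀ a b : ℝ, a ^ 2 * ((f₁ - f₂ + (q₁ - q₂).re) / 2) - a * b * (q₁ - q₂).im +
      b ^ 2 * ((f₁ - f₂ - (q₁ - q₂).re) / 2) + ε * (2 * (a ^ 2 + b ^ 2)) ≤ 0 := by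
    intro a b
    have := H (a • EuclideanSpace.single 0 1 + b • EuclideanSpace.single 1 1)
    rw [hess_quad k₁, hess_quad k₂, m₁, m₂] at this
    have n : ‖(a • EuclideanSpace.single 0 1 + b • EuclideanSpace.single 1 1 : E2)‖ ^ 2 = a ^ 2 + b ^ 2 := by
      rw [EuclideanSpace.norm_sq_eq]; simp
    rw [n] at this
    simp [hm] at this
    simp only [Complex.sub_re, Complex.sub_im]
    linarith
  have E := ell_hm hF f₁ f₂ q₁ q₂
  rw [← m₁, ← m₂, e₁ x hxb, e₂ x hxb] at E
  set f := f₁ - f₂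
  set q := q₁ - q₂
  have r0 := Q 1 0
  have r1 := Q 0 1
  have r2 := Q ((f - q.re) / 2) (q.im / 2)
  have s1 : (f - q.re) / 2 < 0 := by linarith
  have fn : f < 0 := by linarith
  have det : 0 ≤ (f ^ 2 - (q.re * q.re + q.im * q.im)) := by
    by_contra hd
    push Not at hd
    have pr := mul_pos_of_neg_of_neg s1 hd
    have sq1 : 0 ≤ ε * (2 * (((f - q.re) / 2) ^ 2 + (q.im / 2) ^ 2)) := by positivity
    linarith [(by ring : (f - q.re) / 2 * (f ^ 2 - (q.re * q.re + q.im * q.im)) = 4 * (((f - q.re) / 2) ^ 2 * ((f + q.re) / 2) - (f - q.re) / 2 * (q.im / 2) * q.im + (q.im / 2) ^ 2 * ((f - q.re) / 2)))]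
  have nq : ‖q‖ ≤ |f| := by
    rw [← abs_of_nonneg (norm_nonneg q), ← sq_le_sq, ← Complex.normSq_eq_norm_sq, Complex.normSq_apply]
    linarith
  rw [max_eq_left nq, abs_of_neg fn] at E
  have := mul_neg_of_pos_of_neg hlam fn
  linarith

lemma norm_LW (c : ℂ) : ‖LW c‖ ≤ ‖c‖ := by
  refine ContinuousLinearMap.opNorm_le_bound _ (norm_nonneg _) fun v => ?_
  rw [LW_apply]
  have := norm_dW_le c (TE v)
  rw [TE.norm_map] at this
  exact this

lemma circPt_arg {x : E2} (hx : x ∈ sphere (0 : E2) 1) : circPt (Complex.arg (TE x)) = x := by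
  have n : ‖TE x‖ = 1 := by simpa using hx
  have n0 : TE x ≠ 0 := by intro h; rw [h] at n; simp at n
  ext i
  fin_cases i
  · simp [circPt, Complex.cos_arg n0, n]; simp [TE_apply]
  · simp [circPt, Complex.sin_arg, n]; simp [TE_apply]

end FN

/-- Existence and uniqueness of classical solutions: there are universal constants
`ᾱ ∈ (0,1)` and `C > 0` depending only on `lam, Lam` such that for any `C²` uniformly
elliptic `F` with `F(0) = 0` and any `g ∈ C^{2,ᾱ}(∂B₁)` there is a unique classical
solution `u ∈ C^{2,ᾱ}(B̄₁)` of `F(D²u) = 0` in `B₁`, `u = g` on `∂B₁`; moreover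
`‖u‖_{C^{2,ᾱ}(B̄₁)} ≤ C ‖g‖_{C^{2,ᾱ}(∂B₁)}`. -/
theorem exists_unique_classical_solution (lam Lam : ℝ) (hlam : 0 < lam) (hLam : lam ≤ Lam) :
    ∃ α C : ℝ, α ∈ Set.Ioo (0 : ℝ) 1 ∧ 0 < C ∧
      ∀ (F : Mat2 → ℝ) (g : E2 → ℝ),
        ContDiff ℝ 2 (fun A : Fin 2 → Fin 2 → ℝ => F (Matrix.of A)) →
        UniformlyElliptic lam Lam F → F 0 = 0 →
        MemHolderCircle α g →
        (∃ u : E2 → ℝ, IsC2alphaSolution α F g u ∧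
          (∀ x ∈ ball (0 : E2) 1,
            |u x| ≤ C * holderNormCircle α g ∧
            ‖fderiv ℝ u x‖ ≤ C * holderNormCircle α g ∧
            matNorm (hess u x) ≤ C * holderNormCircle α g) ∧
          (∀ x ∈ ball (0 : E2) 1, ∀ y ∈ ball (0 : E2) 1,
            matNorm (hess u x - hess u y) ≤ C * holderNormCircle α g * ‖x - y‖ ^ α)) ∧
        (∀ u₁ u₂ : E2 → ℝ, IsC2alphaSolution α F g u₁ → IsC2alphaSolution α F g u₂ →
          EqOn u₁ u₂ (closedBall (0 : E2) 1)) := by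
  have hs : 0 < Lam + lam := by linarith
  have hk0 : 0 ≤ (Lam - lam) / (Lam + lam) := div_nonneg (by linarith) hs.le
  have hk1 : (Lam - lam) / (Lam + lam) < 1 := by rw [div_lt_one hs]; linarith
  obtain ⟨C, hC, sol⟩ := FN.disc_solve hk0 hk1
  have a0 := FN.gam_pos hk0 hk1
  have a1 := FN.gam_le hk0 hk1
  refine ⟨FN.gam ((Lam - lam) / (Lam + lam)), 3 * C, ⟨a0, by linarith⟩, by positivity, ?_⟩
  intro F g hc hF h0 hg
  constructor
  · obtain ⟨Φ, hΦ, hz⟩ := FN.exists_phi hlam hLam hc hF h0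
    have hcirc := FN.circ_of_mem hg
    have hN := hcirc.N0
    set N := holderNormCircle (FN.gam ((Lam - lam) / (Lam + lam))) g
    set α := FN.gam ((Lam - lam) / (Lam + lam))
    obtain ⟨w, G, f, p, h, hb⟩ := sol hΦ hcirc
    have hCN : 0 ≤ C * N := by positivity
    have n1 : ∀ {x : E2}, x ∈ ball (0 : E2) 1 → ‖FN.TE x‖ ≤ 1 := by
      intro x hx
      simpa using (mem_ball_zero_iff.1 hx).le
    have hol : ∀ x ∈ ball (0 : E2) 1, ∀ y ∈ ball (0 : E2) 1,
        matNorm (hess (fun x => w (FN.TE x)) x - hess (fun x => w (FN.TE x)) y) ≤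
          3 * C * N * ‖x - y‖ ^ α := by
      intro x hx y hy
      rw [h.hess hx, h.hess hy, FN.hm_sub]
      refine (FN.matNorm_hm _ _).trans ?_
      have A := h.hf _ _ (n1 hx) (n1 hy)
      have B := h.hp _ _ (n1 hx) (n1 hy)
      rw [← map_sub, FN.TE.norm_map] at A B
      rw [Real.norm_eq_abs] at A
      linarith
    refine ⟨fun x => w (FN.TE x), ⟨h.contDiff a0, ⟨_, hol⟩, ?_, ?_⟩, ?_, hol⟩
    · intro x hx
      rw [h.hess hx, h.eq _ (n1 hx)]; exact hz _
    · intro x hx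
      have e := hb (FN.TE x) (by simpa using hx)
      simp only [e, onCircle, FN.circPt_arg hx]
    · intro x hx
      have r1 := h.bw _ (n1 hx)
      have r2 := h.bg _ (n1 hx)
      have r3 := h.bf _ (n1 hx)
      have r4 := h.bp _ (n1 hx)
      refine ⟨by linarith, ?_, ?_⟩
      · rw [h.fderiv hx]
        linarith [FN.norm_LW (G (FN.TE x))]
      · rw [h.hess hx]
        linarith [FN.matNorm_hm (f (FN.TE x)) (p (FN.TE x))]
  · intro u₁ u₂ h₁ h₂ x hx
    exact le_antisymm (FN.cmp_le hlam hF h₁ h₂ hx) (FN.cmp_le hlam hF h₂ h₁ hx)
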